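/- Let d ≥ 1, let M be a subcomplex of I^a of dimension d whose geometric realization |M| is a compact topological d-manifold without boundary (in particular a ℤ/2-homology d-manifold, the paper's hypothesis), and let N be a subcomplex of I^b of dimension d whose geometric realization |N| is likewise a compact topological d-manifold without boundary. If Skel_{⌊d/2⌋+1} M and Skel_{⌊d/2⌋+1} N are isomorphic, then M and N are isomorphic. -/

import Mathlib

/-- A face of the cube `I^n`: `none` marks a free coordinate. -/
def CubeFace (n : ℕ) : Type := Fin n → Option Bool

namespace CubeFace

/-- The order on faces of the cube: `F ≤ G` iff every coordinate of `G` is free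
or agrees with the corresponding coordinate of `F`. -/
instance (n : ℕ) : PartialOrder (CubeFace n) where
  le F G := ∀ i, G i = none ∨ F i = G i
  le_refl F i := Or.inr rfl
  le_trans F G H h1 h2 i := by
    rcases h2 i with h | h
    · exact Or.inl h
    · rcases h1 i with h' | h'
      · exact Or.inl (h ▸ h')
      · exact Or.inr (h' ▸ h)
  le_antisymm F G h1 h2 := by
    funext i
    rcases h1 i with h | h
    · rcases h2 i with h' | h'
      · rw [h, h']
      · rw [← h', h]
    · exact h

/-- The face of `I^n` corresponding to a vertex. -/
def toFace {n : ℕ} (v : Fin n → Bool) : CubeFace n := fun i => some (v i)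

/-- The vertex set of a face. -/
def verts {n : ℕ} (F : CubeFace n) : Set (Fin n → Bool) := {v | toFace v ≤ F}

/-- The dimension of a face: its number of free coordinates. -/
def dim {n : ℕ} (F : CubeFace n) : ℕ :=
  (@Finset.filter (Fin n) (fun i => F i = none) (fun i => Option.instDecidableEq (F i) none)
    Finset.univ).card

/-- A subcomplex of `I^n`: a nonempty, downward closed set of faces. -/
def IsSubcomplex {n : ℕ} (K : Set (CubeFace n)) : Prop :=
  K.Nonempty ∧ ∀ F ∈ K, ∀ G : CubeFace n, G ≤ F → G ∈ K

/-- The vertex set of a subcomplex. -/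
def cvert {n : ℕ} (K : Set (CubeFace n)) : Set (Fin n → Bool) := {v | toFace v ∈ K}

/-- A subcomplex `Γ ⊆ K` is face-like if, for every face `F` of `K`, the set of vertices
of `F` belonging to `Γ` is empty or the vertex set of a face of `Γ`. -/
def FaceLike {n : ℕ} (K Γ : Set (CubeFace n)) : Prop :=
  ∀ F ∈ K, verts F ∩ cvert Γ = ∅ ∨ ∃ G ∈ Γ, verts F ∩ cvert Γ = verts G

/-- The deletion `K ∖ Γ`: the faces of `K` with no vertex in `Γ`. -/
def delete {n : ℕ} (K Γ : Set (CubeFace n)) : Set (CubeFace n) :=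
  {F | F ∈ K ∧ verts F ∩ cvert Γ = ∅}

/-- The geometric realization of a subcomplex of `I^n`, as a subset of `ℝ^n`. -/
def real {n : ℕ} (K : Set (CubeFace n)) : Set (Fin n → ℝ) :=
  ⋃ F ∈ K, {x | (∀ i, 0 ≤ x i ∧ x i ≤ 1) ∧
    ∀ i, (F i = some false → x i = 0) ∧ (F i = some true → x i = 1)}

/-- The boundary `∂F̂` of a face `F`: all faces strictly below `F`. -/
def bdryHat {n : ℕ} (F : CubeFace n) : Set (CubeFace n) := {G | G ≤ F ∧ G ≠ F}

/-- The boundary of the cube `I^k`: all faces except the top one. -/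
def boundaryCube (k : ℕ) : Set (CubeFace k) := {F | F ≠ fun _ => none}

/-- The `k`-skeleton of a subcomplex. -/
def skel {n : ℕ} (k : ℕ) (K : Set (CubeFace n)) : Set (CubeFace n) :=
  {F | F ∈ K ∧ dim F ≤ k}

/-- Isomorphism of cubical subcomplexes: a bijection between the vertex sets under which
vertex sets of faces correspond to vertex sets of faces. -/
def Iso {m n : ℕ} (K : Set (CubeFace m)) (L : Set (CubeFace n)) : Prop :=
  ∃ f : (Fin m → Bool) → (Fin n → Bool),
    Set.BijOn f (cvert K) (cvert L) ∧
    ∀ W : Set (Fin m → Bool), W ⊆ cvert K →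
      ((∃ F ∈ K, verts F = W) ↔ (∃ G ∈ L, verts G = f '' W))

/-- `K` has dimension `d`. -/
def HasDim {n : ℕ} (K : Set (CubeFace n)) (d : ℕ) : Prop :=
  (∀ F ∈ K, dim F ≤ d) ∧ ∃ F ∈ K, dim F = d

end CubeFace

open CategoryTheory in
/-- The `j`-th singular homology of a topological space with coefficients in `R`. -/
noncomputable def sHomology (R : Type) [CommRing R] (X : Type) [TopologicalSpace X]
    (j : ℕ) : ModuleCat R :=
  ((AlgebraicTopology.alternatingFaceMapComplex (ModuleCat R)).obj
    (((SimplicialObject.whiskering _ _).obj (ModuleCat.free R)).obj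
      (TopCat.toSSet.obj (TopCat.of X)))).homology j

/-- `X` is a compact topological `d`-manifold without boundary. -/
def IsCompactManifold (X : Type) [TopologicalSpace X] (d : ℕ) : Prop :=
  CompactSpace X ∧ Nonempty (ChartedSpace (EuclideanSpace ℝ (Fin d)) X)


namespace CubManif
open Finsupp

/-- Chains with coefficients in `ℤ/2`. -/
abbrev Ch (B : Type) := B →₀ ZMod 2

/-- A based chain complex over `ℤ/2`. -/
structure BC (B : Type) where
  d : Ch B →ₗ[ZMod 2] Ch B
  deg : B → ℕ
  dd : ∀ z, d (d z) = 0
  hdeg : ∀ b b', d (single b 1) b' ≠ 0 → deg b' + 1 = deg b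

/-- Chains supported on a set of basis elements. -/
abbrev spt {B : Type} (S : Set B) : Submodule (ZMod 2) (Ch B) := supported (ZMod 2) (ZMod 2) S

lemma mem_spt {B : Type} {S : Set B} {z : Ch B} : z ∈ spt S ↔ ∀ b, z b ≠ 0 → b ∈ S := by
  rw [mem_supported']
  constructor
  · intro h b hb
    by_contra hn
    exact hb (h b hn)
  · intro h b hb
    by_contra hn
    exact hb (h b hn)

lemma spt_mono {B : Type} {S T : Set B} (h : S ⊆ T) {z : Ch B} (hz : z ∈ spt S) : z ∈ spt T :=
  supported_mono h hz

lemma single_spt {B : Type} {S : Set B} {b : B} (h : b ∈ S) : single b (1 : ZMod 2) ∈ spt S :=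
  single_mem_supported _ _ h

lemma map_spt {B : Type} {M : Type} [AddCommGroup M] [Module (ZMod 2) M]
    (f : Ch B →ₗ[ZMod 2] M) (Q : Submodule (ZMod 2) M) {S : Set B}
    (h : ∀ b ∈ S, f (single b 1) ∈ Q) {z : Ch B} (hz : z ∈ spt S) : f z ∈ Q := by
  have : spt S ≤ Q.comap f := by
    unfold spt
    rw [supported_eq_span_single, Submodule.span_le]
    rintro _ ⟨b, hb, rfl⟩
    exact h b hb
  exact this hz

lemma map_eq_spt {B : Type} {M : Type} [AddCommGroup M] [Module (ZMod 2) M]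
    (f g : Ch B →ₗ[ZMod 2] M) {S : Set B}
    (h : ∀ b ∈ S, f (single b 1) = g (single b 1)) {z : Ch B} (hz : z ∈ spt S) : f z = g z := by
  have := map_spt (f - g) ⊥ (S := S) (by intro b hb; simp [h b hb]) hz
  simpa [sub_eq_zero] using this

lemma map_eq {B : Type} {M : Type} [AddCommGroup M] [Module (ZMod 2) M]
    (f g : Ch B →ₗ[ZMod 2] M)
    (h : ∀ b, f (single b 1) = g (single b 1)) (z : Ch B) : f z = g z :=
  map_eq_spt f g (S := Set.univ) (fun b _ => h b) (by rw [mem_spt]; simp)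

lemma add2 {M : Type} [AddCommGroup M] [Module (ZMod 2) M] (x : M) : x + x = 0 :=
  ZModModule.add_self x

lemma add2_eq {M : Type} [AddCommGroup M] [Module (ZMod 2) M] {x y : M} : x + y = 0 ↔ x = y := by
  constructor
  · intro h
    have : x + y + y = y := by rw [h, zero_add]
    rwa [add_assoc, add2, add_zero] at this
  · rintro rfl; exact add2 x

lemma zmod2_cases (c : ZMod 2) : c = 0 ∨ c = 1 := by
  revert c; decide

lemma zmod2_ne {c : ZMod 2} (h : c ≠ 0) : c = 1 := (zmod2_cases c).resolve_left h

/-- Linear extension of a map on basis elements. -/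
noncomputable def lext {B : Type} {M : Type} [AddCommGroup M] [Module (ZMod 2) M] (f : B → M) :
    Ch B →ₗ[ZMod 2] M := Finsupp.linearCombination (ZMod 2) f

@[simp] lemma lext_single {B : Type} {M : Type} [AddCommGroup M] [Module (ZMod 2) M] (f : B → M)
    (b : B) : lext f (single b 1) = f b := by
  simp [lext]

open Classical in
/-- Restriction of chains to a set of basis elements. -/
noncomputable def R {B : Type} (S : Set B) : Ch B →ₗ[ZMod 2] Ch B where
  toFun := filter (· ∈ S)
  map_add' _ _ := filter_add
  map_smul' _ _ := filter_smul

open Classical in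
lemma R_apply {B : Type} (S : Set B) (z : Ch B) (b : B) : R S z b = if b ∈ S then z b else 0 := by
  simp [R, filter_apply]

lemma R_pos {B : Type} {S : Set B} (z : Ch B) {b : B} (h : b ∈ S) : R S z b = z b := by
  simp [R_apply, h]

lemma R_neg {B : Type} {S : Set B} (z : Ch B) {b : B} (h : b ∉ S) : R S z b = 0 := by
  simp [R_apply, h]

lemma R_mem {B : Type} (S : Set B) (z : Ch B) : R S z ∈ spt S := by
  rw [mem_spt]; intro b hb
  by_contra h
  exact hb (R_neg z h)

lemma R_eq {B : Type} {S : Set B} {z : Ch B} : R S z = z ↔ z ∈ spt S := by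
  constructor
  · intro h; rw [← h]; exact R_mem S z
  · intro h
    ext b
    by_cases hb : b ∈ S
    · exact R_pos z hb
    · rw [R_neg z hb]
      by_contra hn
      exact hb (mem_spt.1 h b (Ne.symm hn))

lemma R_spt {B : Type} (S T : Set B) {z : Ch B} (h : z ∈ spt T) : R S z ∈ spt (S ∩ T) := by
  rw [mem_spt] at *
  intro b hb
  by_cases hbs : b ∈ S
  · rw [R_pos z hbs] at hb
    exact ⟨hbs, h b hb⟩
  · exact absurd (R_neg z hbs) hb

lemma R_R {B : Type} (S T : Set B) (z : Ch B) : R S (R T z) = R (S ∩ T) z := by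
  ext b
  by_cases hs : b ∈ S <;> by_cases ht : b ∈ T <;> simp [R_apply, hs, ht]

lemma R_compl {B : Type} (S : Set B) (z : Ch B) : R S z + R Sᶜ z = z := by
  ext b
  by_cases hs : b ∈ S <;> simp [R_apply, hs]

namespace BC
variable {B D : Type}

/-- The basis elements of degree `k`. -/
def gr (X : BC B) (k : ℕ) : Set B := {b | X.deg b = k}

lemma d_gr (X : BC B) (k : ℕ) (w : Ch B) : X.d (R (X.gr (k+1)) w) = R (X.gr k) (X.d w) := by
  classical
  apply map_eq (X.d ∘ₗ R (X.gr (k+1))) (R (X.gr k) ∘ₗ X.d)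
  intro b
  simp only [LinearMap.comp_apply]
  by_cases hb : b ∈ X.gr (k+1)
  · rw [R_eq.2 (single_spt hb), eq_comm, R_eq, mem_spt]
    intro b' hb'
    have := X.hdeg b b' hb'
    simp only [gr, Set.mem_ofPred_eq] at *
    omega
  · have : R (X.gr (k+1)) (single b 1) = 0 := by
      ext c
      rw [R_apply]
      split_ifs with hc
      · rw [single_apply]
        split_ifs with h
        · exact absurd (h ▸ hc) hb
        · rfl
      · rfl
    rw [this, map_zero, eq_comm]
    ext c
    rw [R_apply]
    split_ifs with hc
    · by_contra hn
      have := X.hdeg b c hn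
      simp only [gr, Set.mem_ofPred_eq] at *
      omega
    · rfl

lemma d_mem_gr (X : BC B) (k : ℕ) {w : Ch B} (hw : w ∈ spt (X.gr (k+1))) : X.d w ∈ spt (X.gr k) := by
  rw [← R_eq.2 hw, d_gr]
  exact R_mem _ _

/-- A filling of a homogeneous chain can be made homogeneous. -/
lemma hom_fill (X : BC B) {k : ℕ} {S : Set B} {z w : Ch B} (hz : z ∈ spt (X.gr k)) (hw : w ∈ spt S)
    (h : X.d w = z) : ∃ w' ∈ spt (S ∩ X.gr (k+1)), X.d w' = z := by
  refine ⟨R (X.gr (k+1)) w, ?_, ?_⟩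
  · rw [Set.inter_comm]; exact R_spt _ _ hw
  · rw [d_gr, h, R_eq.2 hz]

section carrier
variable (X : BC B) (Y : BC D) (θ : Ch B →ₗ[ZMod 2] Ch D) (Φ : B → Set D)

/-- The map is carried and satisfies the equation up to degree `n`. -/
def Good (φ0 : B → Ch D) (n : ℕ) (φ : Ch B →ₗ[ZMod 2] Ch D) : Prop :=
  (∀ b, X.deg b = 0 → φ (single b 1) = φ0 b) ∧
  ∀ b, X.deg b ≤ n → φ (single b 1) ∈ spt (Φ b) ∧
    Y.d (φ (single b 1)) = φ (X.d (single b 1)) + θ (single b 1)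

theorem carrier
    (hθ : ∀ z, Y.d (θ z) = θ (X.d z)) (Ψ : B → Set D)
    (hΦΨ : ∀ b b', X.d (single b 1) b' ≠ 0 → Φ b' ⊆ Ψ b)
    (hθΨ : ∀ b, θ (single b 1) ∈ spt (Ψ b)) (φ0 : B → Ch D)
    (h0 : ∀ b, X.deg b = 0 → φ0 b ∈ spt (Φ b) ∧ Y.d (φ0 b) = θ (single b 1))
    (fill : ∀ b, X.deg b ≠ 0 → ∀ z ∈ spt (Ψ b), Y.d z = 0 → ∃ w ∈ spt (Φ b), Y.d w = z) :
    ∃ φ : Ch B →ₗ[ZMod 2] Ch D, (∀ b, X.deg b = 0 → φ (single b 1) = φ0 b) ∧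
      (∀ b, φ (single b 1) ∈ spt (Φ b)) ∧
      ∀ z, Y.d (φ z) = φ (X.d z) + θ z := by
  classical
  have dlow : ∀ b, X.d (single b 1) ∈ spt {b' | X.deg b' + 1 = X.deg b} := by
    intro b
    rw [mem_spt]
    intro b' hb'
    exact X.hdeg b b' hb'
  have step : ∀ n (φ : Ch B →ₗ[ZMod 2] Ch D), Good X Y θ Φ φ0 n φ →
      ∃ φ' : Ch B →ₗ[ZMod 2] Ch D, Good X Y θ Φ φ0 (n+1) φ' ∧
        ∀ b, X.deg b ≤ n → φ' (single b 1) = φ (single b 1) := by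
    intro n φ hφ
    have ex : ∀ b, X.deg b = n+1 → ∃ w ∈ spt (Φ b),
        Y.d w = φ (X.d (single b 1)) + θ (single b 1) := by
      intro b hb
      apply fill b (by omega)
      · refine Submodule.add_mem _ ?_ (hθΨ b)
        have : X.d (single b 1) ∈ spt {b' | X.d (single b 1) b' ≠ 0} := by
          rw [mem_spt]; intro b' h; exact h
        refine map_spt φ _ ?_ this
        intro b' hb'
        refine spt_mono (hΦΨ b b' hb') (hφ.2 b' ?_).1
        have := X.hdeg b b' hb'
        omega
      · rw [map_add, hθ]
        have : (Y.d ∘ₗ φ) (X.d (single b 1)) = (φ ∘ₗ X.d + θ) (X.d (single b 1)) := by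
          apply map_eq_spt _ _ _ (dlow b)
          intro b' hb'
          have hb' : X.deg b' + 1 = X.deg b := hb'
          exact (hφ.2 b' (by omega)).2
        simp only [LinearMap.comp_apply, LinearMap.add_apply, X.dd, map_zero, zero_add] at this
        rw [this, add2]
    choose! ww hw1 hw2 using ex
    refine ⟨lext (fun b => if X.deg b = n+1 then ww b else φ (single b 1)), ?_, ?_⟩
    · have agree : ∀ b, X.deg b ≤ n + 1 →
          lext (fun b => if X.deg b = n+1 then ww b else φ (single b 1)) (X.d (single b 1)) =
            φ (X.d (single b 1)) := by
        intro b hb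
        apply map_eq_spt _ _ _ (dlow b)
        intro b' hb'
        have hb' : X.deg b' + 1 = X.deg b := hb'
        rw [lext_single, if_neg (by omega)]
      refine ⟨?_, ?_⟩
      · intro b hb
        rw [lext_single, if_neg (by omega)]
        exact hφ.1 b hb
      · intro b hb
        rw [agree b hb, lext_single]
        split_ifs with h
        · exact ⟨hw1 b h, hw2 b h⟩
        · exact hφ.2 b (by omega)
    · intro b hb
      rw [lext_single, if_neg (by omega)]
  have base : Good X Y θ Φ φ0 0 (lext φ0) := by
    refine ⟨fun b _ => by simp, ?_⟩
    intro b hb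
    have hb : X.deg b = 0 := by omega
    have : X.d (single b 1) = 0 := by
      ext b'
      by_contra hn
      have := X.hdeg b b' hn
      omega
    rw [this, map_zero, zero_add, lext_single]
    exact h0 b hb
  let seq : (n : ℕ) → {φ : Ch B →ₗ[ZMod 2] Ch D // Good X Y θ Φ φ0 n φ} := fun n =>
    Nat.rec ⟨_, base⟩ (fun n p => ⟨(step n p.1 p.2).choose, (step n p.1 p.2).choose_spec.1⟩) n
  have seqs : ∀ n b, X.deg b ≤ n → (seq (n+1)).1 (single b 1) = (seq n).1 (single b 1) := by
    intro n b hb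
    exact (step n (seq n).1 (seq n).2).choose_spec.2 b hb
  have seqa : ∀ n b, X.deg b ≤ n → (seq n).1 (single b 1) = (seq (X.deg b)).1 (single b 1) := by
    intro n b hb
    induction n, hb using Nat.le_induction with
    | base => rfl
    | succ n hn ih => rw [seqs n b hn, ih]
  refine ⟨lext (fun b => (seq (X.deg b)).1 (single b 1)), ?_, ?_, ?_⟩
  · intro b hb
    rw [lext_single]
    exact (seq (X.deg b)).2.1 b hb
  · intro b
    rw [lext_single]
    exact ((seq (X.deg b)).2.2 b le_rfl).1
  · set ff := lext (fun b => (seq (X.deg b)).1 (single b 1)) with hff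
    apply map_eq (Y.d ∘ₗ ff) (ff ∘ₗ X.d + θ)
    intro b
    simp only [LinearMap.comp_apply, LinearMap.add_apply]
    rw [hff, lext_single, ((seq (X.deg b)).2.2 b le_rfl).2]
    congr 1
    apply map_eq_spt _ _ _ (dlow b)
    intro b' hb'
    have hb' : X.deg b' + 1 = X.deg b := hb'
    rw [lext_single, seqa _ b' (by omega)]

end carrier
end BC
end CubManif

namespace CubManif
open Finsupp

section lists
variable {X Y : Type}

/-- Prepending a point. -/
noncomputable def cone (x : X) : Ch (List X) →ₗ[ZMod 2] Ch (List X) :=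
  lext (fun l => single (x :: l) 1)

/-- Boundary of a list. -/
noncomputable def dl : List X → Ch (List X)
  | [] => 0
  | x :: l => single l 1 + cone x (dl l)

/-- Boundary of list chains. -/
noncomputable def dL : Ch (List X) →ₗ[ZMod 2] Ch (List X) := lext dl

@[simp] lemma cone_single (x : X) (l : List X) : cone x (single l 1) = single (x :: l) 1 := by
  simp [cone]

@[simp] lemma dL_single (l : List X) : dL (single l 1) = dl l := by simp [dL]

lemma dL_cone (x : X) (z : Ch (List X)) : dL (cone x z) = z + cone x (dL z) := by
  refine map_eq (dL ∘ₗ cone x) (LinearMap.id + cone x ∘ₗ dL) ?_ z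
  intro l
  simp [dl]

lemma dL_dL (z : Ch (List X)) : dL (dL z) = 0 := by
  apply map_eq (dL ∘ₗ dL) 0
  intro l
  simp only [LinearMap.comp_apply, dL_single, LinearMap.zero_apply]
  induction l with
  | nil => simp [dl]
  | cons x l ih =>
    simp only [dl, map_add, dL_single, dL_cone, ih, map_zero, add_zero]
    exact add2 _

lemma cone_spt {S T : Set (List X)} {x : X} (h : ∀ l ∈ S, x :: l ∈ T) {z : Ch (List X)}
    (hz : z ∈ spt S) : cone x z ∈ spt T := by
  apply map_spt _ _ _ hz
  intro l hl
  rw [cone_single]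
  exact single_spt (h l hl)

lemma dl_spt (l : List X) : dl l ∈ spt {l' | l'.Sublist l ∧ l'.length + 1 = l.length} := by
  induction l with
  | nil => exact Submodule.zero_mem _
  | cons x l ih =>
    refine Submodule.add_mem _ (single_spt ?_) (cone_spt ?_ ih)
    · exact ⟨List.sublist_cons_self x l, by simp⟩
    · rintro l' ⟨h1, h2⟩
      exact ⟨h1.cons_cons x, by simp [h2]⟩

/-- The complex of lists. -/
noncomputable def listBC (X : Type) : BC (List X) where
  d := dL
  deg := List.length
  dd := dL_dL
  hdeg := by
    intro b b' h
    rw [dL_single] at h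
    exact (mem_spt.1 (dl_spt b) b' h).2

lemma dL_spt {S : Set (List X)} (hS : ∀ l ∈ S, ∀ l', l'.Sublist l → l' ∈ S) {z : Ch (List X)}
    (hz : z ∈ spt S) : dL z ∈ spt S := by
  apply map_spt _ _ _ hz
  intro l hl
  rw [dL_single]
  exact spt_mono (fun l' h => hS l hl l' h.1) (dl_spt l)

/-- Chain map induced by a map of points. -/
noncomputable def mp (f : X → Y) : Ch (List X) →ₗ[ZMod 2] Ch (List Y) :=
  lext (fun l => single (l.map f) 1)

@[simp] lemma mp_single (f : X → Y) (l : List X) : mp f (single l 1) = single (l.map f) 1 := by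
  simp [mp]

lemma mp_cone (f : X → Y) (x : X) (z : Ch (List X)) : mp f (cone x z) = cone (f x) (mp f z) := by
  apply map_eq (mp f ∘ₗ cone x) (cone (f x) ∘ₗ mp f)
  intro l
  simp

lemma dL_mp (f : X → Y) (z : Ch (List X)) : dL (mp f z) = mp f (dL z) := by
  apply map_eq (dL ∘ₗ mp f) (mp f ∘ₗ dL)
  intro l
  simp only [LinearMap.comp_apply, dL_single, mp_single]
  induction l with
  | nil => simp [dl]
  | cons x l ih => simp [dl, ih, mp_cone]

lemma mp_spt {f : X → Y} {S : Set (List X)} {T : Set (List Y)} (h : ∀ l ∈ S, l.map f ∈ T)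
    {z : Ch (List X)} (hz : z ∈ spt S) : mp f z ∈ spt T := by
  apply map_spt _ _ _ hz
  intro l hl
  rw [mp_single]
  exact single_spt (h l hl)

lemma mp_mp {Z : Type} (f : X → Y) (g : Y → Z) (z : Ch (List X)) :
    mp g (mp f z) = mp (g ∘ f) z := by
  apply map_eq (mp g ∘ₗ mp f) (mp (g ∘ f))
  intro l
  simp

lemma mp_congr {f g : X → Y} {S : Set (List X)} (h : ∀ l ∈ S, ∀ x ∈ l, f x = g x)
    {z : Ch (List X)} (hz : z ∈ spt S) : mp f z = mp g z := by
  apply map_eq_spt _ _ _ hz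
  intro l hl
  rw [mp_single, mp_single, List.map_congr_left (h l hl)]

lemma mp_id (z : Ch (List X)) : mp id z = z := by
  apply map_eq (mp id) LinearMap.id
  intro l
  simp

/-- The prism on a list. -/
noncomputable def pr (f g : X → Y) : List X → Ch (List Y)
  | [] => 0
  | x :: l => single (f x :: g x :: l.map g) 1 + cone (f x) (pr f g l)

/-- The prism operator. -/
noncomputable def prL (f g : X → Y) : Ch (List X) →ₗ[ZMod 2] Ch (List Y) := lext (pr f g)

@[simp] lemma prL_single (f g : X → Y) (l : List X) : prL f g (single l 1) = pr f g l := by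
  simp [prL]

lemma prL_cone (f g : X → Y) (x : X) (z : Ch (List X)) :
    prL f g (cone x z) = cone (f x) (cone (g x) (mp g z)) + cone (f x) (prL f g z) := by
  apply map_eq (prL f g ∘ₗ cone x) (cone (f x) ∘ₗ cone (g x) ∘ₗ mp g + cone (f x) ∘ₗ prL f g)
  intro l
  simp [pr]

lemma dL_prL (f g : X → Y) (z : Ch (List X)) :
    dL (prL f g z) = prL f g (dL z) + (mp f z + mp g z) := by
  apply map_eq (dL ∘ₗ prL f g) (prL f g ∘ₗ dL + (mp f + mp g))
  intro l
  simp only [LinearMap.comp_apply, LinearMap.add_apply, dL_single, mp_single, prL_single]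
  induction l with
  | nil => simp [pr, dl, add2]
  | cons x l ih =>
    have h1 : dL (single (l.map g) 1) = mp g (dl l) := by
      rw [← mp_single, dL_mp, dL_single]
    simp only [pr, dl, map_add, dL_cone, ih, prL_cone, ← cone_single, prL_single, h1]
    have e1 := add2 (cone (f x) (single (l.map g) (1 : ZMod 2)))
    generalize cone (f x) (single (l.map g) (1 : ZMod 2)) = A at *
    simp only [cone_single, List.map_cons]
    generalize single (g x :: l.map g) (1 : ZMod 2) = B1
    generalize single (f x :: l.map f) (1 : ZMod 2) = B2
    generalize cone (f x) (cone (g x) (mp g (dl l))) = B3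
    generalize (cone (f x)) ((prL f g) (dl l)) = B4
    generalize pr f g l = B5
    have : B1 + (A + B3) + (B5 + (B4 + (B2 + A))) = B5 + (B3 + B4) + (B2 + B1) + (A + A) := by abel
    rw [this, e1, add_zero]

lemma pr_spt (f g : X → Y) (l : List X) :
    pr f g l ∈ spt {l' | ∀ y ∈ l', ∃ x ∈ l, y = f x ∨ y = g x} := by
  induction l with
  | nil => exact Submodule.zero_mem _
  | cons x l ih =>
    refine Submodule.add_mem _ (single_spt ?_) (cone_spt ?_ ih)
    · intro y hy
      simp only [List.mem_cons, List.mem_map] at hy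
      rcases hy with rfl | rfl | ⟨a, ha, rfl⟩
      · exact ⟨x, by simp, by simp⟩
      · exact ⟨x, by simp, by simp⟩
      · exact ⟨a, by simp [ha], by simp⟩
    · intro l' h y hy
      rcases List.mem_cons.1 hy with rfl | hy
      · exact ⟨x, by simp, by simp⟩
      · obtain ⟨a, ha, h⟩ := h y hy
        exact ⟨a, by simp [ha], h⟩

/-- Boundaries of chains supported in `S`. -/
noncomputable def Bd (S : Set (List X)) : Submodule (ZMod 2) (Ch (List X)) := (spt S).map dL

lemma mem_Bd {S : Set (List X)} {z : Ch (List X)} : z ∈ Bd S ↔ ∃ w ∈ spt S, dL w = z := by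
  simp [Bd]

lemma Bd_mono {S T : Set (List X)} (h : S ⊆ T) {z : Ch (List X)} (hz : z ∈ Bd S) : z ∈ Bd T := by
  rw [mem_Bd] at *
  obtain ⟨w, hw, rfl⟩ := hz
  exact ⟨w, spt_mono h hw, rfl⟩

lemma mp_Bd {f : X → Y} {S : Set (List X)} {T : Set (List Y)} (h : ∀ l ∈ S, l.map f ∈ T)
    {z : Ch (List X)} (hz : z ∈ Bd S) : mp f z ∈ Bd T := by
  rw [mem_Bd] at *
  obtain ⟨w, hw, rfl⟩ := hz
  exact ⟨mp f w, mp_spt h hw, dL_mp f w⟩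

end lists

section vietoris
variable {E E' : Type} [PseudoMetricSpace E] [PseudoMetricSpace E']

/-- Vietoris simplices of size `ε` in `X`. -/
def V (ε : ℝ) (X : Set E) : Set (List E) :=
  {l | (∀ x ∈ l, x ∈ X) ∧ ∀ x ∈ l, ∀ y ∈ l, dist x y < ε}

lemma V_sub {ε : ℝ} {X : Set E} : ∀ l ∈ V ε X, ∀ l', l'.Sublist l → l' ∈ V ε X :=
  fun _ hl _ h => ⟨fun x hx => hl.1 x (h.subset hx),
    fun x hx y hy => hl.2 x (h.subset hx) y (h.subset hy)⟩

lemma V_mono {ε δ : ℝ} {X Y : Set E} (h : ε ≤ δ) (hXY : X ⊆ Y) : V ε X ⊆ V δ Y :=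
  fun _ hl => ⟨fun x hx => hXY (hl.1 x hx), fun x hx y hy => (hl.2 x hx y hy).trans_le h⟩

lemma V_map {ε η : ℝ} {X : Set E} {Y : Set E'} {f : E → E'} (hf : ∀ x ∈ X, f x ∈ Y)
    (h : ∀ x ∈ X, ∀ y ∈ X, dist x y < ε → dist (f x) (f y) < η) :
    ∀ l ∈ V ε X, l.map f ∈ V η Y := by
  intro l hl
  refine ⟨?_, ?_⟩
  · intro y hy
    obtain ⟨x, hx, rfl⟩ := List.mem_map.1 hy
    exact hf x (hl.1 x hx)
  · intro y hy y' hy'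
    obtain ⟨x, hx, rfl⟩ := List.mem_map.1 hy
    obtain ⟨x', hx', rfl⟩ := List.mem_map.1 hy'
    exact h x (hl.1 x hx) x' (hl.1 x' hx') (hl.2 x hx x' hx')

lemma prism_Bd {ε η : ℝ} {X : Set E} {Y : Set E'} {f g : E → E'} (hf : ∀ x ∈ X, f x ∈ Y)
    (hg : ∀ x ∈ X, g x ∈ Y)
    (hff : ∀ x ∈ X, ∀ y ∈ X, dist x y < ε → dist (f x) (f y) < η)
    (hfg : ∀ x ∈ X, ∀ y ∈ X, dist x y < ε → dist (f x) (g y) < η)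
    (hgg : ∀ x ∈ X, ∀ y ∈ X, dist x y < ε → dist (g x) (g y) < η)
    {z : Ch (List E)} (hz : z ∈ spt (V ε X)) (hd : dL z = 0) :
    mp f z + mp g z ∈ Bd (V η Y) := by
  rw [mem_Bd]
  refine ⟨prL f g z, ?_, by rw [dL_prL, hd, map_zero, zero_add]⟩
  apply map_spt _ _ _ hz
  intro l hl
  rw [prL_single]
  refine spt_mono ?_ (pr_spt f g l)
  intro l' h
  refine ⟨?_, ?_⟩
  · intro y hy
    obtain ⟨x, hx, rfl | rfl⟩ := h y hy
    · exact hf x (hl.1 x hx)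
    · exact hg x (hl.1 x hx)
  · intro y hy y' hy'
    obtain ⟨x, hx, h1⟩ := h y hy
    obtain ⟨x', hx', h2⟩ := h y' hy'
    have m := hl.1 x hx
    have m' := hl.1 x' hx'
    have dd := hl.2 x hx x' hx'
    rcases h1 with rfl | rfl <;> rcases h2 with rfl | rfl
    · exact hff _ m _ m' dd
    · exact hfg _ m _ m' dd
    · rw [dist_comm]; exact hfg _ m' _ m (by rwa [dist_comm])
    · exact hgg _ m _ m' dd

/-- Homotopy invariance. -/
theorem homotopy_Bd {X : Set E} {Y : Set E'} (hX : IsCompact X) (H : ℝ → E → E')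
    (hH : ContinuousOn (fun p : ℝ × E => H p.1 p.2) (Set.Icc 0 1 ×ˢ X))
    (hm : ∀ t ∈ Set.Icc (0:ℝ) 1, ∀ x ∈ X, H t x ∈ Y) {η : ℝ} (hη : 0 < η) :
    ∃ ε > 0, ∀ z ∈ spt (V ε X), dL z = 0 → mp (H 0) z + mp (H 1) z ∈ Bd (V η Y) := by
  have huc := (isCompact_Icc.prod hX).uniformContinuousOn_of_continuous hH
  rw [Metric.uniformContinuousOn_iff] at huc
  obtain ⟨ε, hε, h⟩ := huc η hη
  refine ⟨ε, hε, ?_⟩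
  intro z hz hd
  obtain ⟨n, hn⟩ := exists_nat_gt (1 / ε)
  have hn0 : (0:ℝ) < n := lt_trans (by positivity) hn
  have hn1 : 1 / (n:ℝ) < ε := by
    rw [div_lt_iff₀ hn0, mul_comm, ← div_lt_iff₀ hε]; exact hn
  have key : ∀ k : ℕ, k ≤ n → mp (H 0) z + mp (H (k / n)) z ∈ Bd (V η Y) := by
    intro k
    induction k with
    | zero =>
      intro _
      simp [add2]
    | succ k ih =>
      intro hk
      have ih := ih (by omega)
      have m1 : ((k:ℝ) / n) ∈ Set.Icc (0:ℝ) 1 := by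
        refine ⟨by positivity, ?_⟩
        rw [div_le_one hn0]; exact_mod_cast (by omega : k ≤ n)
      have m2 : (((k+1:ℕ):ℝ) / n) ∈ Set.Icc (0:ℝ) 1 := by
        refine ⟨by positivity, ?_⟩
        rw [div_le_one hn0]; exact_mod_cast hk
      have dd : dist ((k:ℝ) / n) (((k+1:ℕ):ℝ) / n) < ε := by
        rw [Real.dist_eq]
        have : ((k:ℝ) / n) - (((k+1:ℕ):ℝ) / n) = - (1 / n) := by
          push_cast; field_simp; ring
        rw [this, abs_neg, abs_of_pos (by positivity)]
        exact hn1
      have st : mp (H (k / n)) z + mp (H ((k+1:ℕ) / n)) z ∈ Bd (V η Y) := by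
        refine prism_Bd (hm _ m1) (hm _ m2) ?_ ?_ ?_ hz hd
        · intro x hx y hy hxy
          exact h (_, x) ⟨m1, hx⟩ (_, y) ⟨m1, hy⟩ (by simpa [Prod.dist_eq, hε] using hxy)
        · intro x hx y hy hxy
          refine h (_, x) ⟨m1, hx⟩ (_, y) ⟨m2, hy⟩ ?_
          rw [Prod.dist_eq]
          exact max_lt dd hxy
        · intro x hx y hy hxy
          exact h (_, x) ⟨m2, hx⟩ (_, y) ⟨m2, hy⟩ (by simpa [Prod.dist_eq, hε] using hxy)
      have := Submodule.add_mem _ ih st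
      rwa [add_assoc, ← add_assoc (mp (H (k / n)) z), add2, zero_add] at this
  have := key n le_rfl
  rwa [div_self hn0.ne'] at this

lemma cont_V {X : Set E} {Y : Set E'} (hX : IsCompact X) (f : E → E') (hf : ContinuousOn f X)
    (hm : ∀ x ∈ X, f x ∈ Y) {η : ℝ} (hη : 0 < η) :
    ∃ ε > 0, ∀ l ∈ V ε X, l.map f ∈ V η Y := by
  have huc := hX.uniformContinuousOn_of_continuous hf
  rw [Metric.uniformContinuousOn_iff] at huc
  obtain ⟨ε, hε, h⟩ := huc η hη
  exact ⟨ε, hε, V_map hm (fun x hx y hy => h x hx y hy)⟩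

lemma const_Bd {ε : ℝ} (hε : 0 < ε) {X : Set E'} {p : E'} (hp : p ∈ X) {z : Ch (List E)}
    (hd : dL z = 0) : mp (fun _ => p) z ∈ Bd (V ε X) := by
  rw [mem_Bd]
  refine ⟨cone p (mp (fun _ => p) z), ?_, ?_⟩
  · have : mp (fun _ : E => p) z ∈ spt {l | ∀ x ∈ l, x = p} := by
      apply mp_spt (S := Set.univ) _ (by rw [mem_spt]; simp)
      intro l _ x hx
      obtain ⟨a, _, rfl⟩ := List.mem_map.1 hx
      rfl
    refine cone_spt ?_ this
    intro l hl
    have : ∀ x ∈ p :: l, x = p := by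
      intro x hx
      rcases List.mem_cons.1 hx with rfl | hx
      · rfl
      · exact hl x hx
    refine ⟨fun x hx => by rw [this x hx]; exact hp, ?_⟩
    intro x hx y hy
    rw [this x hx, this y hy, dist_self]
    exact hε
  · rw [dL_cone, dL_mp, hd, map_zero, map_zero, add_zero]

end vietoris

/-- Convex sets are acyclic at every scale. -/
theorem convex_Bd {E : Type} [NormedAddCommGroup E] [NormedSpace ℝ E] {X : Set E}
    (hX : Convex ℝ X) (hb : Bornology.IsBounded X) {p : E} (hp : p ∈ X) {ε : ℝ} (hε : 0 < ε)
    {z : Ch (List E)} (hz : z ∈ spt (V ε X)) (hd : dL z = 0) : z ∈ Bd (V ε X) := by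
  classical
  -- a slightly smaller scale
  have small : ∃ ε' < ε, 0 < ε' ∧ z ∈ spt (V ε' X) := by
    have hl : ∀ l ∈ V ε X, ∃ δ < ε, 0 < δ ∧ l ∈ V δ X := by
      intro l hl
      have hf : ((l.toFinset ×ˢ l.toFinset).image (fun q => dist q.1 q.2) ∪ {0}).Nonempty := by simp
      set m := Finset.max' _ hf with hm
      have hm1 : m < ε := by
        rw [hm, Finset.max'_lt_iff]
        intro y hy
        simp only [Finset.mem_union, Finset.mem_image, Finset.mem_product, List.mem_toFinset,
          Finset.mem_singleton, Prod.exists] at hy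
        rcases hy with ⟨a, b, ⟨ha, hb⟩, rfl⟩ | rfl
        · exact hl.2 a ha b hb
        · exact hε
      have hm0 : 0 ≤ m := Finset.le_max' _ _ (by simp)
      refine ⟨(m + ε) / 2, by linarith, by linarith, hl.1, ?_⟩
      intro x hx y hy
      have : dist x y ≤ m := by
        apply Finset.le_max'
        simp only [Finset.mem_union, Finset.mem_image, Finset.mem_product, List.mem_toFinset,
          Finset.mem_singleton, Prod.exists]
        exact Or.inl ⟨x, y, ⟨hx, hy⟩, rfl⟩
      linarith
    have hmem : ∀ s : Finset (List E), (∀ l ∈ s, l ∈ V ε X) →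
        ∃ δ < ε, 0 < δ ∧ ∀ l ∈ s, l ∈ V δ X := by
      intro s
      induction s using Finset.induction_on with
      | empty => intro _; exact ⟨ε / 2, by linarith, by linarith, by simp⟩
      | insert a s _ ih =>
        intro h
        obtain ⟨δ1, h1, h1', h1''⟩ := ih (fun l hl => h l (Finset.mem_insert_of_mem hl))
        obtain ⟨δ2, h2, h2', h2''⟩ := hl a (h a (Finset.mem_insert_self _ _))
        refine ⟨max δ1 δ2, max_lt h1 h2, lt_max_of_lt_left h1', ?_⟩
        intro l hl
        rcases Finset.mem_insert.1 hl with rfl | hl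
        · exact V_mono (le_max_right _ _) subset_rfl h2''
        · exact V_mono (le_max_left _ _) subset_rfl (h1'' l hl)
    obtain ⟨δ, h1, h2, h3⟩ := hmem z.support (fun l hl => mem_spt.1 hz l (by simpa using hl))
    exact ⟨δ, h1, h2, mem_spt.2 (fun l hl => h3 l (by simpa using hl))⟩
  obtain ⟨ε', h1, h2, hz'⟩ := small
  obtain ⟨C, hC⟩ := hb.exists_norm_le
  obtain ⟨n, hn⟩ := exists_nat_gt ((2 * C) / (ε - ε'))
  have hC0 : 0 ≤ C := (norm_nonneg p).trans (hC p hp)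
  have hn0 : (0:ℝ) < n := lt_of_le_of_lt (div_nonneg (by linarith) (by linarith)) hn
  have hn1 : 1 / (n:ℝ) * (2 * C) < ε - ε' := by
    rw [div_lt_iff₀ (by linarith)] at hn
    rw [one_div, inv_mul_lt_iff₀ hn0]; linarith
  let f : ℝ → E → E := fun t x => x + t • (p - x)
  have fm : ∀ t ∈ Set.Icc (0:ℝ) 1, ∀ x ∈ X, f t x ∈ X := by
    intro t ht x hx
    exact hX.add_smul_sub_mem hx hp ht
  have fd : ∀ t ∈ Set.Icc (0:ℝ) 1, ∀ x y, dist (f t x) (f t y) ≤ dist x y := by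
    intro t ht x y
    have : f t x - f t y = (1 - t) • (x - y) := by
      simp only [f]; module
    rw [dist_eq_norm, dist_eq_norm, this, norm_smul, Real.norm_eq_abs, abs_of_nonneg (by linarith [ht.2])]
    have := norm_nonneg (x - y)
    nlinarith [ht.1]
  have ft : ∀ t s, ∀ x ∈ X, dist (f t x) (f s x) ≤ |t - s| * (2 * C) := by
    intro t s x hx
    have : f t x - f s x = (t - s) • (p - x) := by
      simp only [f]; module
    rw [dist_eq_norm, this, norm_smul, Real.norm_eq_abs]
    gcongr
    exact (norm_sub_le _ _).trans (by linarith [hC p hp, hC x hx])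
  have key : ∀ k : ℕ, k ≤ n → mp (f 0) z + mp (f (k / n)) z ∈ Bd (V ε X) := by
    intro k
    induction k with
    | zero =>
      intro _
      simp [add2]
    | succ k ih =>
      intro hk
      have ih := ih (by omega)
      have m1 : ((k:ℝ) / n) ∈ Set.Icc (0:ℝ) 1 := by
        refine ⟨by positivity, ?_⟩
        rw [div_le_one hn0]; exact_mod_cast (by omega : k ≤ n)
      have m2 : (((k+1:ℕ):ℝ) / n) ∈ Set.Icc (0:ℝ) 1 := by
        refine ⟨by positivity, ?_⟩
        rw [div_le_one hn0]; exact_mod_cast hk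
      have dd : |((k:ℝ) / n) - (((k+1:ℕ):ℝ) / n)| = 1 / n := by
        have : ((k:ℝ) / n) - (((k+1:ℕ):ℝ) / n) = - (1 / n) := by
          push_cast; field_simp; ring
        rw [this, abs_neg, abs_of_pos (by positivity)]
      have st : mp (f (k / n)) z + mp (f ((k+1:ℕ) / n)) z ∈ Bd (V ε X) := by
        refine prism_Bd (fm _ m1) (fm _ m2) ?_ ?_ ?_ hz' hd
        · intro x hx y hy hxy
          exact (fd _ m1 x y).trans_lt (hxy.trans h1)
        · intro x hx y hy hxy
          have a1 := fd _ m1 x y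
          have a2 := ft (k/n) ((k+1:ℕ)/n) y hy
          rw [dd] at a2
          have a3 := dist_triangle (f (k/n) x) (f (k/n) y) (f ((k+1:ℕ)/n) y)
          linarith
        · intro x hx y hy hxy
          exact (fd _ m2 x y).trans_lt (hxy.trans h1)
      have := Submodule.add_mem _ ih st
      rwa [add_assoc, ← add_assoc (mp (f (k / n)) z), add2, zero_add] at this
  have := key n le_rfl
  rw [div_self hn0.ne'] at this
  have e0 : f 0 = id := by funext x; simp [f]
  have e1 : f 1 = fun _ => p := by funext x; simp [f]
  rw [e0, e1, mp_id] at this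
  have h3 := Submodule.add_mem _ this (const_Bd hε hp hd)
  rwa [add_assoc, add2, add_zero] at h3

end CubManif

namespace CubManif
open Finsupp hiding some add_apply
open CubeFace

set_option linter.unusedSimpArgs false
section cells
open scoped Classical
variable {a : ℕ}

/-- Cells: faces of the cube together with an empty cell. -/
abbrev Cell (a : ℕ) := Option (CubeFace a)

/-- Change a coordinate of a face. -/
def upd (F : CubeFace a) (i : Fin a) (x : Option Bool) : CubeFace a := fun j => if j = i then x else F j

@[simp] lemma upd_same (F : CubeFace a) (i : Fin a) (x : Option Bool) : upd F i x i = x := by simp [upd]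

@[simp] lemma upd_ne (F : CubeFace a) {i j : Fin a} (x : Option Bool) (h : j ≠ i) :
    upd F i x j = F j := by simp [upd, h]

lemma upd_ne' (F : CubeFace a) {i j : Fin a} (x : Option Bool) (h : i ≠ j) :
    upd F i x j = F j := by simp [upd, h.symm]

lemma face_ext {F G : CubeFace a} (h : ∀ i, F i = G i) : F = G := funext h

lemma upd_comm (F : CubeFace a) {i j : Fin a} (h : i ≠ j) (x y : Option Bool) :
    upd (upd F i x) j y = upd (upd F j y) i x := by
  apply face_ext; intro k
  unfold upd; split_ifs <;> simp_all

@[simp] lemma upd_upd (F : CubeFace a) (i : Fin a) (x y : Option Bool) :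
    upd (upd F i x) i y = upd F i y := by
  apply face_ext; intro k
  unfold upd; split_ifs <;> simp_all

lemma upd_self {F : CubeFace a} {i : Fin a} {x : Option Bool} (h : F i = x) : upd F i x = F := by
  apply face_ext; intro k
  unfold upd; split_ifs <;> simp_all

lemma le_def {F G : CubeFace a} : F ≤ G ↔ ∀ i, G i = none ∨ F i = G i := Iff.rfl

lemma upd_le {F : CubeFace a} {i : Fin a} (h : F i = none) (x : Option Bool) : upd F i x ≤ F := by
  intro j
  by_cases hj : j = i
  · subst hj; exact Or.inl h
  · right; simp [hj]

lemma le_upd (F : CubeFace a) (i : Fin a) : F ≤ upd F i none := by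
  intro j
  by_cases hj : j = i
  · subst hj; left; simp
  · right; simp [hj]

/-- Free coordinates. -/
noncomputable def fr (F : CubeFace a) : Finset (Fin a) := Finset.univ.filter (fun i => F i = none)

lemma mem_fr {F : CubeFace a} {i : Fin a} : i ∈ fr F ↔ F i = none := by simp [fr]

lemma dim_eq (F : CubeFace a) : dim F = (fr F).card := by
  unfold dim fr
  congr

lemma fr_mono {F G : CubeFace a} (h : F ≤ G) : fr F ⊆ fr G := by
  intro i hi
  rw [mem_fr] at *
  rcases h i with h | h
  · exact h
  · rw [← h]; exact hi

lemma dim_mono {F G : CubeFace a} (h : F ≤ G) : dim F ≤ dim G := by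
  rw [dim_eq, dim_eq]; exact Finset.card_le_card (fr_mono h)

lemma fr_upd_some (F : CubeFace a) (i : Fin a) (b : Bool) : fr (upd F i (some b)) = (fr F).erase i := by
  ext j
  by_cases hj : j = i
  · subst hj; simp [mem_fr]
  · simp [mem_fr, hj]

lemma fr_upd_none (F : CubeFace a) (i : Fin a) : fr (upd F i none) = insert i (fr F) := by
  ext j
  by_cases hj : j = i
  · subst hj; simp [mem_fr]
  · simp [mem_fr, hj]

lemma dim_upd_some {F : CubeFace a} {i : Fin a} (h : F i = none) (b : Bool) :
    dim (upd F i (some b)) + 1 = dim F := by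
  rw [dim_eq, dim_eq, fr_upd_some]
  exact Finset.card_erase_add_one (mem_fr.2 h)

lemma dim_upd_none {F : CubeFace a} {i : Fin a} (h : F i ≠ none) :
    dim (upd F i none) = dim F + 1 := by
  rw [dim_eq, dim_eq, fr_upd_none]
  exact Finset.card_insert_of_notMem (fun h' => h (mem_fr.1 h'))

lemma eq_of_le_dim {F G : CubeFace a} (h : F ≤ G) (hd : dim G ≤ dim F) : F = G := by
  have hfr : fr F = fr G := Finset.eq_of_subset_of_card_le (fr_mono h) (by rwa [dim_eq, dim_eq] at hd)
  apply face_ext; intro i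
  rcases h i with h | h
  · rw [h, ← mem_fr, hfr, mem_fr, h]
  · exact h

/-- facets are updates -/
lemma facet_upd {F G : CubeFace a} (h : G ≤ F) (hd : dim G + 1 = dim F) :
    ∃ i b, F i = none ∧ G = upd F i (some b) := by
  have : ∃ i ∈ fr F, i ∉ fr G := by
    by_contra hn
    push Not at hn
    have := Finset.card_le_card (show fr F ⊆ fr G from hn)
    rw [← dim_eq, ← dim_eq] at this
    omega
  obtain ⟨i, hi, hi'⟩ := this
  rw [mem_fr] at hi hi'
  obtain ⟨b, hb⟩ := Option.ne_none_iff_exists'.1 hi'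
  refine ⟨i, b, hi, ?_⟩
  apply eq_of_le_dim
  · intro j
    by_cases hj : j = i
    · subst hj; right; simp [hb]
    · simpa [hj] using h j
  · have := dim_upd_some hi b
    omega

/-- degree of a cell -/
def cdeg : Cell a → ℕ
  | none => 0
  | some F => dim F + 1

@[simp] lemma cdeg_none : cdeg (none : Cell a) = 0 := rfl
@[simp] lemma cdeg_some (F : CubeFace a) : cdeg (some F) = dim F + 1 := rfl

/-- chain of a face -/
noncomputable abbrev sg (F : CubeFace a) : Ch (Cell a) := single (some F) 1

/-- Coordinate boundary. -/
noncomputable def op (j : Fin a) : Ch (Cell a) →ₗ[ZMod 2] Ch (Cell a) :=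
  lext (fun C => match C with
    | none => 0
    | some F => if F j = none then sg (upd F j (some false)) + sg (upd F j (some true)) else 0)

/-- Augmentation. -/
noncomputable def aug : Ch (Cell a) →ₗ[ZMod 2] Ch (Cell a) :=
  lext (fun C => match C with
    | none => 0
    | some F => if dim F = 0 then single none 1 else 0)

@[simp] lemma op_none (j : Fin a) : op j (single none 1) = 0 := by simp [op]
@[simp] lemma aug_none : aug (single (none : Cell a) 1) = 0 := by simp [aug]
lemma op_some (j : Fin a) (F : CubeFace a) : op j (sg F) =
  if F j = none then sg (upd F j (some false)) + sg (upd F j (some true)) else 0 := by simp [op]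
lemma aug_some (F : CubeFace a) : aug (sg F) = if dim F = 0 then single none 1 else 0 := by simp [aug]

lemma op_comm {i j : Fin a} (h : i ≠ j) (z : Ch (Cell a)) : op i (op j z) = op j (op i z) := by
  apply map_eq (op i ∘ₗ op j) (op j ∘ₗ op i)
  intro C
  simp only [LinearMap.comp_apply]
  rcases C with _ | F
  · simp
  · rw [op_some, op_some]
    by_cases hi : F i = none <;> by_cases hj : F j = none <;>
      simp [hi, hj, op_some, upd_ne _ _ h, upd_ne _ _ h.symm, upd_comm F h]
    abel

lemma op_op (j : Fin a) (z : Ch (Cell a)) : op j (op j z) = 0 := by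
  apply map_eq (op j ∘ₗ op j) 0
  intro C
  simp only [LinearMap.comp_apply]
  rcases C with _ | F
  · simp
  · rw [op_some]
    split_ifs with h
    · simp [op_some]
    · simp

lemma aug_op (j : Fin a) (z : Ch (Cell a)) : aug (op j z) = 0 := by
  apply map_eq (aug ∘ₗ op j) 0
  intro C
  simp only [LinearMap.comp_apply]
  rcases C with _ | F
  · simp
  · rw [op_some]
    split_ifs with h
    · have h1 := dim_upd_some h false
      have h2 := dim_upd_some h true
      have : dim (upd F j (some false)) = dim (upd F j (some true)) := by omega
      simp [aug_some, this, add2]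
    · simp

lemma op_aug (j : Fin a) (z : Ch (Cell a)) : op j (aug z) = 0 := by
  apply map_eq (op j ∘ₗ aug) 0
  intro C
  simp only [LinearMap.comp_apply]
  rcases C with _ | F
  · simp
  · rw [aug_some]
    split_ifs with h <;> simp

lemma aug_aug (z : Ch (Cell a)) : aug (aug z) = 0 := by
  apply map_eq (aug ∘ₗ aug) 0
  intro C
  simp only [LinearMap.comp_apply]
  rcases C with _ | F
  · simp
  · rw [aug_some]
    split_ifs with h <;> simp

/-- The cellular boundary. -/
noncomputable def bd : Ch (Cell a) →ₗ[ZMod 2] Ch (Cell a) := (∑ j, op j) + aug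

lemma bd_apply (z : Ch (Cell a)) : bd z = (∑ j, op j z) + aug z := by
  simp [bd, LinearMap.sum_apply]

lemma bd_bd (z : Ch (Cell a)) : bd (bd z) = 0 := by
  rw [bd_apply, bd_apply]
  simp only [map_add, map_sum, aug_op, op_aug, aug_aug, Finset.sum_const_zero, add_zero]
  rw [← Finset.sum_product']
  apply Finset.sum_involution (fun p _ => (p.2, p.1))
  · rintro ⟨i, j⟩ _
    by_cases h : i = j
    · subst h; simp [op_op]
    · simp only; rw [op_comm h, add2]
  · rintro ⟨i, j⟩ _ h h'
    simp only [Prod.mk.injEq] at h'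
    rw [h'.1] at h
    exact h (op_op _ _)
  · simp
  · simp

/-- Being a facet. -/
def IsFacet : Cell a → Cell a → Prop
  | none, some F => dim F = 0
  | some G, some F => G ≤ F ∧ dim G + 1 = dim F
  | _, none => False

lemma bd_none : bd (single (none : Cell a) 1) = 0 := by simp [bd_apply]

lemma bd_coeff (C C' : Cell a) : bd (single C 1) C' ≠ 0 ↔ IsFacet C' C := by
  classical
  rcases C with _ | F
  · rw [bd_none]; cases C' <;> simp [IsFacet]
  rcases C' with _ | G
  · have h : ∀ j, (op j (sg F)) none = 0 := by
      intro j; rw [op_some]; split_ifs <;> simp [single_apply]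
    rw [bd_apply, Finsupp.add_apply, finsetSum_apply]
    simp only [h, aug_some, IsFacet, Finset.sum_const_zero, zero_add]
    split_ifs with h <;> simp [h]
  · have haug : aug (sg F) (some G) = 0 := by
      rw [aug_some]; split_ifs <;> simp [single_apply]
    rw [bd_apply, Finsupp.add_apply, finsetSum_apply, haug, add_zero]
    constructor
    · intro h
      obtain ⟨j, -, hj⟩ := Finset.exists_ne_zero_of_sum_ne_zero h
      rw [op_some] at hj
      split_ifs at hj with hF
      · have : ∃ b, G = upd F j (some b) := by
          by_contra hn
          push Not at hn
          apply hj
          simp [single_apply, (hn false).symm, (hn true).symm]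
        obtain ⟨b, rfl⟩ := this
        exact ⟨upd_le hF _, dim_upd_some hF b⟩
      · simp at hj
    · rintro ⟨h1, h2⟩
      obtain ⟨i, b, hi, rfl⟩ := facet_upd h1 h2
      rw [Finset.sum_eq_single i]
      · rw [op_some, if_pos hi]
        have : upd F i (some false) ≠ upd F i (some true) := by
          intro h; have := congrFun h i; simp at this
        cases b <;> simp [single_apply, this, this.symm]
      · intro j _ hj
        rw [op_some]
        split_ifs with hF
        · have : ∀ c, upd F j (some c) ≠ upd F i (some b) := by
            intro c h; have := congrFun h j; simp [hj, hF] at this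
          simp [single_apply, this]
        · rfl
      · simp

/-- The based complex of cells. -/
noncomputable def cellBC (a : ℕ) : BC (Cell a) where
  d := bd
  deg := cdeg
  dd := bd_bd
  hdeg := by
    intro b b' h
    rw [bd_coeff] at h
    rcases b with _ | F <;> rcases b' with _ | G <;> simp [IsFacet] at h ⊢
    · omega
    · omega

/-- The boundary of a cell is supported on facets. -/
lemma bd_single_spt (C : Cell a) : bd (single C 1) ∈ spt {C' | IsFacet C' C} := by
  rw [mem_spt]; intro C' h; exact (bd_coeff C C').1 h

/-- `{none} ∪ K` -/
def ac (K : Set (CubeFace a)) : Set (Cell a) := {C | ∀ F, C = some F → F ∈ K}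

@[simp] lemma some_ac {K : Set (CubeFace a)} {F : CubeFace a} : some F ∈ ac K ↔ F ∈ K := by
  simp [ac]
@[simp] lemma none_ac {K : Set (CubeFace a)} : none ∈ ac K := by
  simp [ac]
lemma ac_mono {K L : Set (CubeFace a)} (h : K ⊆ L) : ac K ⊆ ac L := fun _ hC F hF => h (hC F hF)

lemma bd_ac {K : Set (CubeFace a)} (hK : ∀ F ∈ K, ∀ G : CubeFace a, G ≤ F → G ∈ K) {z : Ch (Cell a)}
    (hz : z ∈ spt (ac K)) : bd z ∈ spt (ac K) := by
  apply map_spt _ _ _ hz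
  intro C hC
  refine spt_mono ?_ (bd_single_spt C)
  intro C' hC'
  rcases C with _ | F <;> rcases C' with _ | G <;> simp_all [IsFacet]
  exact hK F hC G hC'.1

/-- Homotopy to `F i = v i`. -/
noncomputable def hh (i : Fin a) (b : Bool) : Ch (Cell a) →ₗ[ZMod 2] Ch (Cell a) :=
  lext (fun C => match C with
    | none => 0
    | some F => if F i = some (!b) then sg (upd F i none) else 0)

/-- projection to `F i = v i`. -/
noncomputable def pp (i : Fin a) (b : Bool) : Ch (Cell a) →ₗ[ZMod 2] Ch (Cell a) :=
  lext (fun C => match C with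
    | none => single none 1
    | some F => if F i = none then 0 else sg (upd F i (some b)))

@[simp] lemma hh_none (i : Fin a) (b : Bool) : hh i b (single none 1) = 0 := by simp [hh]
@[simp] lemma pp_none (i : Fin a) (b : Bool) : pp i b (single none 1) = single none 1 := by simp [pp]
lemma hh_some (i : Fin a) (b : Bool) (F : CubeFace a) : hh i b (sg F) =
    if F i = some (!b) then sg (upd F i none) else 0 := by simp [hh]
lemma pp_some (i : Fin a) (b : Bool) (F : CubeFace a) : pp i b (sg F) =
    if F i = none then 0 else sg (upd F i (some b)) := by simp [pp]

lemma bd_hh (i : Fin a) (b : Bool) (z : Ch (Cell a)) :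
    bd (hh i b z) = hh i b (bd z) + (z + pp i b z) := by
  refine map_eq (bd ∘ₗ hh i b) (hh i b ∘ₗ bd + (LinearMap.id + pp i b)) ?_ z
  intro C
  simp only [LinearMap.comp_apply, LinearMap.add_apply, LinearMap.id_apply]
  rcases C with _ | F
  · simp [bd_none, add2]
  have key : ∀ j, j ≠ i → op j (hh i b (sg F)) = hh i b (op j (sg F)) := by
    intro j hj
    rw [hh_some, op_some]
    by_cases h1 : F i = some (!b) <;> by_cases h2 : F j = none <;>
      simp [h1, h2, hj, hj.symm, op_some, hh_some, upd_comm F hj]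
  have haug1 : aug (hh i b (sg F)) = 0 := by
    rw [hh_some]
    split_ifs with h
    · rw [aug_some, if_neg]
      rw [dim_upd_none (by simp [h])]; omega
    · simp
  have haug2 : hh i b (aug (sg F)) = 0 := by
    rw [aug_some]; split_ifs <;> simp
  have key2 : op i (hh i b (sg F)) = hh i b (op i (sg F)) + (sg F + pp i b (sg F)) := by
    rw [hh_some, op_some, pp_some]
    by_cases h0 : F i = none
    · cases b <;> simp [h0, hh_some, upd_self h0, add2]
    · by_cases h1 : F i = some (!b)
      · cases b
        · simp only [Bool.not_false] at h1
          simp [h1, op_some, upd_self h1]; abel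
        · simp only [Bool.not_true] at h1
          simp [h1, op_some, upd_self h1]
      · have h2 : F i = some b := by
          cases hF : F i with
          | none => exact absurd hF h0
          | some c => rw [hF] at h1; cases b <;> cases c <;> simp_all
        simp [h2, upd_self h2, add2]
  rw [bd_apply, bd_apply, map_add, map_sum, haug1, haug2,
    ← Finset.add_sum_erase _ _ (Finset.mem_univ i),
    ← Finset.add_sum_erase (a := i) _ (fun j => hh i b (op j (sg F))) (Finset.mem_univ i), key2,
    Finset.sum_congr rfl (fun j hj => key j (Finset.ne_of_mem_erase hj))]
  abel

/-- Acyclicity criterion. -/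
theorem acyclic {K : Set (CubeFace a)} (v : Fin a → Bool) (hv : toFace v ∈ K)
    (hp : ∀ F ∈ K, ∀ i, F i ≠ none → upd F i (some (v i)) ∈ K)
    (hu : ∀ F ∈ K, ∀ i, F i = some (!v i) → upd F i none ∈ K)
    {z : Ch (Cell a)} (hz : z ∈ spt (ac K)) (hd : bd z = 0) : ∃ w ∈ spt (ac K), bd w = z := by
  classical
  have step : ∀ s : Finset (Fin a), ∃ w ∈ spt (ac K),
      bd w + z ∈ spt (ac {F | F ∈ K ∧ ∀ i ∈ s, F i = some (v i)}) := by
    intro s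
    induction s using Finset.induction_on with
    | empty =>
      refine ⟨0, Submodule.zero_mem _, ?_⟩
      simpa using hz
    | insert i s hi ih =>
      obtain ⟨w, hw, hwz⟩ := ih
      refine ⟨w + hh i (v i) (bd w + z), ?_, ?_⟩
      · refine Submodule.add_mem _ hw ?_
        apply map_spt _ _ _ hwz
        intro C hC
        rcases C with _ | F
        · simp
        · rw [hh_some]
          split_ifs with h
          · apply single_spt
            simp at hC ⊢
            exact hu F hC.1 i h
          · exact Submodule.zero_mem _
      · rw [map_add, bd_hh, map_add, bd_bd, hd]
        have : bd w + (hh i (v i) (0 + 0) + (bd w + z + pp i (v i) (bd w + z))) + z =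
            pp i (v i) (bd w + z) := by
          have h1 := add2 (bd w)
          have h2 := add2 z
          rw [add_zero, map_zero, zero_add]
          calc _ = (bd w + bd w) + (z + z) + pp i (v i) (bd w + z) := by abel
            _ = _ := by rw [h1, h2]; simp
        rw [this]
        apply map_spt _ _ _ hwz
        intro C hC
        rcases C with _ | F
        · rw [pp_none]; apply single_spt; simp
        · rw [pp_some]
          split_ifs with h
          · exact Submodule.zero_mem _
          · apply single_spt
            simp only [some_ac, Set.mem_ofPred_eq] at hC ⊢
            refine ⟨hp F hC.1 i h, ?_⟩
            intro j hj
            by_cases hji : j = i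
            · subst hji; simp
            · rw [upd_ne _ _ hji]
              rcases Finset.mem_insert.1 hj with h | h
              · exact absurd h hji
              · exact hC.2 j h
  obtain ⟨w, hw, hwz⟩ := step Finset.univ
  have h0 : bd (bd w + z) = 0 := by rw [map_add, bd_bd, hd, add_zero]
  have hvd : dim (toFace v) = 0 := by
    rw [dim_eq, Finset.card_eq_zero]
    ext i; simp [mem_fr, toFace]
  have hbv : bd (sg (toFace v)) = single none 1 := by
    rw [bd_apply, aug_some, if_pos hvd]
    simp [op_some, toFace]
  set y := bd w + z with hy
  have hy2 : y = y none • single none 1 + y (some (toFace v)) • sg (toFace v) := by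
    ext C
    rcases C with _ | F
    · simp
    · by_cases hF : F = toFace v
      · subst hF; simp
      · have : y (some F) = 0 := by
          by_contra hn
          have := mem_spt.1 hwz _ hn
          simp at this
          exact hF (face_ext this.2)
        rw [this]
        simp [single_apply, Ne.symm hF]
  have h1 : y (some (toFace v)) = 0 := by
    rw [hy2, map_add, map_smul, map_smul, bd_none, hbv] at h0
    have := DFunLike.congr_fun h0 none
    simpa using this
  refine ⟨w + y none • sg (toFace v), ?_, ?_⟩
  · refine Submodule.add_mem _ hw (Submodule.smul_mem _ _ (single_spt ?_))
    simpa using hv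
  · rw [map_add, map_smul, hbv]
    rw [h1, zero_smul, add_zero] at hy2
    rw [← hy2, hy, ← add_assoc, add2, zero_add]

end cells
end CubManif

namespace CubManif
open Finsupp hiding some add_apply
open CubeFace

section compare
open scoped Classical
variable {a : ℕ}

/-- The box of a face. -/
def rf (F : CubeFace a) : Set (Fin a → ℝ) := {x | (∀ i, 0 ≤ x i ∧ x i ≤ 1) ∧
    ∀ i, (F i = some false → x i = 0) ∧ (F i = some true → x i = 1)}

lemma mem_real {K : Set (CubeFace a)} {x : Fin a → ℝ} : x ∈ real K ↔ ∃ F ∈ K, x ∈ rf F := by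
  simp only [real, rf, Set.mem_iUnion, exists_prop]

/-- down-closed sets of faces -/
def DC (K : Set (CubeFace a)) : Prop := ∀ F ∈ K, ∀ G : CubeFace a, G ≤ F → G ∈ K

lemma rf_mono {F G : CubeFace a} (h : F ≤ G) : rf F ⊆ rf G := by
  rintro x ⟨h1, h2⟩
  refine ⟨h1, fun i => ?_⟩
  rcases h i with hi | hi
  · simp [hi]
  · rw [← hi]; exact h2 i

lemma rf_convex (F : CubeFace a) : Convex ℝ (rf F) := by
  intro x hx y hy s t hs ht hst
  refine ⟨fun i => ?_, fun i => ⟨fun h => ?_, fun h => ?_⟩⟩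
  · have h1 := hx.1 i
    have h2 := hy.1 i
    simp only [Pi.add_apply, Pi.smul_apply, smul_eq_mul]
    constructor <;> nlinarith
  · simp [(hx.2 i).1 h, (hy.2 i).1 h]
  · simp [(hx.2 i).2 h, (hy.2 i).2 h, hst]

lemma rf_closed (F : CubeFace a) : IsClosed (rf F) := by
  have : rf F = ⋂ i, {x : Fin a → ℝ | (0 ≤ x i ∧ x i ≤ 1) ∧
      (F i = some false → x i = 0) ∧ (F i = some true → x i = 1)} := by
    ext x; simp only [rf, Set.mem_ofPred_eq, Set.mem_iInter]
    exact forall_and.symm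
  rw [this]
  apply isClosed_iInter
  intro i
  have c : Continuous (fun x : Fin a → ℝ => x i) := continuous_apply i
  refine IsClosed.inter (IsClosed.inter (isClosed_le continuous_const c) (isClosed_le c continuous_const)) ?_
  refine IsClosed.inter ?_ ?_
  · by_cases h : F i = some false
    · simp only [h, forall_const]
      exact isClosed_eq c continuous_const
    · simp only [h, false_imp_iff]
      exact isClosed_univ
  · by_cases h : F i = some true
    · simp only [h, forall_const]
      exact isClosed_eq c continuous_const
    · simp only [h, false_imp_iff]
      exact isClosed_univ

lemma rf_subset_Icc (F : CubeFace a) : rf F ⊆ Set.Icc (0 : Fin a → ℝ) 1 :=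
  fun _ hx => ⟨fun i => (hx.1 i).1, fun i => (hx.1 i).2⟩

lemma rf_compact (F : CubeFace a) : IsCompact (rf F) :=
  isCompact_Icc.of_isClosed_subset (rf_closed F) (rf_subset_Icc F)

instance : Finite (CubeFace a) := by unfold CubeFace; infer_instance

lemma real_compact (K : Set (CubeFace a)) : IsCompact (real K) := by
  have : real K = ⋃ F ∈ K, rf F := rfl
  rw [this]
  exact (Set.toFinite K).isCompact_biUnion (fun F _ => rf_compact F)

/-- barycenter -/
noncomputable def bary (F : CubeFace a) : Fin a → ℝ := fun i => match F i with
  | none => 1/2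
  | some false => 0
  | some true => 1

lemma bary_mem (F : CubeFace a) : bary F ∈ rf F := by
  refine ⟨fun i => ?_, fun i => ⟨fun h => ?_, fun h => ?_⟩⟩
  · unfold bary
    rcases F i with _ | (_ | _) <;> norm_num
  · simp [bary, h]
  · simp [bary, h]

/-- a vertex of a face -/
def vx (F : CubeFace a) : Fin a → Bool := fun i => (F i).getD false

lemma vx_le (F : CubeFace a) : toFace (vx F) ≤ F := by
  intro i
  cases h : F i with
  | none => exact Or.inl rfl
  | some b => right; simp [toFace, vx, h]

/-- The box of a cell. -/
def rfc : Cell a → Set (Fin a → ℝ)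
  | none => ∅
  | some F => rf F

lemma acyclic_inter (P : Set (CubeFace a)) (v : Fin a → Bool) (hv : ∀ G ∈ P, toFace v ≤ G)
    {z : Ch (Cell a)} (hz : z ∈ spt (ac {F | ∀ G ∈ P, F ≤ G})) (hd : bd z = 0) :
    ∃ w ∈ spt (ac {F | ∀ G ∈ P, F ≤ G}), bd w = z := by
  refine acyclic (K := {F | ∀ G ∈ P, F ≤ G}) v hv ?_ ?_ hz hd
  · intro F hF i _ G hG j
    by_cases hj : j = i
    · subst hj
      simpa [toFace] using hv G hG j
    · simpa [hj] using hF G hG j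
  · intro F hF i hi G hG j
    by_cases hj : j = i
    · subst hj
      left
      rcases hv G hG j with h | h
      · exact h
      · rcases hF G hG j with h' | h'
        · exact h'
        · rw [← h, hi, toFace] at h'
          simp at h'
    · simpa [hj] using hF G hG j

theorem exists_s (δ : ℝ) (hδ : 0 < δ) : ∃ s : Ch (Cell a) →ₗ[ZMod 2] Ch (List (Fin a → ℝ)),
    s (single none 1) = single [] 1 ∧
    (∀ C, s (single C 1) ∈ spt (V δ (rfc C) ∩ {l | l.length = cdeg C})) ∧
    ∀ z, dL (s z) = s (bd z) := by
  obtain ⟨s, h1, h2, h3⟩ := BC.carrier (cellBC a) (listBC (Fin a → ℝ)) 0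
    (fun C => V δ (rfc C) ∩ {l | l.length = cdeg C})
    (by intro z; simp) (fun C => V δ (rfc C) ∩ {l | l.length + 1 = cdeg C})
    (by
      intro C C' h
      have hf := (bd_coeff C C').1 h
      have hdg : cdeg C' + 1 = cdeg C := (cellBC a).hdeg C C' h
      rintro l ⟨hl1, hl2⟩
      refine ⟨V_mono le_rfl ?_ hl1, ?_⟩
      · rcases C with _ | F <;> rcases C' with _ | G
        · exact hf.elim
        · exact hf.elim
        · exact Set.empty_subset _
        · exact rf_mono hf.1
      · simp only [Set.mem_ofPred_eq] at hl2 ⊢; omega)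
    (by intro b; simp)
    (fun _ => single [] 1)
    (by
      intro C hC
      constructor
      · apply single_spt
        refine ⟨⟨by simp, by simp⟩, ?_⟩
        have : cdeg C = 0 := hC
        simp [this]
      · show dL _ = _
        simp [dl])
    (by
      intro C hC z hz hd
      rcases C with _ | F
      · exact absurd rfl hC
      · have h1 := convex_Bd (rf_convex F) (rf_compact F).isBounded (bary_mem F) hδ
          (spt_mono Set.inter_subset_left hz) hd
        obtain ⟨w, hw, hwz⟩ := mem_Bd.1 h1
        refine BC.hom_fill (listBC _) (k := dim F) ?_ hw hwz
        refine spt_mono ?_ hz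
        rintro l ⟨_, hl⟩
        simp only [Set.mem_ofPred_eq, cdeg_some] at hl
        show l.length = dim F
        omega)
  refine ⟨s, h1 none rfl, h2, ?_⟩
  intro z
  have := h3 z
  rw [LinearMap.zero_apply, add_zero] at this
  exact this

theorem exists_pi : ∃ p : Ch (List (Fin a → Bool)) →ₗ[ZMod 2] Ch (Cell a),
    p (single [] 1) = single none 1 ∧
    (∀ l, p (single l 1) ∈ spt (ac {F | l ≠ [] ∧ ∀ G : CubeFace a, (∀ v ∈ l, toFace v ≤ G) → F ≤ G})) ∧
    ∀ z, bd (p z) = p (dL z) := by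
  obtain ⟨s, h1, h2, h3⟩ := BC.carrier (listBC (Fin a → Bool)) (cellBC a) 0
    (fun l => ac {F | l ≠ [] ∧ ∀ G : CubeFace a, (∀ v ∈ l, toFace v ≤ G) → F ≤ G})
    (by intro z; simp)
    (fun l => ac {F | l ≠ [] ∧ ∀ G : CubeFace a, (∀ v ∈ l, toFace v ≤ G) → F ≤ G})
    (by
      intro l l' h
      have h : dl l l' ≠ 0 := by
        have : dL (single l 1) l' ≠ 0 := h
        rwa [dL_single] at this
      have hs := (mem_spt.1 (dl_spt l) l' h).1
      apply ac_mono
      rintro F ⟨hF1, hF2⟩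
      refine ⟨?_, fun G hG => hF2 G (fun v hv => hG v (hs.subset hv))⟩
      rintro rfl
      exact hF1 (List.sublist_nil.1 hs))
    (by intro b; simp)
    (fun _ => single none 1)
    (by
      intro l _
      constructor
      · apply single_spt; simp
      · show bd _ = _
        simp [bd_none])
    (by
      intro l hl z hz hd
      rcases l with _ | ⟨v, l⟩
      · exact absurd rfl hl
      · have e : {F : CubeFace a | v :: l ≠ [] ∧ ∀ G : CubeFace a, (∀ w ∈ v :: l, toFace w ≤ G) → F ≤ G} =
            {F | ∀ G ∈ {G : CubeFace a | ∀ w ∈ v :: l, toFace w ≤ G}, F ≤ G} := by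
          ext F; simp
        simp only [e] at hz ⊢
        exact acyclic_inter {G : CubeFace a | ∀ w ∈ v :: l, toFace w ≤ G} v (fun G hG => hG v (by simp)) hz hd)
  refine ⟨s, h1 [] rfl, h2, ?_⟩
  intro z
  have := h3 z
  rw [LinearMap.zero_apply, add_zero] at this
  exact this

/-- Rounding. -/
noncomputable def rnd (x : Fin a → ℝ) : Fin a → Bool := fun i => decide (1/2 ≤ x i)

theorem compare (a : ℕ) : ∃ ρ : Ch (List (Fin a → ℝ)) →ₗ[ZMod 2] Ch (Cell a),
    (∀ z, bd (ρ z) = ρ (dL z)) ∧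
    (∀ L : Set (CubeFace a), DC L → ∀ z ∈ spt (V (1/2) (real L)), ρ z ∈ spt (ac L)) ∧
    ∀ δ : ℝ, 0 < δ → δ ≤ 1/2 → ∃ s : Ch (Cell a) →ₗ[ZMod 2] Ch (List (Fin a → ℝ)),
      (∀ z, dL (s z) = s (bd z)) ∧
      (∀ L : Set (CubeFace a), DC L → ∀ z ∈ spt (ac L), s z ∈ spt (V δ (real L))) ∧
      (∀ k, ∀ z ∈ spt ((cellBC a).gr k), s z ∈ spt ((listBC (Fin a → ℝ)).gr k)) ∧
      (∀ L : Set (CubeFace a), DC L → ∀ z ∈ spt (ac L), bd z = 0 →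
        ∃ w ∈ spt (ac L), bd w = ρ (s z) + z) := by
  obtain ⟨p, p1, p2, p3⟩ := exists_pi (a := a)
  have hρ : ∀ L : Set (CubeFace a), DC L → ∀ z ∈ spt (V (1/2) (real L)),
      (p ∘ₗ mp rnd) z ∈ spt (ac L) := by
    intro L hL z hz
    apply map_spt _ _ _ hz
    intro l hl
    simp only [LinearMap.comp_apply, mp_single]
    rcases l with _ | ⟨x, l⟩
    · rw [List.map_nil, p1]; apply single_spt; simp
    · refine spt_mono (ac_mono ?_) (p2 _)
      rintro F ⟨_, hF⟩
      obtain ⟨G, hG, hx⟩ := mem_real.1 (hl.1 x (by simp))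
      refine hL G hG F (hF G ?_)
      intro v hv
      obtain ⟨y, hy, rfl⟩ := List.mem_map.1 hv
      have hd := hl.2 x (by simp) y hy
      intro i
      have hdi := (dist_le_pi_dist x y i).trans_lt hd
      rw [Real.dist_eq, abs_lt] at hdi
      rcases hGi : G i with _ | (_ | _)
      · exact Or.inl rfl
      · right
        have := (hx.2 i).1 hGi
        simp only [toFace, rnd, Option.some.injEq, decide_eq_false_iff_not]
        linarith
      · right
        have := (hx.2 i).2 hGi
        simp only [toFace, rnd, Option.some.injEq, decide_eq_true_eq]
        linarith
  refine ⟨p ∘ₗ mp rnd, ?_, hρ, ?_⟩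
  · intro z
    simp [p3, dL_mp]
  intro δ hδ hδ2
  obtain ⟨s, s1, s2, s3⟩ := exists_s (a := a) δ hδ
  have hs : ∀ L : Set (CubeFace a), DC L → ∀ z ∈ spt (ac L), s z ∈ spt (V δ (real L)) := by
    intro L hL z hz
    apply map_spt _ _ _ hz
    intro C hC
    refine spt_mono (Set.inter_subset_left.trans (V_mono le_rfl ?_)) (s2 C)
    rcases C with _ | F
    · exact Set.empty_subset _
    · intro x hx
      exact mem_real.2 ⟨F, by simpa using hC, hx⟩
  refine ⟨s, s3, hs, ?_, ?_⟩
  · intro k z hz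
    apply map_spt _ _ _ hz
    intro C hC
    refine spt_mono ?_ (s2 C)
    rintro l ⟨_, hl⟩
    have hC : cdeg C = k := hC
    simp only [Set.mem_ofPred_eq] at hl
    show l.length = k
    omega
  · let θ : Ch (Cell a) →ₗ[ZMod 2] Ch (Cell a) := (p ∘ₗ mp rnd) ∘ₗ s + LinearMap.id
    obtain ⟨h, h1, h2, h3⟩ := BC.carrier (cellBC a) (cellBC a) θ
      (fun C => ac {G | ∃ F, C = some F ∧ G ≤ F})
      (by
        intro z
        show bd _ = θ (bd z)
        simp [θ, p3, dL_mp, s3])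
      (fun C => ac {G | ∃ F, C = some F ∧ G ≤ F})
      (by
        intro C C' hc
        have hf := (bd_coeff C C').1 hc
        apply ac_mono
        rintro G ⟨F, rfl, hF⟩
        rcases C with _ | F'
        · exact hf.elim
        · exact ⟨F', rfl, hF.trans hf.1⟩)
      (by
        intro C
        simp only [θ, LinearMap.add_apply, LinearMap.comp_apply, LinearMap.id_apply]
        refine Submodule.add_mem _ ?_ (single_spt ?_)
        · refine hρ _ ?_ _ (spt_mono (V_mono hδ2 subset_rfl) (hs _ ?_ _ (single_spt ?_)))
          · rintro G ⟨F, rfl, hF⟩ G' hG'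
            exact ⟨F, rfl, hG'.trans hF⟩
          · rintro G ⟨F, rfl, hF⟩ G' hG'
            exact ⟨F, rfl, hG'.trans hF⟩
          · rintro F rfl; exact ⟨F, rfl, le_rfl⟩
        · rintro F rfl; exact ⟨F, rfl, le_rfl⟩)
      (fun _ => 0)
      (by
        intro C hC
        refine ⟨Submodule.zero_mem _, ?_⟩
        rcases C with _ | F
        · simp [θ, s1, p1, add2]
        · have : cdeg (some F) = 0 := hC
          simp at this)
      (by
        intro C hC z hz hd
        rcases C with _ | F
        · exact absurd rfl hC
        · have e : {G : CubeFace a | ∃ F', some F = some F' ∧ G ≤ F'} = {G | ∀ F' ∈ ({F} : Set (CubeFace a)), G ≤ F'} := by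
            ext G; simp
          simp only [e] at hz ⊢
          exact acyclic_inter _ (vx F) (fun G hG => by rw [Set.mem_singleton_iff.1 hG]; exact vx_le F) hz hd)
    intro L hL z hz hd
    refine ⟨h z, ?_, ?_⟩
    · apply map_spt _ _ _ hz
      intro C hC
      refine spt_mono (ac_mono ?_) (h2 C)
      rintro G ⟨F, rfl, hF⟩
      exact hL F (by simpa using hC) G hF
    · have h3 : bd (h z) = h (bd z) + θ z := h3 z
      rw [hd, map_zero, zero_add] at h3
      exact h3

end compare
end CubManif

namespace CubManif
open Finsupp hiding some add_apply

section spheres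
variable {E : Type} [NormedAddCommGroup E] [NormedSpace ℝ E]

/-- unit sphere -/
def Sph (E : Type) [NormedAddCommGroup E] : Set E := {x | ‖x‖ = 1}

/-- normalization -/
noncomputable def nz (x : E) : E := ‖x‖⁻¹ • x

lemma nz_mem {x : E} (h : x ≠ 0) : nz x ∈ Sph E := by
  show ‖nz x‖ = 1
  rw [nz, norm_smul, norm_inv, norm_norm]
  exact inv_mul_cancel₀ (norm_ne_zero_iff.2 h)

lemma nz_of_mem {x : E} (h : x ∈ Sph E) : nz x = x := by
  have h : ‖x‖ = 1 := h
  simp [nz, h]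

lemma nz_cont {T : Type} [TopologicalSpace T] {f : T → E} {X : Set T} (hf : ContinuousOn f X)
    (h : ∀ x ∈ X, f x ≠ 0) : ContinuousOn (fun x => nz (f x)) X := by
  unfold nz
  exact (hf.norm.inv₀ (fun x hx => norm_ne_zero_iff.2 (h x hx))).smul hf

theorem contr_Bd {X : Set E} (hX : IsCompact X) (hXS : X ⊆ Sph E) {q : E} (hq : q ∈ Sph E)
    (hqX : -q ∉ X) {η : ℝ} (hη : 0 < η) :
    ∃ ε > 0, ∀ z ∈ spt (V ε X), dL z = 0 → z ∈ Bd (V η (Sph E)) := by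
  have ne : ∀ p ∈ Set.Icc (0:ℝ) 1 ×ˢ X, (1 - p.1) • p.2 + p.1 • q ≠ 0 := by
    rintro ⟨s, x⟩ ⟨⟨h0, h1⟩, hx⟩ h
    simp only at h h0 h1 hx
    have hx1 : ‖x‖ = 1 := hXS hx
    have hq1 : ‖q‖ = 1 := hq
    have e : (1 - s) • x = - (s • q) := eq_neg_of_add_eq_zero_left h
    have e2 : ‖(1 - s) • x‖ = ‖s • q‖ := by rw [e, norm_neg]
    rw [norm_smul, norm_smul, hx1, hq1, Real.norm_of_nonneg (by linarith), Real.norm_of_nonneg h0] at e2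
    have hs : s = 1/2 := by linarith
    subst hs
    apply hqX
    have : x = -q := by
      have e3 : (1/2 : ℝ) • x = (1/2 : ℝ) • (-q) := by
        rw [smul_neg, ← e]; norm_num
      exact smul_right_injective E (by norm_num : (1/2:ℝ) ≠ 0) e3
    rwa [← this]
  obtain ⟨ε, hε, h⟩ := homotopy_Bd (Y := Sph E) hX (fun s x => nz ((1 - s) • x + s • q))
    (by
      apply nz_cont _ ne
      fun_prop)
    (by
      intro t ht x hx
      exact nz_mem (ne (t, x) ⟨ht, hx⟩)) hη
  refine ⟨ε, hε, ?_⟩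
  intro z hz hd
  have h1 := h z hz hd
  have e0 : mp (fun x => nz ((1 - (0:ℝ)) • x + (0:ℝ) • q)) z = z := by
    conv_rhs => rw [← mp_id z]
    apply mp_congr _ hz
    intro l hl x hx
    simp [nz_of_mem (hXS (hl.1 x hx))]
  have e1 : mp (fun x : E => nz ((1 - (1:ℝ)) • x + (1:ℝ) • q)) z = mp (fun _ => q) z := by
    apply mp_congr _ hz
    intro l hl x hx
    simp [nz_of_mem hq]
  rw [e0, e1] at h1
  have h2 := const_Bd hη hq (z := z) hd
  have := Submodule.add_mem _ h1 h2
  rwa [add_assoc, add2, add_zero] at this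

lemma sph_compact [ProperSpace E] : IsCompact (Sph E) := by
  have : Sph E = Metric.sphere (0 : E) 1 := by
    ext x; simp [Sph]
  rw [this]; exact isCompact_sphere _ _

/-- The unit sphere for the sup norm. -/
abbrev SS (d : ℕ) : Set (Fin d → ℝ) := Sph (Fin d → ℝ)

lemma R_spt_self {B : Type} {S T : Set B} {z : Ch B} (h : z ∈ spt T) : R S z ∈ spt T :=
  spt_mono Set.inter_subset_right (R_spt S T h)

lemma norm_tail {d : ℕ} {x : Fin (d+1) → ℝ} (hx : x ∈ SS (d+1)) (h : |x 0| < 1) :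
    Fin.tail x ∈ SS d := by
  have hx : ‖x‖ = 1 := hx
  show ‖Fin.tail x‖ = 1
  apply le_antisymm
  · rw [pi_norm_le_iff_of_nonneg zero_le_one]
    intro i
    rw [← hx]
    exact norm_le_pi_norm x i.succ
  · by_contra hn
    push Not at hn
    have : ‖x‖ < 1 := by
      rw [pi_norm_lt_iff one_pos]
      intro i
      refine Fin.cases h ?_ i
      intro j
      exact (norm_le_pi_norm (Fin.tail x) j).trans_lt hn
    linarith

lemma norm_cons {d : ℕ} {y : Fin d → ℝ} (hy : y ∈ SS d) : (Fin.cons 0 y : Fin (d+1) → ℝ) ∈ SS (d+1) := by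
  have hy : ‖y‖ = 1 := hy
  show ‖(Fin.cons 0 y : Fin (d+1) → ℝ)‖ = 1
  apply le_antisymm
  · rw [pi_norm_le_iff_of_nonneg zero_le_one]
    intro i
    refine Fin.cases (by simp) ?_ i
    intro j
    rw [← hy]
    simpa using norm_le_pi_norm y j
  · rw [← hy, pi_norm_le_iff_of_nonneg (norm_nonneg _)]
    intro j
    simpa using norm_le_pi_norm (Fin.cons 0 y : Fin (d+1) → ℝ) j.succ

lemma dist_tail {d : ℕ} (x y : Fin (d+1) → ℝ) : dist (Fin.tail x) (Fin.tail y) ≤ dist x y := by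
  rw [dist_pi_le_iff dist_nonneg]
  intro i
  exact dist_le_pi_dist x y i.succ

lemma dist_cons_lt {d : ℕ} {r : ℝ} (hr : 0 < r) {x y : Fin (d+1) → ℝ}
    (h0 : dist (x 0) (y 0) < r) (h : dist (Fin.tail x) (Fin.tail y) < r) : dist x y < r := by
  rw [dist_pi_lt_iff hr]
  intro i
  refine Fin.cases h0 ?_ i
  intro j
  exact (dist_le_pi_dist (Fin.tail x) (Fin.tail y) j).trans_lt h

/-- Connecting map for spheres. -/
noncomputable def conn (d : ℕ) : Ch (List (Fin (d+1) → ℝ)) →ₗ[ZMod 2] Ch (List (Fin d → ℝ)) :=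
  mp Fin.tail ∘ₗ dL ∘ₗ R {l | ∀ x ∈ l, 0 ≤ x 0}

theorem sphere_step (d : ℕ) {η : ℝ} (hη : 0 < η) : ∃ ε1 > 0, ∀ ε > 0, ε ≤ ε1 → ε ≤ 1/4 →
    ∀ z ∈ spt (V ε (SS (d+1))), dL z = 0 →
      conn d z ∈ spt (V ε (SS d)) ∧ (conn d z ∈ Bd (V ε1 (SS d)) → z ∈ Bd (V η (SS (d+1)))) := by
  set S := SS (d+1) with hS
  set Sp : Set (Fin (d+1) → ℝ) := {x | x ∈ S ∧ -(1/2) ≤ x 0} with hSp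
  set Sm : Set (Fin (d+1) → ℝ) := {x | x ∈ S ∧ x 0 ≤ 1/2} with hSm
  have c0 : Continuous (fun x : Fin (d+1) → ℝ => x 0) := continuous_apply 0
  have cSp : IsCompact Sp := sph_compact.inter_right (isClosed_le continuous_const c0)
  have cSm : IsCompact Sm := sph_compact.inter_right (isClosed_le c0 continuous_const)
  set p : Fin (d+1) → ℝ := Pi.single 0 1 with hp
  have hpS : p ∈ S := by
    show ‖p‖ = 1
    simp [hp, Pi.norm_single]
  have hpS' : -p ∈ S := by
    show ‖-p‖ = 1
    rw [norm_neg]; exact hpS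
  obtain ⟨ea, hea, ha⟩ := contr_Bd cSp (fun x hx => hx.1) hpS (by
    intro h; have := h.2; simp [hp] at this; norm_num at this) hη
  obtain ⟨eb, heb, hb⟩ := contr_Bd cSm (fun x hx => hx.1) hpS' (by
    intro h; have := h.2; simp [hp] at this; norm_num at this) hη
  refine ⟨min ea eb, lt_min hea heb, ?_⟩
  intro ε hε hε1 hε4 z hz hd
  set zp := R {l : List (Fin (d+1) → ℝ) | ∀ x ∈ l, 0 ≤ x 0} z with hzp
  set zm := R {l : List (Fin (d+1) → ℝ) | ∀ x ∈ l, 0 ≤ x 0}ᶜ z with hzm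
  have hsum : zp + zm = z := R_compl _ _
  have hzp1 : zp ∈ spt (V ε {x | x ∈ S ∧ 0 ≤ x 0}) := by
    refine spt_mono ?_ (R_spt _ _ hz)
    rintro l ⟨h1, h2⟩
    exact ⟨fun x hx => ⟨h2.1 x hx, h1 x hx⟩, h2.2⟩
  have hzm1 : zm ∈ spt (V ε {x | x ∈ S ∧ x 0 < ε}) := by
    refine spt_mono ?_ (R_spt _ _ hz)
    rintro l ⟨h1, h2⟩
    refine ⟨fun x hx => ⟨h2.1 x hx, ?_⟩, h2.2⟩
    simp only [Set.mem_compl_iff, Set.mem_ofPred_eq, not_forall, not_le] at h1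
    obtain ⟨y, hy, hy0⟩ := h1
    have := (dist_le_pi_dist x y 0).trans_lt (h2.2 x hx y hy)
    rw [Real.dist_eq, abs_lt] at this
    linarith
  set c := dL zp with hc
  have hc' : c = dL zm := by
    rw [← add2_eq, hc, ← map_add, hsum, hd]
  set C : Set (Fin (d+1) → ℝ) := {x | x ∈ S ∧ 0 ≤ x 0 ∧ x 0 < ε} with hC
  have hcC : c ∈ spt (V ε C) := by
    have h1 := dL_spt V_sub hzp1
    have h2 := dL_spt V_sub hzm1
    rw [← hc'] at h2
    rw [mem_spt] at *
    intro l hl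
    have k1 := h1 l hl
    have k2 := h2 l hl
    exact ⟨fun x hx => ⟨(k1.1 x hx).1, (k1.1 x hx).2, (k2.1 x hx).2⟩, k1.2⟩
  have hcd : dL c = 0 := dL_dL _
  have Ctail : ∀ x ∈ C, Fin.tail x ∈ SS d := by
    rintro x ⟨h1, h2, h3⟩
    apply norm_tail h1
    rw [abs_lt]; constructor <;> linarith
  have hconn : conn d z = mp Fin.tail c := rfl
  refine ⟨?_, ?_⟩
  · rw [hconn]
    exact mp_spt (V_map Ctail (fun x _ y _ h => (dist_tail x y).trans_lt h)) hcC
  intro hcb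
  set j : (Fin d → ℝ) → (Fin (d+1) → ℝ) := fun y => Fin.cons 0 y with hj
  have hh : mp id c + mp (j ∘ Fin.tail) c ∈ Bd (V ε (Sp ∩ Sm)) := by
    refine prism_Bd (X := C) ?_ ?_ ?_ ?_ ?_ hcC hcd
    · rintro x ⟨h1, h2, h3⟩
      exact ⟨⟨h1, by simp only [id]; linarith⟩, ⟨h1, by simp only [id]; linarith⟩⟩
    · intro x hx
      have := norm_cons (Ctail x hx)
      exact ⟨⟨this, by simp [hj]⟩, ⟨this, by simp [hj]⟩⟩
    · intro x _ y _ h; exact h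
    · intro x hx y _ h
      apply dist_cons_lt hε
      · simp only [hj, id, Function.comp, Fin.cons_zero, Real.dist_eq, sub_zero]
        rw [abs_of_nonneg hx.2.1]; exact hx.2.2
      · simp only [hj, id, Function.comp, Fin.tail_cons]
        exact (dist_tail x y).trans_lt h
    · intro x hx y _ h
      apply dist_cons_lt hε
      · simpa [hj] using hε
      · simp only [hj, Function.comp, Fin.tail_cons]
        exact (dist_tail x y).trans_lt h
  have hbb : mp j (conn d z) ∈ Bd (V (min ea eb) (Sp ∩ Sm)) := by
    apply mp_Bd (V_map _ _) hcb
    · intro y hy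
      have := norm_cons hy
      exact ⟨⟨this, by simp [hj]⟩, ⟨this, by simp [hj]⟩⟩
    · intro x _ y _ h
      apply dist_cons_lt (lt_min hea heb)
      · simpa [hj] using lt_min hea heb
      · simpa [hj, Fin.tail_cons] using h
  have hcB : c ∈ Bd (V (min ea eb) (Sp ∩ Sm)) := by
    have h1 := Submodule.add_mem _ (Bd_mono (V_mono hε1 subset_rfl) hh) hbb
    rw [hconn, mp_mp, mp_id, add_assoc, add2, add_zero] at h1
    exact h1
  obtain ⟨e, he, hec⟩ := mem_Bd.1 hcB
  have hsp : {x : Fin (d+1) → ℝ | x ∈ S ∧ 0 ≤ x 0} ⊆ Sp := fun x hx => ⟨hx.1, by linarith [hx.2]⟩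
  have hsm : {x : Fin (d+1) → ℝ | x ∈ S ∧ x 0 < ε} ⊆ Sm := fun x hx => ⟨hx.1, by linarith [hx.2]⟩
  have k1 := ha (zp + e) (Submodule.add_mem _
      (spt_mono (V_mono (hε1.trans (min_le_left _ _)) hsp) hzp1)
      (spt_mono (V_mono (min_le_left _ _) Set.inter_subset_left) he))
      (by rw [map_add, hec, ← hc, add2])
  have k2 := hb (zm + e) (Submodule.add_mem _
      (spt_mono (V_mono (hε1.trans (min_le_right _ _)) hsm) hzm1)
      (spt_mono (V_mono (min_le_right _ _) Set.inter_subset_right) he))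
      (by rw [map_add, hec, ← hc', add2])
  have := Submodule.add_mem _ k1 k2
  have e2 : zp + e + (zm + e) = z := by
    rw [← hsum]
    have := add2 e
    calc _ = zp + zm + (e + e) := by abel
      _ = _ := by rw [this, add_zero]
  rwa [e2] at this

lemma conn_gr (d k : ℕ) {z : Ch (List (Fin (d+1) → ℝ))} (hz : z ∈ spt ((listBC _).gr (k+1))) :
    conn d z ∈ spt ((listBC _).gr k) := by
  have h1 : dL (R {l : List (Fin (d+1) → ℝ) | ∀ x ∈ l, 0 ≤ x 0} z) ∈ spt ((listBC _).gr k) :=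
    (listBC _).d_mem_gr k (R_spt_self hz)
  refine mp_spt ?_ h1
  intro l hl
  have hl : l.length = k := hl
  show (l.map _).length = k
  simpa using hl

theorem sphere_claim (d : ℕ) : ∀ η > (0:ℝ), ∃ ε > (0:ℝ),
    (∀ k < d, ∀ z ∈ spt (V ε (SS d)), z ∈ spt ((listBC _).gr k) → dL z = 0 → z ∈ Bd (V η (SS d))) ∧
    (∀ z ∈ spt (V ε (SS d)), z ∈ spt ((listBC _).gr d) → dL z = 0 →
      ∀ w ∈ spt (V ε (SS d)), w ∈ spt ((listBC _).gr d) → dL w = 0 →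
      z ∈ Bd (V η (SS d)) ∨ w ∈ Bd (V η (SS d)) ∨ z + w ∈ Bd (V η (SS d))) := by
  classical
  induction d with
  | zero =>
    intro η hη
    refine ⟨1, one_pos, by simp, ?_⟩
    have key : ∀ z : Ch (List (Fin 0 → ℝ)), z ∈ spt ((listBC _).gr 0) → z = 0 ∨ z = single [] 1 := by
      intro z hz
      have : z = single [] (z []) := by
        ext l
        by_cases hl : l = []
        · subst hl; simp
        · have : z l = 0 := by
            by_contra hn
            have : l.length = 0 := mem_spt.1 hz l hn
            exact hl (List.length_eq_zero_iff.1 this)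
          rw [this, single_eq_of_ne hl]
      rcases zmod2_cases (z []) with h | h <;> rw [h] at this
      · left; rw [this]; simp
      · right; exact this
    intro z _ hz _ w _ hw _
    rcases key z hz with rfl | rfl
    · left; exact Submodule.zero_mem _
    · rcases key w hw with rfl | rfl
      · right; left; exact Submodule.zero_mem _
      · right; right; rw [add2]; exact Submodule.zero_mem _
  | succ d ih =>
    intro η hη
    obtain ⟨ε1, hε1, h1⟩ := sphere_step d hη
    obtain ⟨ε2, hε2, h2a, h2b⟩ := ih ε1 hε1
    set ε := min (min ε1 ε2) (1/4) with hε
    have l1 : ε ≤ ε1 := (min_le_left _ _).trans (min_le_left _ _)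
    have l2 : ε ≤ ε2 := (min_le_left _ _).trans (min_le_right _ _)
    have l3 : ε ≤ 1/4 := min_le_right _ _
    have hε0 : 0 < ε := lt_min (lt_min hε1 hε2) (by norm_num)
    have hcc : ∀ z : Ch (List (Fin (d+1) → ℝ)), dL (conn d z) = 0 := by
      intro z
      simp only [conn, LinearMap.comp_apply, dL_mp, dL_dL, map_zero]
    refine ⟨ε, hε0, ?_, ?_⟩
    · intro k hk z hz hzk hd
      obtain ⟨k1, k2⟩ := h1 ε hε0 l1 l3 z hz hd
      apply k2
      rcases k with _ | k
      · have : dL (R {l : List (Fin (d+1) → ℝ) | ∀ x ∈ l, 0 ≤ x 0} z) = 0 := by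
          apply map_eq_spt dL 0 _ (R_spt_self hzk)
          intro l hl
          have : l = [] := List.length_eq_zero_iff.1 hl
          subst this
          simp [dl]
        simp only [conn, LinearMap.comp_apply, this, map_zero]
        exact Submodule.zero_mem _
      · exact h2a k (by omega) _ (spt_mono (V_mono l2 subset_rfl) k1) (conn_gr d k hzk) (hcc z)
    · intro z hz hzk hzd w hw hwk hwd
      obtain ⟨k1, k2⟩ := h1 ε hε0 l1 l3 z hz hzd
      obtain ⟨k3, k4⟩ := h1 ε hε0 l1 l3 w hw hwd
      obtain ⟨k5, k6⟩ := h1 ε hε0 l1 l3 (z + w) (Submodule.add_mem _ hz hw) (by rw [map_add, hzd, hwd, add_zero])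
      rcases h2b _ (spt_mono (V_mono l2 subset_rfl) k1) (conn_gr d d hzk) (hcc z)
        _ (spt_mono (V_mono l2 subset_rfl) k3) (conn_gr d d hwk) (hcc w) with h | h | h
      · left; exact k2 h
      · right; left; exact k4 h
      · right; right; apply k6; rwa [map_add]

end spheres
end CubManif

namespace CubManif
open Finsupp hiding some add_apply
open CubeFace

section geom
open scoped Classical
variable {a : ℕ}

/-- The closed star of `G`. -/
def Nb (M : Set (CubeFace a)) (G : CubeFace a) : Set (CubeFace a) := {F | ∃ C ∈ M, G ≤ C ∧ F ≤ C}

/-- The link part of the star. -/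
def Lk (M : Set (CubeFace a)) (G : CubeFace a) : Set (CubeFace a) := {F | F ∈ Nb M G ∧ ¬ G ≤ F}

lemma Nb_DC (M : Set (CubeFace a)) (G : CubeFace a) : DC (Nb M G) := by
  rintro F ⟨C, hC, h1, h2⟩ F' hF'
  exact ⟨C, hC, h1, hF'.trans h2⟩

lemma Lk_DC (M : Set (CubeFace a)) (G : CubeFace a) : DC (Lk M G) := by
  rintro F ⟨h1, h2⟩ F' hF'
  exact ⟨Nb_DC M G F h1 F' hF', fun h => h2 (h.trans hF')⟩

lemma Nb_sub {M : Set (CubeFace a)} (hM : DC M) (G : CubeFace a) : Nb M G ⊆ M := by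
  rintro F ⟨C, hC, h1, h2⟩; exact hM C hC F h2

lemma real_mono {K L : Set (CubeFace a)} (h : K ⊆ L) : real K ⊆ real L := by
  intro x hx
  obtain ⟨F, hF, hx⟩ := mem_real.1 hx
  exact mem_real.2 ⟨F, h hF, hx⟩

/-- weights -/
noncomputable def wt (G : CubeFace a) (i : Fin a) : ℝ := if G i = none then 2 else 1

/-- gauge -/
noncomputable def gg (G : CubeFace a) (y : Fin a → ℝ) : ℝ := ‖fun i => wt G i * (y i - bary G i)‖

lemma wt_pos (G : CubeFace a) (i : Fin a) : 1 ≤ wt G i := by unfold wt; split_ifs <;> norm_num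

lemma gg_le {G : CubeFace a} {y : Fin a → ℝ} {r : ℝ} (hr : 0 ≤ r) :
    gg G y ≤ r ↔ ∀ i, wt G i * |y i - bary G i| ≤ r := by
  unfold gg
  rw [pi_norm_le_iff_of_nonneg hr]
  refine forall_congr' fun i => ?_
  rw [norm_mul, Real.norm_of_nonneg (zero_le_one.trans (wt_pos G i)), Real.norm_eq_abs]

lemma le_gg (G : CubeFace a) (y : Fin a → ℝ) (i : Fin a) : wt G i * |y i - bary G i| ≤ gg G y :=
  (gg_le (norm_nonneg _)).1 le_rfl i

lemma gg_nonneg (G : CubeFace a) (y : Fin a → ℝ) : 0 ≤ gg G y := norm_nonneg _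

lemma gg_cont (G : CubeFace a) : Continuous (gg G) := by
  unfold gg; fun_prop

lemma gg_eq_zero {G : CubeFace a} {y : Fin a → ℝ} : gg G y = 0 ↔ y = bary G := by
  constructor
  · intro h
    ext i
    have := le_gg G y i
    rw [h] at this
    have h2 := wt_pos G i
    have h3 : |y i - bary G i| = 0 := by
      have := abs_nonneg (y i - bary G i)
      nlinarith
    linarith [abs_eq_zero.1 h3]
  · rintro rfl
    simp [gg]
    rfl

/-- scaling about the barycenter -/
noncomputable def sc (G : CubeFace a) (t : ℝ) (y : Fin a → ℝ) : Fin a → ℝ := bary G + t • (y - bary G)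

lemma gg_sc (G : CubeFace a) {t : ℝ} (ht : 0 ≤ t) (y : Fin a → ℝ) : gg G (sc G t y) = t * gg G y := by
  unfold gg
  rw [← Real.norm_of_nonneg ht, ← norm_smul]
  congr 1
  ext i
  simp [sc]
  rw [abs_of_nonneg ht]
  ring

lemma sc_sc (G : CubeFace a) (s t : ℝ) (y : Fin a → ℝ) : sc G s (sc G t y) = sc G (s * t) y := by
  ext i; simp [sc]; ring

lemma sc_one (G : CubeFace a) (y : Fin a → ℝ) : sc G 1 y = y := by
  ext i; simp [sc]

lemma bary_none {G : CubeFace a} {i : Fin a} (h : G i = none) : bary G i = 1/2 := by simp [bary, h]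
lemma bary_f {G : CubeFace a} {i : Fin a} (h : G i = some false) : bary G i = 0 := by simp [bary, h]
lemma bary_t {G : CubeFace a} {i : Fin a} (h : G i = some true) : bary G i = 1 := by simp [bary, h]

lemma gg_cube {G : CubeFace a} {y : Fin a → ℝ} (h : ∀ i, 0 ≤ y i ∧ y i ≤ 1) : gg G y ≤ 1 := by
  rw [gg_le zero_le_one]
  intro i
  have := h i
  rcases hG : G i with _ | (_ | _)
  · have : |y i - 1/2| ≤ 1/2 := by rw [abs_le]; constructor <;> linarith
    rw [bary_none hG]; simp only [wt, hG, if_true]; linarith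
  · rw [bary_f hG]; simp only [wt, hG]; simp; rw [abs_le]; constructor <;> linarith
  · rw [bary_t hG]; simp only [wt, hG]; simp; rw [abs_le]; constructor <;> linarith

lemma gg_real {M : Set (CubeFace a)} {G : CubeFace a} {y : Fin a → ℝ} (hy : y ∈ real M) : gg G y ≤ 1 := by
  obtain ⟨F, hF, hy⟩ := mem_real.1 hy
  exact gg_cube hy.1

/-- If some fixed coordinate of a face is not that of `G`, the gauge is one. -/
lemma gg_of_not_le {F G : CubeFace a} {y : Fin a → ℝ} (hy : y ∈ rf F) (h : ¬ G ≤ F) : gg G y = 1 := by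
  apply le_antisymm (gg_cube hy.1)
  rw [le_def] at h
  push Not at h
  obtain ⟨i, h1, h2⟩ := h
  refine le_trans ?_ (le_gg G y i)
  rcases hF : F i with _ | (_ | _)
  · exact absurd hF h1
  · rw [(hy.2 i).1 hF]
    rcases hG : G i with _ | (_ | _)
    · rw [bary_none hG]; simp [wt, hG]
    · rw [hF, hG] at h2; exact absurd rfl h2
    · rw [bary_t hG]; simp [wt, hG]
  · rw [(hy.2 i).2 hF]
    rcases hG : G i with _ | (_ | _)
    · rw [bary_none hG]; simp [wt, hG]; norm_num [abs_of_pos]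
    · rw [bary_f hG]; simp [wt, hG]
    · rw [hF, hG] at h2; exact absurd rfl h2

lemma Lk_gg {M : Set (CubeFace a)} {G : CubeFace a} {y : Fin a → ℝ} (hy : y ∈ real (Lk M G)) :
    gg G y = 1 := by
  obtain ⟨F, hF, hy⟩ := mem_real.1 hy
  exact gg_of_not_le hy hF.2

lemma gg_Lk {M : Set (CubeFace a)} {G : CubeFace a} {y : Fin a → ℝ} (hy : y ∈ real (Nb M G))
    (h1 : gg G y = 1) : y ∈ real (Lk M G) := by
  obtain ⟨F, ⟨C, hC, hGC, hFC⟩, hyF⟩ := mem_real.1 hy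
  have hyC := rf_mono hFC hyF
  have ex : ∃ i, wt G i * |y i - bary G i| = 1 := by
    by_contra hn
    push Not at hn
    have hlt : ∀ i, wt G i * |y i - bary G i| < 1 := fun i =>
      lt_of_le_of_ne ((le_gg G y i).trans h1.le) (hn i)
    have : gg G y < 1 := by
      unfold gg
      rw [pi_norm_lt_iff one_pos]
      intro i
      rw [norm_mul, Real.norm_of_nonneg (zero_le_one.trans (wt_pos G i)), Real.norm_eq_abs]
      exact hlt i
    linarith
  obtain ⟨i, hi⟩ := ex
  -- find the value
  have key : ∃ b : Bool, G i ≠ some b ∧ y i = (if b then 1 else 0) ∧ C i = none := by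
    have hyi := hyC.1 i
    rcases hG : G i with _ | (_ | _)
    · have hCi : C i = none := by
        rcases hGC i with h | h
        · exact h
        · rw [← h, hG]
      rw [bary_none hG] at hi
      simp only [wt, hG, if_true] at hi
      have : |y i - 1/2| = 1/2 := by linarith
      rcases (abs_eq (by norm_num)).1 this with h | h
      · exact ⟨true, by simp, by simp; linarith, hCi⟩
      · exact ⟨false, by simp, by simp; linarith, hCi⟩
    · rw [bary_f hG] at hi
      simp only [wt, hG] at hi
      simp at hi
      rw [abs_of_nonneg hyi.1] at hi
      refine ⟨true, by simp, by simpa using hi, ?_⟩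
      rcases hGC i with h | h
      · exact h
      · rw [hG] at h
        have := (hyC.2 i).1 h.symm
        linarith
    · rw [bary_t hG] at hi
      simp only [wt, hG] at hi
      simp at hi
      rw [abs_of_nonpos (by linarith)] at hi
      refine ⟨false, by simp, by simp; linarith, ?_⟩
      rcases hGC i with h | h
      · exact h
      · rw [hG] at h
        have := (hyC.2 i).2 h.symm
        linarith
  obtain ⟨b, hb1, hb2, hb3⟩ := key
  refine mem_real.2 ⟨upd C i (some b), ⟨⟨C, hC, hGC, upd_le hb3 _⟩, ?_⟩, hyC.1, ?_⟩
  · intro h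
    have := h i
    simp [hb1] at this
  · intro j
    by_cases hj : j = i
    · subst hj
      cases b <;> simp at hb2 ⊢ <;> exact hb2
    · rw [upd_ne _ _ hj]; exact hyC.2 j

lemma scale_mem {M : Set (CubeFace a)} {G : CubeFace a} {y : Fin a → ℝ} (hy : y ∈ real (Nb M G))
    {t : ℝ} (h0 : 0 ≤ t) (h1 : t ≤ 1) : sc G t y ∈ real (Nb M G) := by
  obtain ⟨F, ⟨C, hC, hGC, hFC⟩, hyF⟩ := mem_real.1 hy
  refine mem_real.2 ⟨C, ⟨C, hC, hGC, le_rfl⟩, ?_⟩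
  have := (rf_convex C) (rf_mono hGC (bary_mem G)) (rf_mono hFC hyF) (sub_nonneg.2 h1) h0 (by ring)
  convert this using 1
  ext i; simp [sc]; ring

/-- radial projection -/
noncomputable def rad (G : CubeFace a) (y : Fin a → ℝ) : Fin a → ℝ := sc G (gg G y)⁻¹ y

lemma gg_rad {G : CubeFace a} {y : Fin a → ℝ} (h0 : gg G y ≠ 0) : gg G (rad G y) = 1 := by
  unfold rad
  rw [gg_sc G (inv_nonneg.2 (gg_nonneg G y)), inv_mul_cancel₀ h0]

lemma rad_mem {M : Set (CubeFace a)} {G : CubeFace a} {y : Fin a → ℝ} (hy : y ∈ real M)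
    (h0 : gg G y ≠ 0) (h1 : gg G y < 1) : rad G y ∈ real (Lk M G) := by
  obtain ⟨C, hC, hyC⟩ := mem_real.1 hy
  have hGC : G ≤ C := by
    by_contra h
    rw [gg_of_not_le hyC h] at h1
    exact lt_irrefl _ h1
  apply gg_Lk _ (gg_rad h0)
  refine mem_real.2 ⟨C, ⟨C, hC, hGC, le_rfl⟩, ?_⟩
  have hpos : 0 < gg G y := lt_of_le_of_ne (gg_nonneg G y) (Ne.symm h0)
  set γ := gg G y with hγ
  have hr : ∀ i, rad G y i = bary G i + (y i - bary G i) / γ := by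
    intro i; simp [rad, sc, ← hγ]; ring
  refine ⟨?_, ?_⟩
  · intro i
    have h2 := le_gg G y i
    rw [← hγ] at h2
    have hyi := hyC.1 i
    rw [hr i]
    rcases hG : G i with _ | (_ | _)
    · rw [bary_none hG] at h2 ⊢
      simp only [wt, hG, if_true] at h2
      have h3 : |(y i - 1/2) / γ| ≤ 1/2 := by
        rw [abs_div, abs_of_pos hpos, div_le_iff₀ hpos]; linarith
      rw [abs_le] at h3
      constructor <;> linarith
    · rw [bary_f hG] at h2 ⊢
      simp only [wt, hG] at h2
      simp at h2
      rw [abs_of_nonneg hyi.1] at h2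
      simp only [sub_zero, zero_add]
      exact ⟨div_nonneg hyi.1 hpos.le, (div_le_one hpos).2 h2⟩
    · rw [bary_t hG] at h2 ⊢
      simp only [wt, hG] at h2
      simp at h2
      rw [abs_of_nonpos (by linarith)] at h2
      have e1 : -1 ≤ (y i - 1) / γ := by rw [le_div_iff₀ hpos]; linarith
      have e2 : (y i - 1) / γ ≤ 0 := div_nonpos_of_nonpos_of_nonneg (by linarith) hpos.le
      constructor <;> linarith
  · intro i
    refine ⟨fun h => ?_, fun h => ?_⟩
    · have e := (hyC.2 i).1 h
      have hG : G i = some false := by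
        rcases hGC i with h' | h'
        · rw [h] at h'; exact absurd h' (by simp)
        · rw [h', h]
      rw [hr i, bary_f hG, e]; simp
    · have e := (hyC.2 i).2 h
      have hG : G i = some true := by
        rcases hGC i with h' | h'
        · rw [h] at h'; exact absurd h' (by simp)
        · rw [h', h]
      rw [hr i, bary_t hG, e]; simp

end geom
end CubManif

namespace CubManif
open Finsupp hiding some add_apply
open CubeFace

section chart
open scoped Classical

/-- Local charts as total functions. -/
theorem exists_chart {E : Type} [TopologicalSpace E] {d : ℕ} {M : Set E}
    (h : Nonempty (ChartedSpace (EuclideanSpace ℝ (Fin d)) M)) {x0 : E} (hx0 : x0 ∈ M) {O : Set E}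
    (hO : IsOpen O) (hxO : x0 ∈ O) :
    ∃ (U : Set E) (φ : E → (Fin d → ℝ)) (ψ : (Fin d → ℝ) → E) (r : ℝ), 0 < r ∧ IsOpen U ∧ x0 ∈ U ∧
      φ x0 = 0 ∧ ContinuousOn φ (U ∩ M) ∧ (∀ y ∈ U ∩ M, ‖φ y‖ < r) ∧
      ContinuousOn ψ (Metric.ball 0 r) ∧ (∀ v, ‖v‖ < r → ψ v ∈ U ∩ M) ∧
      (∀ y ∈ U ∩ M, ψ (φ y) = y) ∧ (∀ v, ‖v‖ < r → φ (ψ v) = v) ∧ ∀ y ∈ U ∩ M, y ∈ O := by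
  obtain ⟨cs⟩ := h
  let e0 := chartAt (EuclideanSpace ℝ (Fin d)) (⟨x0, hx0⟩ : M)
  let T : EuclideanSpace ℝ (Fin d) ≃ₜ (Fin d → ℝ) :=
    (EuclideanSpace.equiv (Fin d) ℝ).toHomeomorph.trans
      (Homeomorph.addRight (-(EuclideanSpace.equiv (Fin d) ℝ (e0 ⟨x0, hx0⟩))))
  let e := e0.transHomeomorph T
  have hsrc : (⟨x0, hx0⟩ : M) ∈ e.source := mem_chart_source _ (⟨x0, hx0⟩ : M)
  have he0 : e ⟨x0, hx0⟩ = 0 := by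
    show T (e0 ⟨x0, hx0⟩) = 0
    simp [T]
  have hopen : IsOpen (e.target ∩ e.symm ⁻¹' (Subtype.val ⁻¹' O)) :=
    e.isOpen_inter_preimage_symm (hO.preimage continuous_subtype_val)
  have h0m : (0 : Fin d → ℝ) ∈ e.target ∩ e.symm ⁻¹' (Subtype.val ⁻¹' O) := by
    rw [← he0]
    refine ⟨e.map_source hsrc, ?_⟩
    simp only [Set.mem_preimage, e.left_inv hsrc]
    exact hxO
  obtain ⟨r, hr, hball⟩ := Metric.isOpen_iff.1 hopen _ h0m
  have hb : ∀ v : Fin d → ℝ, ‖v‖ < r → v ∈ e.target ∧ (e.symm v : E) ∈ O := by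
    intro v hv
    have := hball (show v ∈ Metric.ball 0 r by simpa using hv)
    exact this
  have hW : IsOpen (e.source ∩ e ⁻¹' Metric.ball 0 r) := e.isOpen_inter_preimage Metric.isOpen_ball
  obtain ⟨U, hU, hUW⟩ := isOpen_induced_iff.1 hW
  have hUM : ∀ y : M, (y : E) ∈ U ↔ y ∈ e.source ∧ ‖e y‖ < r := by
    intro y
    have : y ∈ Subtype.val ⁻¹' U ↔ y ∈ e.source ∩ e ⁻¹' Metric.ball 0 r := by rw [hUW]
    simpa using this
  let φ : E → (Fin d → ℝ) := fun y => if hy : y ∈ M then e ⟨y, hy⟩ else 0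
  have hφ : ∀ y : M, φ y = e y := by
    rintro ⟨y, hy⟩; simp [φ, hy]
  have hsetc : U ∩ M = Subtype.val '' (e.source ∩ e ⁻¹' Metric.ball 0 r) := by
    rw [← hUW]
    ext y
    simp [and_comm]
  refine ⟨U, φ, fun v => (e.symm v : E), r, hr, hU, ?_, ?_, ?_, ?_, ?_, ?_, ?_, ?_, ?_⟩
  · exact (hUM ⟨x0, hx0⟩).2 ⟨hsrc, by rw [he0]; simpa using hr⟩
  · rw [hφ ⟨x0, hx0⟩, he0]
  · rw [hsetc, Topology.IsInducing.subtypeVal.continuousOn_image_iff]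
    have : φ ∘ Subtype.val = e := by funext y; exact hφ y
    rw [this]
    exact e.continuousOn.mono Set.inter_subset_left
  · rintro y ⟨hy, hyM⟩
    rw [hφ ⟨y, hyM⟩]
    exact ((hUM ⟨y, hyM⟩).1 hy).2
  · apply continuous_subtype_val.comp_continuousOn
    apply e.symm.continuousOn.mono
    intro v hv
    exact (hb v (by simpa using hv)).1
  · intro v hv
    have := (hb v hv).1
    refine ⟨(hUM _).2 ⟨e.map_target this, by rwa [e.right_inv this]⟩, (e.symm v).2⟩
  · rintro y ⟨hy, hyM⟩
    have := ((hUM ⟨y, hyM⟩).1 hy).1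
    show (e.symm (φ y) : E) = y
    rw [hφ ⟨y, hyM⟩, e.left_inv this]
  · intro v hv
    show φ (e.symm v) = v
    rw [hφ, e.right_inv (hb v hv).1]
  · rintro y ⟨hy, hyM⟩
    have h1 := (hUM ⟨y, hyM⟩).1 hy
    have h2 := (hb _ h1.2).2
    rwa [e.left_inv h1.1] at h2

end chart

section maps
open scoped Classical
variable {a d : ℕ}

lemma sc_cont {T : Type} [TopologicalSpace T] {G : CubeFace a} {t : T → ℝ} {y : T → Fin a → ℝ} {X : Set T}
    (ht : ContinuousOn t X) (hy : ContinuousOn y X) : ContinuousOn (fun x => sc G (t x) (y x)) X := by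
  unfold sc
  exact continuousOn_const.add (ht.smul (hy.sub continuousOn_const))

lemma rad_cont {T : Type} [TopologicalSpace T] {G : CubeFace a} {y : T → Fin a → ℝ} {X : Set T}
    (hy : ContinuousOn y X) (h : ∀ x ∈ X, gg G (y x) ≠ 0) : ContinuousOn (fun x => rad G (y x)) X := by
  unfold rad
  exact sc_cont (((gg_cont G).comp_continuousOn hy).inv₀ h) hy

lemma rad_sc {G : CubeFace a} {t : ℝ} (ht : 0 < t) {y : Fin a → ℝ} (hy : gg G y = 1) :
    rad G (sc G t y) = y := by
  unfold rad
  rw [gg_sc G ht.le, sc_sc, hy, mul_one, inv_mul_cancel₀ ht.ne', sc_one]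

lemma sc_rad {G : CubeFace a} {y : Fin a → ℝ} (h : gg G y ≠ 0) : sc G (gg G y) (rad G y) = y := by
  unfold rad
  rw [sc_sc, mul_inv_cancel₀ h, sc_one]

theorem local_maps {M : Set (CubeFace a)} (hM : DC M)
    (h : Nonempty (ChartedSpace (EuclideanSpace ℝ (Fin d)) (real M))) {G : CubeFace a} (hG : G ∈ M) :
    ∃ (f : (Fin a → ℝ) → (Fin d → ℝ)) (g : (Fin d → ℝ) → (Fin a → ℝ))
      (K : ℝ → (Fin a → ℝ) → (Fin a → ℝ)) (H : ℝ → (Fin d → ℝ) → (Fin d → ℝ)),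
      ContinuousOn f (real (Nb M G) \ {bary G}) ∧ (∀ y ∈ real (Nb M G), y ≠ bary G → f y ∈ SS d) ∧
      ContinuousOn g (SS d) ∧ (∀ s ∈ SS d, g s ∈ real (Lk M G)) ∧
      ContinuousOn (fun p : ℝ × (Fin a → ℝ) => K p.1 p.2) (Set.Icc 0 1 ×ˢ real (Lk M G)) ∧
      (∀ t ∈ Set.Icc (0:ℝ) 1, ∀ y ∈ real (Lk M G), K t y ∈ real (Lk M G)) ∧
      (∀ y ∈ real (Lk M G), K 0 y = y ∧ K 1 y = g (f y)) ∧
      ContinuousOn (fun p : ℝ × (Fin d → ℝ) => H p.1 p.2) (Set.Icc 0 1 ×ˢ SS d) ∧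
      (∀ t ∈ Set.Icc (0:ℝ) 1, ∀ y ∈ SS d, H t y ∈ SS d) ∧
      (∀ y ∈ SS d, H 0 y = y ∧ H 1 y = f (g y)) := by
  have hb0 : gg G (bary G) = 0 := gg_eq_zero.2 rfl
  obtain ⟨U, φ, ψ, R, hR, hUo, hxU, hφ0, hφc, hφm, hψc, hψm, hψφ, hφψ, hUO⟩ :=
    exists_chart h (mem_real.2 ⟨G, hG, bary_mem G⟩) (O := {y | gg G y < 1})
      (isOpen_lt (gg_cont G) continuous_const) (by simp [hb0])
  have hxM : bary G ∈ real M := mem_real.2 ⟨G, hG, bary_mem G⟩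
  have hψ0 : ψ 0 = bary G := by rw [← hφ0]; exact hψφ _ ⟨hxU, hxM⟩
  have hφne : ∀ y ∈ U ∩ real M, y ≠ bary G → φ y ≠ 0 := by
    intro y hy hne h0
    apply hne
    rw [← hψφ y hy, h0, hψ0]
  have hψne : ∀ v, ‖v‖ < R → v ≠ 0 → ψ v ≠ bary G := by
    intro v hv hne h0
    apply hne
    rw [← hφψ v hv, h0, hφ0]
  have hNM := real_mono (Nb_sub hM G)
  -- choose t0
  obtain ⟨ρ, hρ, hball⟩ := Metric.isOpen_iff.1 hUo _ hxU
  obtain ⟨t0, ht0, ht1, htU⟩ : ∃ t0 : ℝ, 0 < t0 ∧ t0 ≤ 1 ∧ ∀ y ∈ real (Nb M G), ∀ t, 0 ≤ t → t ≤ t0 →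
      sc G t y ∈ U := by
    refine ⟨min (ρ/2) 1, by positivity, min_le_right _ _, ?_⟩
    intro y hy t h0 h1
    apply hball
    rw [Metric.mem_ball, dist_eq_norm]
    have e : sc G t y - bary G = t • (y - bary G) := by simp [sc]
    rw [e, norm_smul, Real.norm_of_nonneg h0]
    have : ‖y - bary G‖ ≤ 1 := by
      rw [pi_norm_le_iff_of_nonneg zero_le_one]
      intro i
      have h1 := le_gg G y i
      have h2 := gg_real (G := G) hy
      have h3 := wt_pos G i
      rw [Pi.sub_apply, Real.norm_eq_abs]
      nlinarith [abs_nonneg (y i - bary G i)]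
    have h2 : t ≤ ρ/2 := h1.trans (min_le_left _ _)
    nlinarith [norm_nonneg (y - bary G)]
  have hsU : ∀ y ∈ real (Nb M G), ∀ t, 0 ≤ t → t ≤ t0 → sc G t y ∈ U ∩ real M := by
    intro y hy t h0 h1
    exact ⟨htU y hy t h0 h1, hNM (scale_mem hy h0 (h1.trans ht1))⟩
  have hsne : ∀ y : Fin a → ℝ, y ≠ bary G → ∀ t, 0 < t → sc G t y ≠ bary G := by
    intro y hy t h0 he
    rw [← gg_eq_zero, gg_sc G h0.le] at he
    rcases mul_eq_zero.1 he with h | h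
    · exact h0.ne' h
    · exact hy (gg_eq_zero.1 h)
  -- choose r
  obtain ⟨r, hr, hrR, hrt⟩ : ∃ r : ℝ, 0 < r ∧ r < R ∧ ∀ v, ‖v‖ ≤ r → gg G (ψ v) < t0 := by
    have hc : ContinuousAt (fun v => gg G (ψ v)) 0 :=
      ((gg_cont G).comp_continuousOn hψc).continuousAt (Metric.ball_mem_nhds _ hR)
    have hlt : gg G (ψ 0) < t0 := by rw [hψ0, hb0]; exact ht0
    obtain ⟨r, hr, h⟩ := Metric.eventually_nhds_iff.1 (hc.eventually (gt_mem_nhds hlt))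
    refine ⟨min (r/2) (R/2), by positivity, (min_le_right _ _).trans_lt (by linarith), ?_⟩
    intro v hv
    apply h
    rw [dist_zero_right]
    have := hv.trans (min_le_left _ _)
    linarith
  have hLN : real (Lk M G) ⊆ real (Nb M G) := real_mono (fun F hF => hF.1)
  have hLne : ∀ y ∈ real (Lk M G), y ≠ bary G := by
    intro y hy h
    have := Lk_gg hy
    rw [h, hb0] at this
    exact zero_ne_one this
  have hrad : ∀ v : Fin d → ℝ, ‖v‖ < R → v ≠ 0 → gg G (ψ v) ≠ 0 ∧ rad G (ψ v) ∈ real (Lk M G) := by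
    intro v hv hne
    have h1 := hψm v hv
    have h2 : gg G (ψ v) ≠ 0 := fun h => hψne v hv hne (gg_eq_zero.1 h)
    exact ⟨h2, rad_mem h1.2 h2 (hUO _ h1)⟩
  have hsn : ∀ s ∈ SS d, ‖r • s‖ = r := by
    intro s hs
    have hs : ‖s‖ = 1 := hs
    rw [norm_smul, hs, Real.norm_of_nonneg hr.le, mul_one]
  have hs0 : ∀ s ∈ SS d, r • s ≠ 0 := by
    intro s hs h
    have := hsn s hs
    rw [h, norm_zero] at this
    linarith
  set f : (Fin a → ℝ) → (Fin d → ℝ) := fun y => nz (φ (sc G t0 y)) with hf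
  set g : (Fin d → ℝ) → (Fin a → ℝ) := fun s => rad G (ψ (r • s)) with hg
  have hgL : ∀ s ∈ SS d, g s ∈ real (Lk M G) := by
    intro s hs
    exact (hrad _ (by rw [hsn s hs]; exact hrR) (hs0 s hs)).2
  have hcs : ContinuousOn (fun y => φ (sc G t0 y)) (real (Nb M G)) := by
    refine hφc.comp (sc_cont continuousOn_const continuousOn_id) ?_
    intro y hy
    exact hsU y hy t0 ht0.le le_rfl
  have hpne : ∀ y ∈ real (Nb M G), y ≠ bary G → φ (sc G t0 y) ≠ 0 := fun y hy hne =>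
    hφne _ (hsU y hy t0 ht0.le le_rfl) (hsne y hne t0 ht0)
  have hψr : ContinuousOn (fun s => ψ (r • s)) (SS d) := by
    refine hψc.comp (continuous_const_smul r).continuousOn ?_
    intro s hs
    rw [mem_ball_zero_iff, hsn s hs]; exact hrR
  have hgc : ContinuousOn g (SS d) :=
    rad_cont hψr (fun s hs => (hrad _ (by rw [hsn s hs]; exact hrR) (hs0 s hs)).1)
  -- the parameter of K
  have hKarg : ∀ p ∈ Set.Icc (0:ℝ) 1 ×ˢ real (Lk M G),
      ‖((1 - p.1) * ‖φ (sc G t0 p.2)‖ + p.1 * r) • nz (φ (sc G t0 p.2))‖ < R ∧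
      ((1 - p.1) * ‖φ (sc G t0 p.2)‖ + p.1 * r) • nz (φ (sc G t0 p.2)) ≠ 0 := by
    rintro ⟨u, y⟩ ⟨⟨h0, h1⟩, hy⟩
    simp only at h0 h1 hy ⊢
    have h2 := hpne y (hLN hy) (hLne y hy)
    have h3 := hφm _ (hsU y (hLN hy) t0 ht0.le le_rfl)
    have h4 : ‖nz (φ (sc G t0 y))‖ = 1 := nz_mem h2
    have h5 := norm_pos_iff.2 h2
    set A := ‖φ (sc G t0 y)‖
    have h6 : 0 < (1 - u) * A + u * r := by
      rcases eq_or_lt_of_le h0 with h | h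
      · rw [← h]; linarith
      · have := mul_pos h hr
        have := mul_nonneg (sub_nonneg.2 h1) h5.le
        linarith
    have h7 : ‖((1 - u) * A + u * r) • nz (φ (sc G t0 y))‖ = (1 - u) * A + u * r := by
      rw [norm_smul, h4, Real.norm_of_nonneg h6.le, mul_one]
    constructor
    · rw [h7]
      rcases eq_or_lt_of_le h0 with h | h
      · rw [← h]; linarith
      · nlinarith [mul_nonneg (sub_nonneg.2 h1) (sub_nonneg.2 h3.le), mul_pos h (sub_pos.2 hrR)]
    · intro h8
      rw [h8, norm_zero] at h7
      linarith
  have hHarg : ∀ p ∈ Set.Icc (0:ℝ) 1 ×ˢ SS d,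
      sc G ((1 - p.1) * gg G (ψ (r • p.2)) + p.1 * t0) (rad G (ψ (r • p.2))) ∈ U ∩ real M ∧
      sc G ((1 - p.1) * gg G (ψ (r • p.2)) + p.1 * t0) (rad G (ψ (r • p.2))) ≠ bary G := by
    rintro ⟨u, s⟩ ⟨⟨h0, h1⟩, hs⟩
    simp only at h0 h1 hs ⊢
    have h2 := hrad (r • s) (by rw [hsn s hs]; exact hrR) (hs0 s hs)
    have h3 := hrt (r • s) (hsn s hs).le
    have h5 : 0 < gg G (ψ (r • s)) := lt_of_le_of_ne (gg_nonneg _ _) (Ne.symm h2.1)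
    set A := gg G (ψ (r • s))
    have h6 : 0 < (1 - u) * A + u * t0 := by
      rcases eq_or_lt_of_le h0 with h | h
      · rw [← h]; linarith
      · have := mul_pos h ht0
        have := mul_nonneg (sub_nonneg.2 h1) h5.le
        linarith
    have h7 : (1 - u) * A + u * t0 ≤ t0 := by nlinarith
    exact ⟨hsU _ (hLN h2.2) _ h6.le h7, hsne _ (hLne _ h2.2) _ h6⟩
  refine ⟨f, g, fun u y => rad G (ψ (((1 - u) * ‖φ (sc G t0 y)‖ + u * r) • nz (φ (sc G t0 y)))),
    fun u s => nz (φ (sc G ((1 - u) * gg G (ψ (r • s)) + u * t0) (rad G (ψ (r • s))))),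
    ?_, ?_, hgc, hgL, ?_, ?_, ?_, ?_, ?_, ?_⟩
  · exact nz_cont (hcs.mono Set.sdiff_subset) (fun y hy => hpne y hy.1 hy.2)
  · intro y hy hne
    exact nz_mem (hpne y hy hne)
  · apply rad_cont
    · refine hψc.comp ?_ ?_
      · have c1 : ContinuousOn (fun p : ℝ × (Fin a → ℝ) => φ (sc G t0 p.2))
            (Set.Icc 0 1 ×ˢ real (Lk M G)) :=
          hcs.comp continuous_snd.continuousOn (fun p hp => hLN hp.2)
        have c2 : ContinuousOn (fun p : ℝ × (Fin a → ℝ) => nz (φ (sc G t0 p.2)))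
            (Set.Icc 0 1 ×ˢ real (Lk M G)) :=
          nz_cont c1 (fun p hp => hpne p.2 (hLN hp.2) (hLne _ hp.2))
        have c3 : ContinuousOn (fun p : ℝ × (Fin a → ℝ) => p.1) (Set.Icc 0 1 ×ˢ real (Lk M G)) :=
          continuous_fst.continuousOn
        exact (((continuousOn_const.sub c3).mul c1.norm).add (c3.mul continuousOn_const)).smul c2
      · intro p hp
        rw [mem_ball_zero_iff]
        exact (hKarg p hp).1
    · intro p hp
      exact (hrad _ (hKarg p hp).1 (hKarg p hp).2).1
  · intro t ht y hy
    have hp := hKarg (t, y) ⟨ht, hy⟩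
    exact (hrad _ hp.1 hp.2).2
  · intro y hy
    have h2 := hpne y (hLN hy) (hLne y hy)
    constructor
    · simp only [sub_zero, one_mul, zero_mul, add_zero]
      have e : ‖φ (sc G t0 y)‖ • nz (φ (sc G t0 y)) = φ (sc G t0 y) := by
        rw [nz, smul_smul, mul_inv_cancel₀ (norm_ne_zero_iff.2 h2), one_smul]
      rw [e, hψφ _ (hsU y (hLN hy) t0 ht0.le le_rfl), rad_sc ht0 (Lk_gg hy)]
    · simp [hg, hf]
  · apply nz_cont
    · refine hφc.comp ?_ (fun p hp => (hHarg p hp).1)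
      have c1 : ContinuousOn (fun p : ℝ × (Fin d → ℝ) => ψ (r • p.2)) (Set.Icc 0 1 ×ˢ SS d) :=
        hψr.comp continuous_snd.continuousOn (fun p hp => hp.2)
      have c2 : ContinuousOn (fun p : ℝ × (Fin d → ℝ) => rad G (ψ (r • p.2))) (Set.Icc 0 1 ×ˢ SS d) :=
        hgc.comp continuous_snd.continuousOn (fun p hp => hp.2)
      have c3 : ContinuousOn (fun p : ℝ × (Fin d → ℝ) => p.1) (Set.Icc 0 1 ×ˢ SS d) :=
        continuous_fst.continuousOn
      exact sc_cont (((continuousOn_const.sub c3).mul ((gg_cont G).comp_continuousOn c1)).add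
        (c3.mul continuousOn_const)) c2
    · intro p hp
      exact hφne _ (hHarg p hp).1 (hHarg p hp).2
  · intro t ht s hs
    have hp := hHarg (t, s) ⟨ht, hs⟩
    exact nz_mem (hφne _ hp.1 hp.2)
  · intro s hs
    have h2 := hrad (r • s) (by rw [hsn s hs]; exact hrR) (hs0 s hs)
    constructor
    · simp only [sub_zero, one_mul, zero_mul, add_zero]
      rw [sc_rad h2.1, hφψ _ (by rw [hsn s hs]; exact hrR)]
      rw [nz, hsn s hs, smul_smul, inv_mul_cancel₀ hr.ne', one_smul]
    · simp [hg, hf]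

end maps
end CubManif

namespace CubManif
open Finsupp hiding some add_apply
open CubeFace

section linkhom
open scoped Classical
variable {a d : ℕ}

lemma mp_gr {X Y : Type} (f : X → Y) {k : ℕ} {z : Ch (List X)} (hz : z ∈ spt ((listBC X).gr k)) :
    mp f z ∈ spt ((listBC Y).gr k) := by
  refine mp_spt ?_ hz
  intro l hl
  simpa [BC.gr, listBC] using hl

theorem lk_list {M : Set (CubeFace a)} (hM : DC M)
    (h : Nonempty (ChartedSpace (EuclideanSpace ℝ (Fin d)) (real M))) {G : CubeFace a} (hG : G ∈ M) :
    ∃ ε > 0, (∀ k < d, ∀ z ∈ spt (V ε (real (Lk M G))), z ∈ spt ((listBC _).gr k) → dL z = 0 →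
        z ∈ Bd (V (1/2) (real (Lk M G)))) ∧
      (∀ z ∈ spt (V ε (real (Lk M G))), z ∈ spt ((listBC _).gr d) → dL z = 0 →
       ∀ w ∈ spt (V ε (real (Lk M G))), w ∈ spt ((listBC _).gr d) → dL w = 0 →
        z ∈ Bd (V (1/2) (real (Lk M G))) ∨ w ∈ Bd (V (1/2) (real (Lk M G))) ∨
        z + w ∈ Bd (V (1/2) (real (Lk M G)))) := by
  obtain ⟨f, g, K, H, hf, hfm, hg, hgm, hK, hKm, hK0, -⟩ := local_maps hM h hG
  have hLc : IsCompact (real (Lk M G)) := real_compact _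
  have hsub : real (Lk M G) ⊆ real (Nb M G) \ {bary G} := by
    intro y hy
    refine ⟨real_mono (fun F hF => hF.1) hy, ?_⟩
    intro h0
    have h1 := Lk_gg hy
    rw [gg_eq_zero.2 h0] at h1
    norm_num at h1
  obtain ⟨η, hη, hg'⟩ := cont_V (sph_compact) g hg hgm (η := 1/2) (by norm_num)
  obtain ⟨ε1, hε1, hs1, hs2⟩ := sphere_claim d η hη
  obtain ⟨ε2, hε2, hf'⟩ := cont_V (Y := SS d) hLc f (hf.mono hsub)
    (fun y hy => hfm y (hsub hy).1 (hsub hy).2) hε1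
  obtain ⟨ε3, hε3, hK'⟩ := homotopy_Bd hLc K hK hKm (η := 1/2) (by norm_num)
  have key : ∀ z ∈ spt (V (min ε2 ε3) (real (Lk M G))), dL z = 0 → mp f z ∈ spt (V ε1 (SS d)) ∧
      dL (mp f z) = 0 ∧ (mp f z ∈ Bd (V η (SS d)) → z ∈ Bd (V (1/2) (real (Lk M G)))) := by
    intro z hz hd
    have hz2 := spt_mono (V_mono (min_le_left ε2 ε3) le_rfl) hz
    have hz3 := spt_mono (V_mono (min_le_right ε2 ε3) le_rfl) hz
    refine ⟨mp_spt hf' hz2, by rw [dL_mp, hd, map_zero], ?_⟩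
    intro hb
    have h1 := mp_Bd hg' hb
    have h2 := hK' z hz3 hd
    have e0 : mp (K 0) z = z := by
      conv_rhs => rw [← mp_id z]
      exact mp_congr (fun l hl x hx => (hK0 x (hl.1 x hx)).1) hz
    have e1 : mp (K 1) z = mp g (mp f z) := by
      rw [mp_mp]
      exact mp_congr (fun l hl x hx => (hK0 x (hl.1 x hx)).2) hz
    rw [e0, e1] at h2
    have h3 := Submodule.add_mem _ h2 h1
    rwa [add_assoc, add2, add_zero] at h3
  refine ⟨min ε2 ε3, lt_min hε2 hε3, ?_, ?_⟩
  · intro k hk z hz hzk hd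
    obtain ⟨h1, h2, h3⟩ := key z hz hd
    exact h3 (hs1 k hk _ h1 (mp_gr f hzk) h2)
  · intro z hz hzk hd w hw hwk hwd
    obtain ⟨h1, h2, h3⟩ := key z hz hd
    obtain ⟨h1', h2', h3'⟩ := key w hw hwd
    obtain ⟨-, -, h3''⟩ := key (z + w) (Submodule.add_mem _ hz hw) (by rw [map_add, hd, hwd, add_zero])
    rw [map_add] at h3''
    rcases hs2 _ h1 (mp_gr f hzk) h2 _ h1' (mp_gr f hwk) h2' with h | h | h
    · exact Or.inl (h3 h)
    · exact Or.inr (Or.inl (h3' h))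
    · exact Or.inr (Or.inr (h3'' h))

theorem lk_cells {M : Set (CubeFace a)} (hM : DC M)
    (h : Nonempty (ChartedSpace (EuclideanSpace ℝ (Fin d)) (real M))) {G : CubeFace a} (hG : G ∈ M) :
    (∀ k < d, ∀ z ∈ spt (ac (Lk M G)), z ∈ spt ((cellBC a).gr k) → bd z = 0 →
        ∃ w ∈ spt (ac (Lk M G)), bd w = z) ∧
      (∀ z ∈ spt (ac (Lk M G)), z ∈ spt ((cellBC a).gr d) → bd z = 0 →
       ∀ w ∈ spt (ac (Lk M G)), w ∈ spt ((cellBC a).gr d) → bd w = 0 →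
        (∃ u ∈ spt (ac (Lk M G)), bd u = z) ∨ (∃ u ∈ spt (ac (Lk M G)), bd u = w) ∨
        ∃ u ∈ spt (ac (Lk M G)), bd u = z + w) := by
  obtain ⟨ε, hε, h1, h2⟩ := lk_list hM h hG
  obtain ⟨ρ, hρ, hρs, hs⟩ := compare a
  obtain ⟨s, hsd, hss, hsg, hsh⟩ := hs (min ε (1/2)) (lt_min hε (by norm_num)) (min_le_right _ _)
  have hL := Lk_DC M G
  have sV : ∀ z ∈ spt (ac (Lk M G)), s z ∈ spt (V ε (real (Lk M G))) := fun z hz =>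
    spt_mono (V_mono (min_le_left _ _) le_rfl) (hss _ hL z hz)
  have back : ∀ z ∈ spt (ac (Lk M G)), bd z = 0 → s z ∈ Bd (V (1/2) (real (Lk M G))) →
      ∃ w ∈ spt (ac (Lk M G)), bd w = z := by
    intro z hz hd hb
    obtain ⟨w, hw, hwz⟩ := mem_Bd.1 hb
    obtain ⟨u, hu, huz⟩ := hsh _ hL z hz hd
    refine ⟨ρ w + u, Submodule.add_mem _ (hρs _ hL w hw) hu, ?_⟩
    rw [map_add, hρ, hwz, huz, ← add_assoc, add2, zero_add]
  have sd : ∀ z, bd z = 0 → dL (s z) = 0 := fun z hz => by rw [hsd, hz, map_zero]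
  refine ⟨?_, ?_⟩
  · intro k hk z hz hzk hd
    exact back z hz hd (h1 k hk _ (sV z hz) (hsg k z hzk) (sd z hd))
  · intro z hz hzk hd w hw hwk hwd
    rcases h2 _ (sV z hz) (hsg d z hzk) (sd z hd) _ (sV w hw) (hsg d w hwk) (sd w hwd) with h | h | h
    · exact Or.inl (back z hz hd h)
    · exact Or.inr (Or.inl (back w hw hwd h))
    · refine Or.inr (Or.inr (back _ (Submodule.add_mem _ hz hw) ?_ ?_))
      · rw [map_add, hd, hwd, add_zero]
      · rwa [map_add]

lemma Nb_acyclic {M : Set (CubeFace a)} {G : CubeFace a} (hG : G ∈ M) {z : Ch (Cell a)}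
    (hz : z ∈ spt (ac (Nb M G))) (hd : bd z = 0) : ∃ w ∈ spt (ac (Nb M G)), bd w = z := by
  have hv := vx_le G
  refine acyclic (vx G) ?_ ?_ ?_ hz hd
  · exact ⟨G, hG, le_rfl, hv⟩
  · rintro F ⟨C, hC, hGC, hFC⟩ i hi
    refine ⟨C, hC, hGC, ?_⟩
    intro j
    rcases hFC j with h | h
    · exact Or.inl h
    · by_cases hj : j = i
      · subst hj
        rcases hGC j with h' | h'
        · exact Or.inl h'
        · rcases hv j with h'' | h''
          · exact Or.inl (h'.symm.trans h'')
          · right; rw [upd_same, ← h', ← h'']; rfl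
      · rw [upd_ne _ _ hj]; exact Or.inr h
  · rintro F ⟨C, hC, hGC, hFC⟩ i hi
    refine ⟨C, hC, hGC, ?_⟩
    intro j
    rcases hFC j with h | h
    · exact Or.inl h
    · by_cases hj : j = i
      · subst hj
        rcases hGC j with h' | h'
        · exact Or.inl h'
        · rcases hv j with h'' | h''
          · exact Or.inl (h'.symm.trans h'')
          · exfalso
            rw [h, ← h', ← h''] at hi
            simp [toFace] at hi
      · rw [upd_ne _ _ hj]; exact Or.inr h

end linkhom
end CubManif

namespace CubManif
open Finsupp hiding some add_apply
open CubeFace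

section nontriv
open scoped Classical
variable {a d : ℕ}

lemma sph_coord {d : ℕ} {x : Fin d → ℝ} (hx : x ∈ SS d) :
    (∀ i, |x i| ≤ 1) ∧ ∃ i, |x i| = 1 := by
  have hx : ‖x‖ = 1 := hx
  refine ⟨fun i => hx ▸ norm_le_pi_norm x i, ?_⟩
  by_contra hn
  push Not at hn
  have : ‖x‖ < 1 := by
    rw [pi_norm_lt_iff zero_lt_one]
    intro i
    exact lt_of_le_of_ne (hx ▸ norm_le_pi_norm x i) (hn i)
  linarith

lemma sph_of_coord {d : ℕ} {x : Fin d → ℝ} (h1 : ∀ i, |x i| ≤ 1) {i : Fin d} (hi : |x i| = 1) :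
    x ∈ SS d := by
  show ‖x‖ = 1
  apply le_antisymm
  · rw [pi_norm_le_iff_of_nonneg zero_le_one]; exact h1
  · rw [← hi]; exact norm_le_pi_norm x i

lemma bdry_DC (d : ℕ) : DC (boundaryCube d) := by
  intro F hF G hG h
  apply hF
  funext i
  rcases hG i with h' | h'
  · exact h'
  · rw [← h', h]

/-- The top cell. -/
def tp (d : ℕ) : CubeFace d := fun _ => none

lemma tp_apply (d : ℕ) (i : Fin d) : tp d i = none := rfl

lemma mem_bdry {d : ℕ} {F : CubeFace d} : F ∈ boundaryCube d ↔ F ≠ tp d := Iff.rfl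

theorem sphere_nontrivial {d : ℕ} (hd : 1 ≤ d) :
    ¬ ∃ ε > 0, ∀ z ∈ spt (V ε (SS d)), dL z = 0 → z ∈ Bd (V 1 (SS d)) := by
  rintro ⟨ε, hε, hb⟩
  set L : Set (CubeFace d) := boundaryCube d with hL
  have hLD : DC L := bdry_DC d
  let T : (Fin d → ℝ) → (Fin d → ℝ) := fun x i => (x i + 1) / 2
  let T' : (Fin d → ℝ) → (Fin d → ℝ) := fun x i => 2 * x i - 1
  have hTT : T ∘ T' = id := by funext x; funext i; simp [T, T']
  have hTm : ∀ x ∈ SS d, T x ∈ real L := by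
    intro x hx
    obtain ⟨h1, i, hi⟩ := sph_coord hx
    have hb : ∀ j, 0 ≤ T x j ∧ T x j ≤ 1 := by
      intro j
      have := abs_le.1 (h1 j)
      simp only [T]
      constructor <;> linarith
    rcases eq_or_eq_neg_of_abs_eq hi with h | h
    · refine mem_real.2 ⟨upd (tp d) i (some true), ?_, hb, ?_⟩
      · intro hc
        have := congrFun (hc : _ = tp d) i
        rw [upd_same] at this; cases this
      · intro j
        by_cases hj : j = i
        · subst hj; simp [T, h]
        · rw [upd_ne _ _ hj, tp_apply]; simp
    · refine mem_real.2 ⟨upd (tp d) i (some false), ?_, hb, ?_⟩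
      · intro hc
        have := congrFun (hc : _ = tp d) i
        rw [upd_same] at this; cases this
      · intro j
        by_cases hj : j = i
        · subst hj; simp [T, h]
        · rw [upd_ne _ _ hj, tp_apply]; simp
  have hT'm : ∀ y ∈ real L, T' y ∈ SS d := by
    intro y hy
    obtain ⟨F, hF, hyF⟩ := mem_real.1 hy
    have : ∃ i, F i ≠ none := by
      by_contra hn
      push Not at hn
      exact hF (funext hn)
    obtain ⟨i, hi⟩ := this
    refine sph_of_coord (i := i) ?_ ?_
    · intro j
      have := hyF.1 j
      simp only [T']
      rw [abs_le]; constructor <;> linarith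
    · obtain ⟨b, hb⟩ := Option.ne_none_iff_exists'.1 hi
      cases b with
      | false => simp [T', (hyF.2 i).1 hb]
      | true =>
        simp only [T', (hyF.2 i).2 hb]
        norm_num
  have hTd : ∀ x y, dist x y < 1 → dist (T x) (T y) < 1/2 := by
    intro x y h
    rw [dist_pi_lt_iff (by norm_num)] at h ⊢
    intro i
    have := h i
    rw [Real.dist_eq] at this ⊢
    have e : T x i - T y i = (x i - y i) * (1/2) := by simp only [T]; ring
    rw [e, abs_mul]
    norm_num
    linarith
  have hT'd : ∀ x y, dist x y < ε/2 → dist (T' x) (T' y) < ε := by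
    intro x y h
    rw [dist_pi_lt_iff (by linarith)] at h ⊢
    intro i
    have := h i
    rw [Real.dist_eq] at this ⊢
    have e : T' x i - T' y i = (x i - y i) * 2 := by simp only [T']; ring
    rw [e, abs_mul]
    norm_num
    linarith
  obtain ⟨ρ, hρ, hρs, hs⟩ := compare d
  obtain ⟨s, hsd, hss, hsg, hsh⟩ := hs (min (ε/2) (1/2)) (lt_min (by linarith) (by norm_num))
    (min_le_right _ _)
  obtain ⟨top, htop⟩ : ∃ t, t = tp d := ⟨_, rfl⟩
  have hdt : dim top = d := by
    rw [dim_eq]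
    have : fr top = Finset.univ := by ext i; simp [mem_fr, htop, tp_apply]
    rw [this]; simp
  set z : Ch (Cell d) := bd (sg top) with hz
  have hzg : z ∈ spt ((cellBC d).gr d) := by
    apply (cellBC d).d_mem_gr d
    apply single_spt
    show dim top + 1 = d + 1
    rw [hdt]
  have hzL : z ∈ spt (ac L) := by
    refine spt_mono ?_ (bd_single_spt (some top))
    intro C' hC'
    cases C' with
    | none => simp
    | some F =>
      rw [some_ac]
      intro h
      have h : F = tp d := h
      rw [← htop] at h
      subst h
      have := hC'.2
      omega
  have hzd : bd z = 0 := bd_bd _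
  have h1 : s z ∈ spt (V (ε/2) (real L)) :=
    spt_mono (V_mono (min_le_left _ _) le_rfl) (hss _ hLD z hzL)
  have h2 : mp T' (s z) ∈ Bd (V 1 (SS d)) := by
    apply hb
    · exact mp_spt (V_map hT'm (fun x _ y _ => hT'd x y)) h1
    · rw [dL_mp, hsd, hzd, map_zero, map_zero]
  have h3 : mp T (mp T' (s z)) ∈ Bd (V (1/2) (real L)) :=
    mp_Bd (V_map hTm (fun x _ y _ => hTd x y)) h2
  rw [mp_mp, hTT, mp_id] at h3
  obtain ⟨w, hw, hwz⟩ := mem_Bd.1 h3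
  obtain ⟨u, hu, huz⟩ := hsh _ hLD z hzL hzd
  have hfill : bd (ρ w + u) = z := by
    rw [map_add, hρ, hwz, huz, ← add_assoc, add2, zero_add]
  obtain ⟨w', hw', hwz'⟩ := (cellBC d).hom_fill hzg (Submodule.add_mem _ (hρs _ hLD w hw) hu) hfill
  have : w' = 0 := by
    ext C
    by_contra hC
    have := (mem_spt.1 hw') C hC
    cases C with
    | none => exact absurd this.2 (by simp [BC.gr, cellBC])
    | some F =>
      have hF : dim F + 1 = d + 1 := this.2
      have hFt : F ≤ top := fun i => Or.inl (by rw [htop]; rfl)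
      have hFL : F ∈ L := some_ac.1 this.1
      exact hFL ((eq_of_le_dim hFt (by omega)).trans htop)
  rw [this, map_zero] at hwz'
  have hne := (bd_coeff (some top) (some (upd top ⟨0, hd⟩ (some false)))).2
    ⟨upd_le (by rw [htop]; rfl) _, dim_upd_some (by rw [htop]; rfl) false⟩
  apply hne
  change z _ = 0
  rw [← hwz']; rfl

theorem not_boundary {M : Set (CubeFace a)} (hM : DC M) (hd : 1 ≤ d)
    (h : Nonempty (ChartedSpace (EuclideanSpace ℝ (Fin d)) (real M))) {G C : CubeFace a} (hG : G ∈ M)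
    (hC : C ∈ M) (hGC : G ≤ C) (hdim : dim G + 1 = dim C) (honly : ∀ F ∈ M, G ≤ F → F ≤ C) : False := by
  obtain ⟨f, g, K, H, hf, hfm, hg, hgm, -, -, -, hH, hHm, hH0⟩ := local_maps hM h hG
  obtain ⟨i, b, hi, rfl⟩ := facet_upd hGC hdim
  set G := upd C i (some b) with hGdef
  have hNb : real (Nb M G) = rf C := by
    ext y
    rw [mem_real]
    constructor
    · rintro ⟨F, ⟨D, hD, h1, h2⟩, hy⟩
      exact rf_mono (h2.trans (honly D hD h1)) hy
    · intro hy
      exact ⟨C, ⟨C, hC, hGC, le_rfl⟩, hy⟩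
  set e := bary (upd C i (some (!b))) with he
  have heC : e ∈ rf C := rf_mono (upd_le hi _) (bary_mem _)
  have hconv : ∀ t ∈ Set.Icc (0:ℝ) 1, ∀ y ∈ rf C, (1 - t) • y + t • e ∈ rf C := by
    intro t ht y hy
    exact rf_convex C hy heC (by linarith [ht.2]) ht.1 (by ring)
  have hne : ∀ t ∈ Set.Icc (0:ℝ) 1, ∀ y ∈ real (Lk M G), (1 - t) • y + t • e ≠ bary G := by
    intro t ht y hy heq
    have hyN : y ∈ rf C := hNb ▸ real_mono (fun F hF => hF.1) hy
    have hyi := hyN.1 i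
    have h1 := congrFun heq i
    have ht0 : t = 0 := by
      obtain ⟨ht0, ht1⟩ := ht
      simp only [Pi.add_apply, Pi.smul_apply, smul_eq_mul] at h1
      cases b with
      | false =>
        rw [bary_f (G := G) (by rw [hGdef, upd_same]), he, bary_t (by rw [upd_same]; rfl)] at h1
        nlinarith [mul_nonneg (sub_nonneg.2 ht1) hyi.1]
      | true =>
        rw [bary_t (G := G) (by rw [hGdef, upd_same]), he, bary_f (by rw [upd_same]; rfl)] at h1
        nlinarith [mul_nonneg (sub_nonneg.2 ht1) (sub_nonneg.2 hyi.2)]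
    rw [ht0] at heq
    simp at heq
    have := Lk_gg hy
    rw [gg_eq_zero.2 heq] at this
    norm_num at this
  have hcont : ContinuousOn (fun p : ℝ × (Fin d → ℝ) => f ((1 - p.1) • g p.2 + p.1 • e))
      (Set.Icc 0 1 ×ˢ SS d) := by
    refine hf.comp (t := real (Nb M G) \ {bary G}) ?_ ?_
    · have : ContinuousOn (fun p : ℝ × (Fin d → ℝ) => g p.2) (Set.Icc 0 1 ×ˢ SS d) :=
        hg.comp continuousOn_snd (fun p hp => hp.2)
      exact ((continuousOn_const.sub continuousOn_fst).smul this).add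
        (continuousOn_fst.smul continuousOn_const)
    · rintro ⟨t, x⟩ ⟨ht, hx⟩
      have hgx := hgm x hx
      refine ⟨?_, hne t ht _ hgx⟩
      rw [hNb]
      exact hconv t ht _ (hNb ▸ real_mono (fun F hF => hF.1) hgx)
  have hmem : ∀ t ∈ Set.Icc (0:ℝ) 1, ∀ x ∈ SS d, f ((1 - t) • g x + t • e) ∈ SS d := by
    intro t ht x hx
    have hgx := hgm x hx
    refine hfm _ ?_ (hne t ht _ hgx)
    rw [hNb]
    exact hconv t ht _ (hNb ▸ real_mono (fun F hF => hF.1) hgx)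
  obtain ⟨ε1, hε1, h1⟩ := homotopy_Bd sph_compact (fun t x => f ((1 - t) • g x + t • e)) hcont hmem
    one_pos
  obtain ⟨ε2, hε2, h2⟩ := homotopy_Bd sph_compact H hH hHm one_pos
  refine sphere_nontrivial hd ⟨min ε1 ε2, lt_min hε1 hε2, ?_⟩
  intro z hz hzd
  have hz1 := h1 z (spt_mono (V_mono (min_le_left _ _) le_rfl) hz) hzd
  have hz2 := h2 z (spt_mono (V_mono (min_le_right _ _) le_rfl) hz) hzd
  by_cases hz0 : z = 0
  · rw [hz0]; exact Submodule.zero_mem _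
  have hfe : f e ∈ SS d := by
    refine hfm e (hNb ▸ heC) ?_
    intro h
    have := congrFun h i
    cases b with
    | false =>
      rw [bary_f (G := G) (by rw [hGdef, upd_same]), he, bary_t (by rw [upd_same]; rfl)] at this
      norm_num at this
    | true =>
      rw [bary_t (G := G) (by rw [hGdef, upd_same]), he, bary_f (by rw [upd_same]; rfl)] at this
      norm_num at this
  have hz3 := const_Bd (E := Fin d → ℝ) one_pos hfe hzd
  have e0 : mp (H 0) z = z := by
    conv_rhs => rw [← mp_id z]
    exact mp_congr (fun l hl x hx => (hH0 x (hl.1 x hx)).1) hz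
  have e1 : mp (H 1) z = mp (fun x => f (g x)) z :=
    mp_congr (fun l hl x hx => (hH0 x (hl.1 x hx)).2) hz
  simp only [sub_zero, one_smul, zero_smul, add_zero, sub_self, zero_add] at hz1
  rw [e0, e1] at hz2
  have := Submodule.add_mem _ (Submodule.add_mem _ hz2 hz1) hz3
  have e2 : ∀ A B C : Ch (List (Fin d → ℝ)), A + B + (B + C) + C = A := by
    intro A B C
    have : A + B + (B + C) + C = A + (B + B) + (C + C) := by abel
    rw [this, add2, add2, add_zero, add_zero]
  rwa [e2] at this

end nontriv
end CubManif

namespace CubManif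
open Finsupp hiding some add_apply
open CubeFace

section combman
open scoped Classical
variable {a d : ℕ}

/-- cells of a set of faces -/
def cs (U : Set (CubeFace a)) : Set (Cell a) := {C | ∃ F ∈ U, C = some F}

@[simp] lemma some_cs {U : Set (CubeFace a)} {F : CubeFace a} : some F ∈ cs U ↔ F ∈ U := by
  simp [cs]

@[simp] lemma none_cs {U : Set (CubeFace a)} : (none : Cell a) ∉ cs U := by
  simp [cs]

lemma cs_mono {U W : Set (CubeFace a)} (h : U ⊆ W) : cs U ⊆ cs W := by
  rintro C ⟨F, hF, rfl⟩; exact ⟨F, h hF, rfl⟩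

lemma cs_inter (U W : Set (CubeFace a)) : cs U ∩ cs W = cs (U ∩ W) := by
  ext C; cases C <;> simp

lemma cs_ac {U M : Set (CubeFace a)} (h : U ⊆ M) : cs U ⊆ ac M := by
  rintro C ⟨F, hF, rfl⟩; exact some_ac.2 (h hF)

/-- open subsets -/
def Op (M U : Set (CubeFace a)) : Prop := U ⊆ M ∧ ∀ F ∈ U, ∀ G ∈ M, F ≤ G → G ∈ U

lemma IsFacet_le {F : CubeFace a} {C : Cell a} (h : IsFacet (some F) C) : ∃ G, C = some G ∧ F ≤ G := by
  cases C with
  | none => exact h.elim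
  | some G => exact ⟨G, rfl, h.1⟩

/-- naturality of the restriction to open sets -/
lemma R_bd {M U : Set (CubeFace a)} (hU : Op M U) {x : Ch (Cell a)} (hx : x ∈ spt (ac M)) :
    R (cs U) (bd (R (cs U) x)) = R (cs U) (bd x) := by
  have h0 : R (cs U) (bd (R (cs U)ᶜ x)) = 0 := by
    have h1 := R_spt (cs U)ᶜ _ hx
    have := map_spt (R (cs U) ∘ₗ bd) ⊥ (S := (cs U)ᶜ ∩ ac M) ?_ h1
    · simpa using this
    · rintro C ⟨hC, hCM⟩
      rw [Submodule.mem_bot, LinearMap.comp_apply]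
      ext b
      by_contra hb
      have hbU := mem_spt.1 (R_mem _ _) b hb
      rw [R_pos _ hbU] at hb
      have hf := (bd_coeff _ _).1 hb
      obtain ⟨F, hF, rfl⟩ := hbU
      obtain ⟨G, rfl, hFG⟩ := IsFacet_le hf
      exact hC (some_cs.2 (hU.2 F hF G (some_ac.1 hCM) hFG))
  conv_rhs => rw [← R_compl (cs U) x, map_add, map_add, h0, add_zero]

lemma R_R_sub {B : Type} {S T : Set B} (h : S ⊆ T) (z : Ch B) : R S (R T z) = R S z := by
  rw [R_R, Set.inter_eq_left.2 h]

instance : Finite (Cell a) := by unfold Cell; infer_instance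

/-- The fundamental chain. -/
noncomputable def Om (M : Set (CubeFace a)) (d : ℕ) : Ch (Cell a) :=
  Finsupp.equivFunOnFinite.symm (fun C => if C ∈ cs M ∧ cdeg C = d + 1 then 1 else 0)

lemma Om_apply (M : Set (CubeFace a)) (d : ℕ) (C : Cell a) :
    Om M d C = if C ∈ cs M ∧ cdeg C = d + 1 then 1 else 0 := by
  simp [Om]

lemma Om_some {M : Set (CubeFace a)} {d : ℕ} {F : CubeFace a} (hF : F ∈ M) (h : dim F = d) :
    Om M d (some F) = 1 := by
  rw [Om_apply, if_pos]
  exact ⟨some_cs.2 hF, by simp [cdeg, h]⟩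

lemma Om_spt (M : Set (CubeFace a)) (d : ℕ) : Om M d ∈ spt (cs M ∩ (cellBC a).gr (d+1)) := by
  rw [mem_spt]
  intro b hb
  rw [Om_apply] at hb
  by_contra hn
  exact hb (if_neg hn)

lemma Om_ac (M : Set (CubeFace a)) (d : ℕ) : Om M d ∈ spt (ac M) :=
  spt_mono (fun _ h => cs_ac le_rfl h.1) (Om_spt M d)

/-- Combination of a relative boundary and the fundamental class. -/
def Wk (M : Set (CubeFace a)) (d : ℕ) (U : Set (CubeFace a)) (z : Ch (Cell a)) : Prop :=
  ∃ u ∈ spt (cs U), ∃ c : ZMod 2, z = R (cs U) (bd u) + c • R (cs U) (Om M d)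

/-- open star -/
def st (M : Set (CubeFace a)) (G : CubeFace a) : Set (CubeFace a) := {F | F ∈ M ∧ G ≤ F}

lemma st_op (M : Set (CubeFace a)) (G : CubeFace a) : Op M (st M G) :=
  ⟨fun _ h => h.1, fun _ hF _ hG h => ⟨hG, hF.2.trans h⟩⟩

/-- combinatorial homology manifolds -/
structure CM (M : Set (CubeFace a)) (d : ℕ) : Prop where
  dc : DC M
  hdim : ∀ F ∈ M, dim F ≤ d
  pure : ∀ G ∈ M, ∃ C ∈ M, G ≤ C ∧ dim C = d
  cyc : R (cs M) (bd (Om M d)) = 0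
  loc : ∀ G ∈ M, ∀ z ∈ spt (cs (st M G)), R (cs (st M G)) (bd z) = 0 → Wk M d (st M G) z

lemma Wk_add {M U : Set (CubeFace a)} {z w : Ch (Cell a)} (hz : Wk M d U z) (hw : Wk M d U w) :
    Wk M d U (z + w) := by
  obtain ⟨u, hu, c, rfl⟩ := hz
  obtain ⟨u', hu', c', rfl⟩ := hw
  refine ⟨u + u', Submodule.add_mem _ hu hu', c + c', ?_⟩
  rw [map_add, map_add, add_smul]
  abel

lemma Wk_zero {M U : Set (CubeFace a)} : Wk M d U 0 :=
  ⟨0, Submodule.zero_mem _, 0, by simp⟩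

lemma Wk_sum {M U : Set (CubeFace a)} (s : Finset ℕ) (z : ℕ → Ch (Cell a)) (h : ∀ k ∈ s, Wk M d U (z k)) :
    Wk M d U (∑ k ∈ s, z k) := by
  induction s using Finset.induction_on with
  | empty => simpa using Wk_zero
  | insert k s hk ih =>
    rw [Finset.sum_insert hk]
    exact Wk_add (h k (Finset.mem_insert_self _ _)) (ih (fun j hj => h j (Finset.mem_insert_of_mem hj)))

/-- decomposition of chains in the star -/
lemma ac_Nb (M : Set (CubeFace a)) (G : CubeFace a) (hM : DC M) : ac (Nb M G) ⊆ cs (st M G) ∪ ac (Lk M G) := by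
  intro C hC
  cases C with
  | none => right; simp
  | some F =>
    have hF := some_ac.1 hC
    by_cases h : G ≤ F
    · left; exact some_cs.2 ⟨Nb_sub hM G hF, h⟩
    · right; exact some_ac.2 ⟨hF, h⟩

lemma st_Nb (M : Set (CubeFace a)) (G : CubeFace a) : cs (st M G) ⊆ ac (Nb M G) := by
  rintro C ⟨F, hF, rfl⟩
  exact some_ac.2 ⟨F, hF.1, hF.2, le_rfl⟩

lemma R_st_Lk {M : Set (CubeFace a)} {G : CubeFace a} {w : Ch (Cell a)} (hw : w ∈ spt (ac (Lk M G))) :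
    R (cs (st M G)) w = 0 := by
  ext b
  by_contra hb
  have hbU := mem_spt.1 (R_mem _ _) b hb
  rw [R_pos _ hbU] at hb
  obtain ⟨F, hF, rfl⟩ := hbU
  exact (some_ac.1 (mem_spt.1 hw _ hb)).2 hF.2

lemma bd_rel_Lk {M : Set (CubeFace a)} (hM : DC M) {G : CubeFace a} {z : Ch (Cell a)}
    (hz : z ∈ spt (cs (st M G))) (hd : R (cs (st M G)) (bd z) = 0) : bd z ∈ spt (ac (Lk M G)) := by
  have h1 := bd_ac (Nb_DC M G) (spt_mono (st_Nb M G) hz)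
  rw [mem_spt] at h1 ⊢
  intro b hb
  rcases ac_Nb M G hM (h1 b hb) with h | h
  · rw [← R_pos _ h, hd] at hb; exact absurd rfl hb
  · exact h

/-- T-i -/
lemma rel_low {M : Set (CubeFace a)} (hM : DC M)
    (h : Nonempty (ChartedSpace (EuclideanSpace ℝ (Fin d)) (real M))) {G : CubeFace a} (hG : G ∈ M)
    {k : ℕ} (hk : k < d + 1) {z : Ch (Cell a)} (hz : z ∈ spt (cs (st M G)))
    (hzk : z ∈ spt ((cellBC a).gr k)) (hd : R (cs (st M G)) (bd z) = 0) :
    ∃ u ∈ spt (cs (st M G)), R (cs (st M G)) (bd u) = z := by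
  cases k with
  | zero =>
    refine ⟨0, Submodule.zero_mem _, ?_⟩
    have : z = 0 := by
      ext b
      by_contra hb
      obtain ⟨F, hF, rfl⟩ := mem_spt.1 hz b hb
      have := mem_spt.1 hzk _ hb
      simp [BC.gr, cellBC, cdeg] at this
    rw [this]; simp
  | succ k =>
    obtain ⟨w, hw, hwz⟩ := (lk_cells hM h hG).1 k (by omega) (bd z) (bd_rel_Lk hM hz hd)
      ((cellBC a).d_mem_gr k hzk) (bd_bd z)
    obtain ⟨u, hu, huz⟩ := Nb_acyclic hG (z := z + w)
      (Submodule.add_mem _ (spt_mono (st_Nb M G) hz) (spt_mono (ac_mono (fun _ h => h.1)) hw))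
      (by rw [map_add, hwz, add2])
    refine ⟨R (cs (st M G)) u, R_mem _ _, ?_⟩
    rw [R_bd (st_op M G) (spt_mono (ac_mono (Nb_sub hM G)) hu), huz, map_add, R_st_Lk hw, R_eq.2 hz,
      add_zero]

/-- T-ii -/
lemma rel_top {M : Set (CubeFace a)} (hM : DC M) (hMd : ∀ F ∈ M, dim F ≤ d)
    (h : Nonempty (ChartedSpace (EuclideanSpace ℝ (Fin d)) (real M))) {G : CubeFace a} (hG : G ∈ M)
    {z : Ch (Cell a)} (hz : z ∈ spt (cs (st M G)))
    (hzk : z ∈ spt ((cellBC a).gr (d+1))) (hd : R (cs (st M G)) (bd z) = 0)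
    {w : Ch (Cell a)} (hw : w ∈ spt (cs (st M G)))
    (hwk : w ∈ spt ((cellBC a).gr (d+1))) (hwd : R (cs (st M G)) (bd w) = 0) :
    z = 0 ∨ w = 0 ∨ z + w = 0 := by
  have key : ∀ z ∈ spt (cs (st M G)), z ∈ spt ((cellBC a).gr (d+1)) →
      (∃ u ∈ spt (ac (Lk M G)), bd u = bd z) → z = 0 := by
    rintro z hz hzk ⟨u, hu, huz⟩
    obtain ⟨u', hu', huz'⟩ := (cellBC a).hom_fill ((cellBC a).d_mem_gr d hzk) hu huz
    have hu'1 : u' ∈ spt (ac (Lk M G)) := spt_mono (fun _ h => h.1) hu'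
    have hu'2 : u' ∈ spt ((cellBC a).gr (d+1)) := spt_mono (fun _ h => h.2) hu'
    obtain ⟨x, hx, hxz⟩ := Nb_acyclic hG (z := z + u')
      (Submodule.add_mem _ (spt_mono (st_Nb M G) hz) (spt_mono (ac_mono (fun _ h => h.1)) hu'1))
      (by rw [map_add]; erw [huz']; exact add2 _)
    obtain ⟨x', hx', hxz'⟩ := (cellBC a).hom_fill (Submodule.add_mem _ hzk hu'2) hx hxz
    have hx0 : x' = 0 := by
      ext b
      by_contra hb
      obtain ⟨h1, h2⟩ := mem_spt.1 hx' b hb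
      cases b with
      | none => simp [BC.gr, cellBC, cdeg] at h2
      | some F =>
        have h3 : dim F + 1 = d + 1 + 1 := h2
        have := hMd F (Nb_sub hM G (some_ac.1 h1))
        omega
    rw [hx0, map_zero] at hxz'
    have := add2_eq.1 hxz'.symm
    rw [← R_eq.2 hz, this]
    exact R_st_Lk hu'1
  rcases (lk_cells hM h hG).2 (bd z) (bd_rel_Lk hM hz hd) ((cellBC a).d_mem_gr d hzk) (bd_bd z)
    (bd w) (bd_rel_Lk hM hw hwd) ((cellBC a).d_mem_gr d hwk) (bd_bd w) with h | h | h
  · exact Or.inl (key z hz hzk h)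
  · exact Or.inr (Or.inl (key w hw hwk h))
  · refine Or.inr (Or.inr (key _ (Submodule.add_mem _ hz hw) (Submodule.add_mem _ hzk hwk) ?_))
    rwa [map_add]

lemma bd_sg {F : CubeFace a} {C : Cell a} (h : IsFacet C (some F)) : bd (sg F) C = 1 :=
  zmod2_ne ((bd_coeff _ _).2 h)

lemma purity {M : Set (CubeFace a)} (hM : DC M) (hMd : ∀ F ∈ M, dim F ≤ d)
    (h : Nonempty (ChartedSpace (EuclideanSpace ℝ (Fin d)) (real M))) (G : CubeFace a) (hG : G ∈ M) :
    ∃ C ∈ M, G ≤ C ∧ dim C = d := by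
  obtain ⟨C, ⟨hC, hGC⟩, hmax⟩ := (Set.toFinite (st M G)).exists_maximalFor dim _ ⟨G, hG, le_rfl⟩
  refine ⟨C, hC, hGC, ?_⟩
  by_contra hne
  have hlt : dim C < d := lt_of_le_of_ne (hMd C hC) hne
  have hst : ∀ F ∈ st M C, F = C := by
    rintro F ⟨hF, hCF⟩
    have := hmax (j := F) ⟨hF, hGC.trans hCF⟩ (dim_mono hCF)
    exact (eq_of_le_dim hCF this).symm
  have hno : ∀ u ∈ spt (cs (st M C)), R (cs (st M C)) (bd u) = 0 := by
    intro u hu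
    have := map_spt (R (cs (st M C)) ∘ₗ bd) ⊥ (S := cs (st M C)) ?_ hu
    · simpa using this
    · rintro _ ⟨F, hF, rfl⟩
      rw [Submodule.mem_bot, LinearMap.comp_apply]
      ext b
      by_contra hb
      have hbU := mem_spt.1 (R_mem _ _) b hb
      rw [R_pos _ hbU] at hb
      have hf := (bd_coeff _ _).1 hb
      obtain ⟨F', hF', rfl⟩ := hbU
      rw [hst F hF, hst F' hF'] at hf
      have := hf.2
      omega
  have hCs : sg C ∈ spt (cs (st M C)) := single_spt (some_cs.2 ⟨hC, le_rfl⟩)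
  obtain ⟨u, hu, huC⟩ := rel_low hM h hC (k := dim C + 1) (by omega) (z := sg C) hCs
    (single_spt rfl) (hno _ hCs)
  rw [hno u hu] at huC
  have := DFunLike.congr_fun huC (some C)
  simp at this

/-- Relative cycles around a ridge. -/
lemma ridge_cycle {M : Set (CubeFace a)} {G C C' : CubeFace a} (hdG : dim G + 1 = d)
    (hGC : G ≤ C) (hGC' : G ≤ C') (hC : dim C = d) (hC' : dim C' = d) :
    R (cs (st M G)) (bd (sg C + sg C')) = 0 := by
  ext b
  by_contra hb
  have hbU := mem_spt.1 (R_mem _ _) b hb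
  rw [R_pos _ hbU, map_add, Finsupp.add_apply] at hb
  obtain ⟨F, hF, rfl⟩ := hbU
  have hd : dim F + 1 = d := by
    by_contra hn
    apply hb
    have h1 : bd (sg C) (some F) = 0 := by
      by_contra h1
      have := ((bd_coeff _ _).1 h1).2
      omega
    have h2 : bd (sg C') (some F) = 0 := by
      by_contra h1
      have := ((bd_coeff _ _).1 h1).2
      omega
    rw [h1, h2, add_zero]; rfl
  have : G = F := eq_of_le_dim hF.2 (by omega)
  subst this
  apply hb
  have f1 : IsFacet (some G) (some C) := ⟨hGC, by omega⟩
  have f2 : IsFacet (some G) (some C') := ⟨hGC', by omega⟩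
  rw [bd_sg f1, bd_sg f2]; rfl

lemma two_facets {M : Set (CubeFace a)} (hM : DC M) (hMd : ∀ F ∈ M, dim F ≤ d) (hd : 1 ≤ d)
    (h : Nonempty (ChartedSpace (EuclideanSpace ℝ (Fin d)) (real M))) (G : CubeFace a) (hG : G ∈ M)
    (hdG : dim G + 1 = d) : ∃ C C', C ∈ st M G ∧ C' ∈ st M G ∧ dim C = d ∧ dim C' = d ∧ C ≠ C' ∧
      ∀ F ∈ st M G, dim F = d → F = C ∨ F = C' := by
  obtain ⟨C, hC, hGC, hdC⟩ := purity hM hMd h G hG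
  have : ∃ C' ∈ st M G, dim C' = d ∧ C ≠ C' := by
    by_contra hn
    push Not at hn
    refine not_boundary hM hd h hG hC hGC (by omega) ?_
    intro F hF hGF
    obtain ⟨E, hE, hFE, hdE⟩ := purity hM hMd h F hF
    rw [hn E ⟨hE, hGF.trans hFE⟩ hdE]; exact hFE
  obtain ⟨C', hC', hdC', hne⟩ := this
  refine ⟨C, C', ⟨hC, hGC⟩, hC', hdC, hdC', hne, ?_⟩
  intro F hF hdF
  by_contra hn
  push Not at hn
  have hm : ∀ E ∈ st M G, dim E = d → sg E ∈ spt (cs (st M G)) ∧ sg E ∈ spt ((cellBC a).gr (d+1)) := by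
    intro E hE hdE
    refine ⟨single_spt (some_cs.2 hE), single_spt ?_⟩
    show dim E + 1 = d + 1
    rw [hdE]
  have m1 := hm C ⟨hC, hGC⟩ hdC
  have m2 := hm C' hC' hdC'
  have m3 := hm F hF hdF
  rcases rel_top hM hMd h hG (z := sg C + sg C') (w := sg C + sg F) (Submodule.add_mem _ m1.1 m2.1)
    (Submodule.add_mem _ m1.2 m2.2) (ridge_cycle hdG hGC hC'.2 hdC hdC')
    (Submodule.add_mem _ m1.1 m3.1) (Submodule.add_mem _ m1.2 m3.2)
    (ridge_cycle hdG hGC hF.2 hdC hdF) with h | h | h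
  · have := DFunLike.congr_fun h (some C)
    simp [hne.symm] at this
  · have := DFunLike.congr_fun h (some C)
    simp [hn.1] at this
  · have := DFunLike.congr_fun h (some F)
    simp [hn.1.symm, hn.2.symm] at this

theorem combman {M : Set (CubeFace a)} (hM : DC M) (hMd : ∀ F ∈ M, dim F ≤ d) (hd : 1 ≤ d)
    (h : Nonempty (ChartedSpace (EuclideanSpace ℝ (Fin d)) (real M))) : CM M d := by
  have hpure := purity hM hMd h
  have hcyc : R (cs M) (bd (Om M d)) = 0 := by
    ext b
    by_contra hb
    have hbU := mem_spt.1 (R_mem _ _) b hb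
    rw [R_pos _ hbU] at hb
    obtain ⟨G, hG, rfl⟩ := hbU
    have h1 := (cellBC a).d_mem_gr d (spt_mono (fun _ h => h.2) (Om_spt M d))
    have hdG : dim G + 1 = d := mem_spt.1 h1 _ hb
    obtain ⟨C, C', hC, hC', hdC, hdC', hne, hall⟩ := two_facets hM hMd hd h G hG hdG
    have hR : R (cs (st M G)) (Om M d) = sg C + sg C' := by
      ext b
      by_cases hb : b ∈ cs (st M G)
      · rw [R_pos _ hb]
        obtain ⟨F, hF, rfl⟩ := hb
        by_cases hdF : dim F = d
        · rw [Om_some hF.1 hdF]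
          rcases hall F hF hdF with rfl | rfl
          · simp [hne.symm]
          · simp [hne]
        · rw [Om_apply, if_neg]
          · have e1 : C ≠ F := fun e => hdF (e ▸ hdC)
            have e2 : C' ≠ F := fun e => hdF (e ▸ hdC')
            simp [e1, e2]
          · simp [cdeg, hdF]
      · rw [R_neg _ hb]
        have e1 : some C ≠ b := fun e => hb (e ▸ some_cs.2 hC)
        have e2 : some C' ≠ b := fun e => hb (e ▸ some_cs.2 hC')
        simp [e1, e2]
    apply hb
    rw [← R_pos (S := cs (st M G)) _ (some_cs.2 ⟨hG, le_rfl⟩), ← R_bd (st_op M G) (Om_ac M d), hR,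
      ridge_cycle hdG hC.2 hC'.2 hdC hdC']
  refine ⟨hM, hMd, hpure, hcyc, ?_⟩
  intro G hG z hz hzd
  have hsum : z = ∑ k ∈ Finset.range (d + 2), R ((cellBC a).gr k) z := by
    ext b
    rw [Finsupp.finsetSum_apply]
    simp only [R_apply]
    by_cases hb : z b = 0
    · simp [hb]
    · obtain ⟨F, hF, rfl⟩ := mem_spt.1 hz b hb
      have hFd := hMd F hF.1
      rw [Finset.sum_eq_single (dim F + 1)]
      · simp [BC.gr, cellBC, cdeg]
      · intro k _ hk
        rw [if_neg]
        intro h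
        exact hk (Eq.symm h)
      · intro hk
        simp at hk
        omega
  rw [hsum]
  apply Wk_sum
  intro k hk
  have hk : k < d + 2 := Finset.mem_range.1 hk
  have hzk1 : R ((cellBC a).gr k) z ∈ spt (cs (st M G)) :=
    spt_mono (fun _ h => h.2) (R_spt _ _ hz)
  have hzk2 : R ((cellBC a).gr k) z ∈ spt ((cellBC a).gr k) := R_mem _ _
  have hzk3 : R (cs (st M G)) (bd (R ((cellBC a).gr k) z)) = 0 := by
    cases k with
    | zero =>
      have : R ((cellBC a).gr 0) z = 0 := by
        ext b
        by_contra hb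
        obtain ⟨F, hF, rfl⟩ := mem_spt.1 hzk1 b hb
        have := mem_spt.1 hzk2 _ hb
        simp [BC.gr, cellBC, cdeg] at this
      rw [this]; simp
    | succ k =>
      have h1 : bd (R ((cellBC a).gr (k+1)) z) = R ((cellBC a).gr k) (bd z) := (cellBC a).d_gr k z
      rw [h1, R_R, Set.inter_comm, ← R_R, hzd, map_zero]
  by_cases hkd : k < d + 1
  · obtain ⟨u, hu, huz⟩ := rel_low hM h hG hkd hzk1 hzk2 hzk3
    exact ⟨u, hu, 0, by rw [huz]; simp⟩
  · obtain rfl : k = d + 1 := by omega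
    obtain ⟨C, hC, hGC, hdC⟩ := hpure G hG
    have hO1 : R (cs (st M G)) (Om M d) ∈ spt ((cellBC a).gr (d+1)) :=
      spt_mono (fun _ h => h.2.2) (R_spt _ _ (Om_spt M d))
    have hO2 : R (cs (st M G)) (bd (R (cs (st M G)) (Om M d))) = 0 := by
      rw [R_bd (st_op M G) (Om_ac M d), ← R_R_sub (cs_mono (st_op M G).1), hcyc, map_zero]
    rcases rel_top hM hMd h hG hzk1 hzk2 hzk3 (R_mem (cs (st M G)) (Om M d)) hO1 hO2 with h | h | h
    · rw [h]; exact Wk_zero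
    · exfalso
      have := DFunLike.congr_fun h (some C)
      have hCs : C ∈ st M G := ⟨hC, hGC⟩
      rw [R_pos _ (some_cs.2 hCs), Om_some hC hdC] at this
      simp at this
    · exact ⟨0, Submodule.zero_mem _, 1, by rw [add2_eq.1 h]; simp⟩

end combman
end CubManif

namespace CubManif
open Finsupp hiding some add_apply
open CubeFace

section duality
open scoped Classical
variable {a d : ℕ}

lemma top_bd {M : Set (CubeFace a)} (hM : CM M d) {y : Ch (Cell a)} (hy : y ∈ spt (ac M))
    {C : CubeFace a} (hC : dim C = d) : bd y (some C) = 0 := by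
  have h : bd y ∈ spt {C : Cell a | cdeg C ≠ d + 1} := by
    refine map_spt bd _ ?_ hy
    intro b hb
    rw [mem_spt]
    intro b' hb' hd
    have hf := (bd_coeff _ _).1 hb'
    have h1 := (cellBC a).hdeg b b' hb'
    change cdeg b' + 1 = cdeg b at h1
    cases b with
    | none => simp [cdeg] at h1
    | some F =>
      have := hM.hdim F (some_ac.1 hb)
      simp only [cdeg] at h1 hd
      omega
  by_contra hn
  have := mem_spt.1 h _ hn
  apply this
  simp [cdeg, hC]

lemma Om_cyc {M U : Set (CubeFace a)} (hM : CM M d) (hU : Op M U) :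
    R (cs U) (bd (R (cs U) (Om M d))) = 0 := by
  rw [R_bd hU (Om_ac M d), ← R_R_sub (cs_mono hU.1), hM.cyc, map_zero]

lemma cover_ext {A B : Set (CubeFace a)} {p q : Ch (Cell a)} (hp : p ∈ spt (cs (A ∪ B)))
    (hq : q ∈ spt (cs (A ∪ B))) (hA : R (cs A) p = R (cs A) q) (hB : R (cs B) p = R (cs B) q) :
    p = q := by
  ext b
  by_cases hbA : b ∈ cs A
  · rw [← R_pos p hbA, hA, R_pos q hbA]
  by_cases hbB : b ∈ cs B
  · rw [← R_pos p hbB, hB, R_pos q hbB]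
  have hb : b ∉ cs (A ∪ B) := by
    rintro ⟨F, hF | hF, rfl⟩
    · exact hbA (some_cs.2 hF)
    · exact hbB (some_cs.2 hF)
  rw [← R_eq.2 hp, ← R_eq.2 hq, R_neg _ hb, R_neg _ hb]

lemma Op_union {M A B : Set (CubeFace a)} (hA : Op M A) (hB : Op M B) : Op M (A ∪ B) :=
  ⟨Set.union_subset hA.1 hB.1, fun F hF G hG h => hF.elim (fun hF => Or.inl (hA.2 F hF G hG h))
    (fun hF => Or.inr (hB.2 F hF G hG h))⟩

lemma Op_inter {M A B : Set (CubeFace a)} (hA : Op M A) (hB : Op M B) : Op M (A ∩ B) :=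
  ⟨fun _ h => hA.1 h.1, fun F hF G hG h => ⟨hA.2 F hF.1 G hG h, hB.2 F hF.2 G hG h⟩⟩

/-- The duality property of open sets. -/
def PP (M : Set (CubeFace a)) (d : ℕ) (U : Set (CubeFace a)) : Prop :=
  ∀ z ∈ spt (cs U), R (cs U) (bd z) = 0 → Wk M d U z

lemma add2_move {M : Type} [AddCommGroup M] [Module (ZMod 2) M] {x y z : M} (h : x = y + z) :
    y = x + z := by
  rw [h, add_assoc, add2, add_zero]

theorem mv_P {M A B : Set (CubeFace a)} (hM : CM M d) (hA : Op M A) (hB : Op M B) (pA : PP M d A)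
    (pB : PP M d B) (pD : PP M d (A ∩ B)) {C : CubeFace a} (hCA : C ∈ A) (hCB : C ∈ B)
    (hC : dim C = d) : PP M d (A ∪ B) := by
  intro z hz hzd
  have hU := Op_union hA hB
  have hD := Op_inter hA hB
  have sAU : cs A ⊆ cs (A ∪ B) := cs_mono Set.subset_union_left
  have sBU : cs B ⊆ cs (A ∪ B) := cs_mono Set.subset_union_right
  have sDA : cs (A ∩ B) ⊆ cs A := cs_mono Set.inter_subset_left
  have sDB : cs (A ∩ B) ⊆ cs B := cs_mono Set.inter_subset_right
  have hzM : z ∈ spt (ac M) := spt_mono (cs_ac hU.1) hz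
  have acA : ∀ {x : Ch (Cell a)}, x ∈ spt (cs A) → x ∈ spt (ac M) := fun h => spt_mono (cs_ac hA.1) h
  have acB : ∀ {x : Ch (Cell a)}, x ∈ spt (cs B) → x ∈ spt (ac M) := fun h => spt_mono (cs_ac hB.1) h
  have acD : ∀ {x : Ch (Cell a)}, x ∈ spt (cs (A ∩ B)) → x ∈ spt (ac M) :=
    fun h => spt_mono (cs_ac hD.1) h
  obtain ⟨x, hx, c, ex⟩ := pA (R (cs A) z) (R_mem _ _)
    (by rw [R_bd hA hzM, ← R_R_sub sAU, hzd, map_zero])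
  obtain ⟨y, hy, c2, ey⟩ := pB (R (cs B) z) (R_mem _ _)
    (by rw [R_bd hB hzM, ← R_R_sub sBU, hzd, map_zero])
  have hcc : c = c2 := by
    have h1 := DFunLike.congr_fun ex (some C)
    have h2 := DFunLike.congr_fun ey (some C)
    simp only [Finsupp.add_apply, Finsupp.smul_apply] at h1 h2
    rw [R_pos _ (some_cs.2 hCA), R_pos _ (some_cs.2 hCA), R_pos _ (some_cs.2 hCA),
      Om_some (hA.1 hCA) hC, top_bd hM (acA hx) hC] at h1
    rw [R_pos _ (some_cs.2 hCB), R_pos _ (some_cs.2 hCB), R_pos _ (some_cs.2 hCB),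
      Om_some (hA.1 hCA) hC, top_bd hM (acB hy) hC] at h2
    simp at h1 h2
    rw [← h1, ← h2]
  subst hcc
  have ex' := add2_move ex
  have ey' := add2_move ey
  obtain ⟨w, hw, c3, ew⟩ := pD (R (cs (A ∩ B)) (x + y)) (R_mem _ _) (by
    rw [R_bd hD (Submodule.add_mem _ (acA hx) (acB hy)), map_add, map_add, ← R_R_sub sDA (bd x), ex',
      ← R_R_sub sDB (bd y), ey', map_add, map_add, R_R_sub sDA, R_R_sub sDB, map_smul, map_smul,
      R_R_sub sDA, R_R_sub sDB, add2])
  set x' := x + (R (cs A) (bd w) + c3 • R (cs A) (Om M d)) with hx'def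
  have hx' : x' ∈ spt (cs A) := Submodule.add_mem _ hx
    (Submodule.add_mem _ (R_mem _ _) (Submodule.smul_mem _ _ (R_mem _ _)))
  have hRx : R (cs (A ∩ B)) x' = R (cs (A ∩ B)) y := by
    rw [hx'def, map_add, map_add, map_smul, R_R_sub sDA, R_R_sub sDA, ← ew, map_add, ← add_assoc, add2,
      zero_add]
  have hbx : R (cs A) (bd x') = R (cs A) (bd x) := by
    rw [hx'def]
    simp only [map_add, map_smul]
    rw [Om_cyc hM hA, R_bd hA (bd_ac hM.dc (acD hw)), bd_bd]
    simp
  set u := x' + R (cs A)ᶜ y with hu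
  have huA : R (cs A) u = x' := by
    have h0 : R (cs A) (R (cs A)ᶜ y) = 0 := by
      ext b
      by_cases hb : b ∈ cs A
      · rw [R_pos _ hb, R_neg _ (by simpa using hb)]; rfl
      · rw [R_neg _ hb]; rfl
    rw [hu, map_add, h0, R_eq.2 hx', add_zero]
  have huB : R (cs B) u = y := by
    ext b
    by_cases hbB : b ∈ cs B
    · rw [R_pos _ hbB, hu, Finsupp.add_apply]
      by_cases hbA : b ∈ cs A
      · have hbD : b ∈ cs (A ∩ B) := by rw [← cs_inter]; exact ⟨hbA, hbB⟩
        have := DFunLike.congr_fun hRx b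
        rw [R_pos _ hbD, R_pos _ hbD] at this
        rw [this, R_neg _ (by simpa using hbA), add_zero]
      · rw [← R_eq.2 hx', R_neg _ hbA, zero_add, R_pos _ hbA]
    · rw [R_neg _ hbB, ← R_eq.2 hy, R_neg _ hbB]
  have huU : u ∈ spt (cs (A ∪ B)) := Submodule.add_mem _ (spt_mono sAU hx')
    (spt_mono (fun b hb => sBU hb.2) (R_spt _ _ hy))
  have huM : u ∈ spt (ac M) := spt_mono (cs_ac hU.1) huU
  refine ⟨u, huU, c, ?_⟩
  refine cover_ext hz (Submodule.add_mem _ (R_mem _ _) (Submodule.smul_mem _ _ (R_mem _ _))) ?_ ?_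
  · rw [map_add, map_smul, R_R_sub sAU, R_R_sub sAU, ← R_bd hA huM, huA, hbx, ex]
  · rw [map_add, map_smul, R_R_sub sBU, R_R_sub sBU, ← R_bd hB huM, huB, ey]

/-- Cells meeting `F` and free along `J`. -/
def UU (M : Set (CubeFace a)) (F : CubeFace a) (J : Finset (Fin a)) : Set (CubeFace a) :=
  {C | C ∈ M ∧ (∀ i, C i = none ∨ F i = none ∨ C i = F i) ∧ ∀ j ∈ J, C j = none}

lemma UU_op (M : Set (CubeFace a)) (F : CubeFace a) (J : Finset (Fin a)) : Op M (UU M F J) := by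
  refine ⟨fun _ h => h.1, ?_⟩
  rintro C ⟨hC, h1, h2⟩ G hG hCG
  refine ⟨hG, fun i => ?_, fun j hj => ?_⟩
  · rcases hCG i with h | h
    · exact Or.inl h
    · rw [← h]; exact h1 i
  · rcases hCG j with h | h
    · exact h
    · rw [← h]; exact h2 j hj

lemma UU_upd_sub {M : Set (CubeFace a)} {F : CubeFace a} {J : Finset (Fin a)} {i : Fin a}
    (hi : F i = none) (b : Bool) : UU M (upd F i (some b)) J ⊆ UU M F J := by
  rintro C ⟨hC, h1, h2⟩
  refine ⟨hC, fun j => ?_, h2⟩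
  by_cases hj : j = i
  · subst hj; exact Or.inr (Or.inl hi)
  · simpa [upd_ne _ _ hj] using h1 j

lemma UU_union {M : Set (CubeFace a)} {F : CubeFace a} {J : Finset (Fin a)} {i : Fin a}
    (hi : F i = none) :
    UU M F J = UU M (upd F i (some false)) J ∪ UU M (upd F i (some true)) J := by
  apply Set.Subset.antisymm
  · rintro C ⟨hC, h1, h2⟩
    by_cases hCt : C i = some true
    · right
      refine ⟨hC, fun j => ?_, h2⟩
      by_cases hj : j = i
      · subst hj; simp [hCt]
      · simpa [upd_ne _ _ hj] using h1 j
    · left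
      refine ⟨hC, fun j => ?_, h2⟩
      by_cases hj : j = i
      · subst hj
        cases h : C j with
        | none => simp
        | some b =>
          cases b with
          | false => simp
          | true => exact absurd h hCt
      · simpa [upd_ne _ _ hj] using h1 j
  · exact Set.union_subset (UU_upd_sub hi _) (UU_upd_sub hi _)

lemma UU_inter {M : Set (CubeFace a)} {F : CubeFace a} {J : Finset (Fin a)} {i : Fin a}
    (hi : F i = none) :
    UU M (upd F i (some false)) J ∩ UU M (upd F i (some true)) J = UU M F (insert i J) := by
  apply Set.Subset.antisymm
  · rintro C ⟨h, h'⟩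
    have h0 := UU_upd_sub hi _ h
    refine ⟨h0.1, h0.2.1, ?_⟩
    intro j hj
    rcases Finset.mem_insert.1 hj with rfl | hj
    · have h1 := h.2.1 j
      have h2 := h'.2.1 j
      rw [upd_same] at h1 h2
      cases hC : C j with
      | none => rfl
      | some b => cases b <;> simp_all
    · exact h0.2.2 j hj
  · rintro C ⟨hC, h1, h2⟩
    have h3 := h2 i (Finset.mem_insert_self _ _)
    have h4 : ∀ j ∈ J, C j = none := fun j hj => h2 j (Finset.mem_insert_of_mem hj)
    refine ⟨⟨hC, fun j => ?_, h4⟩, ⟨hC, fun j => ?_, h4⟩⟩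
    all_goals
      by_cases hj : j = i
      · subst hj; exact Or.inl h3
      · simpa [upd_ne _ _ hj] using h1 j

lemma UU_full (M : Set (CubeFace a)) (F : CubeFace a) : UU M F (fr F) = st M F := by
  ext C
  constructor
  · rintro ⟨hC, h1, h2⟩
    refine ⟨hC, fun i => ?_⟩
    rcases h1 i with h | h | h
    · exact Or.inl h
    · exact Or.inl (h2 i (mem_fr.2 h))
    · exact Or.inr h.symm
  · rintro ⟨hC, h⟩
    refine ⟨hC, fun i => ?_, fun j hj => ?_⟩
    · rcases h i with h | h
      · exact Or.inl h
      · exact Or.inr (Or.inr h.symm)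
    · rcases h j with h | h
      · exact h
      · rw [← h]; exact mem_fr.1 hj

lemma UU_top {M : Set (CubeFace a)} (hM : CM M d) {F : CubeFace a} (hF : F ∈ M) {J : Finset (Fin a)}
    (hJ : J ⊆ fr F) : ∃ C ∈ UU M F J, dim C = d := by
  obtain ⟨C, hC, hFC, hd⟩ := hM.pure F hF
  have : C ∈ UU M F (fr F) := by rw [UU_full]; exact ⟨hC, hFC⟩
  exact ⟨C, ⟨this.1, this.2.1, fun j hj => this.2.2 j (hJ hj)⟩, hd⟩

lemma fr_card_step {F : CubeFace a} {J : Finset (Fin a)} {i : Fin a} (hi : i ∈ fr F \ J) {n : ℕ}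
    (hn : (fr F \ J).card = n + 1) :
    (∀ b, (fr (upd F i (some b)) \ J).card = n) ∧ (fr F \ insert i J).card = n := by
  have h1 : ((fr F \ J).erase i).card = n := by rw [Finset.card_erase_of_mem hi, hn]; rfl
  refine ⟨fun b => ?_, ?_⟩
  · rw [fr_upd_some, ← h1]; congr 1; ext j; simp; tauto
  · rw [← h1]; congr 1; ext j; simp; tauto

lemma fr_sub_step {F : CubeFace a} {J : Finset (Fin a)} {i : Fin a} (hi : i ∈ fr F \ J) (hJ : J ⊆ fr F) :
    (∀ b, J ⊆ fr (upd F i (some b))) ∧ insert i J ⊆ fr F := by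
  rw [Finset.mem_sdiff] at hi
  refine ⟨fun b => ?_, Finset.insert_subset hi.1 hJ⟩
  rw [fr_upd_some]
  intro j hj
  exact Finset.mem_erase.2 ⟨fun e => hi.2 (e ▸ hj), hJ hj⟩

theorem UU_P {M : Set (CubeFace a)} (hM : CM M d) : ∀ n : ℕ, ∀ F ∈ M, ∀ J ⊆ fr F,
    (fr F \ J).card = n → PP M d (UU M F J) := by
  intro n
  induction n with
  | zero =>
    intro F hF J hJ hn
    have : J = fr F := by
      apply Finset.Subset.antisymm hJ
      rwa [← Finset.sdiff_eq_empty_iff_subset, ← Finset.card_eq_zero]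
    rw [this, UU_full]
    exact hM.loc F hF
  | succ n ih =>
    intro F hF J hJ hn
    obtain ⟨i, hi⟩ : (fr F \ J).Nonempty := by rw [← Finset.card_pos]; omega
    have hiF : F i = none := mem_fr.1 (Finset.mem_sdiff.1 hi).1
    obtain ⟨c1, c2⟩ := fr_card_step hi hn
    obtain ⟨s1, s2⟩ := fr_sub_step hi hJ
    have hm : ∀ b, upd F i (some b) ∈ M := fun b => hM.dc F hF _ (upd_le hiF _)
    obtain ⟨C, hC, hCd⟩ := UU_top hM hF s2
    have hC' := hC
    rw [← UU_inter hiF] at hC'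
    rw [UU_union hiF]
    refine mv_P hM (UU_op _ _ _) (UU_op _ _ _) (ih _ (hm _) J (s1 _) (c1 _)) (ih _ (hm _) J (s1 _) (c1 _))
      ?_ hC'.1 hC'.2 hCd
    rw [UU_inter hiF]
    exact ih F hF _ s2 c2

/-- Nontrivial classes. -/
def QQ (M : Set (CubeFace a)) (d : ℕ) (U : Set (CubeFace a)) (q : ℕ) : Prop :=
  ∃ ζ ∈ spt (cs U), ζ ∈ spt ((cellBC a).gr q) ∧ R (cs U) (bd ζ) = 0 ∧ ¬ Wk M d U ζ

theorem mv_Q {M A B : Set (CubeFace a)} (hM : CM M d) (hA : Op M A) (hB : Op M B) (pA : PP M d A)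
    (pB : PP M d B) {q : ℕ} (qD : QQ M d (A ∩ B) (q+1)) {C : CubeFace a} (hCA : C ∈ A)
    (hC : dim C = d) : QQ M d (A ∪ B) q := by
  have hU := Op_union hA hB
  have hD := Op_inter hA hB
  have sAU : cs A ⊆ cs (A ∪ B) := cs_mono Set.subset_union_left
  have sBU : cs B ⊆ cs (A ∪ B) := cs_mono Set.subset_union_right
  have sDA : cs (A ∩ B) ⊆ cs A := cs_mono Set.inter_subset_left
  have sDB : cs (A ∩ B) ⊆ cs B := cs_mono Set.inter_subset_right
  have acA : ∀ {x : Ch (Cell a)}, x ∈ spt (cs A) → x ∈ spt (ac M) := fun h => spt_mono (cs_ac hA.1) h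
  have acU : ∀ {x : Ch (Cell a)}, x ∈ spt (cs (A ∪ B)) → x ∈ spt (ac M) :=
    fun h => spt_mono (cs_ac hU.1) h
  have acD : ∀ {x : Ch (Cell a)}, x ∈ spt (cs (A ∩ B)) → x ∈ spt (ac M) :=
    fun h => spt_mono (cs_ac hD.1) h
  obtain ⟨ζ, hζ, hζq, hζd, hζn⟩ := qD
  set ξ := R (cs A) (bd ζ) with hξ
  have hξA : ξ ∈ spt (cs A) := R_mem _ _
  have hξU : ξ ∈ spt (cs (A ∪ B)) := spt_mono sAU hξA
  have hξB : R (cs B) ξ = 0 := by rw [hξ, R_R, Set.inter_comm, cs_inter, hζd]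
  refine ⟨ξ, hξU, ?_, ?_, ?_⟩
  · exact spt_mono (fun _ h => h.2) (R_spt (cs A) _ ((cellBC a).d_mem_gr q hζq))
  · refine cover_ext (R_mem _ _) (Submodule.zero_mem _) ?_ ?_
    · rw [R_R_sub sAU, hξ, R_bd hA (bd_ac hM.dc (acD hζ)), bd_bd]
    · rw [R_R_sub sBU, ← R_bd hB (acU hξU), hξB]; simp
  · rintro ⟨y, hy, c, e⟩
    have eA := congrArg (R (cs A)) e
    have eB := congrArg (R (cs B)) e
    rw [R_eq.2 hξA, map_add, map_smul, R_R_sub sAU, R_R_sub sAU] at eA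
    rw [hξB, map_add, map_smul, R_R_sub sBU, R_R_sub sBU] at eB
    have hc : c = 0 := by
      have h1 := DFunLike.congr_fun eA (some C)
      simp only [Finsupp.add_apply, Finsupp.smul_apply] at h1
      rw [hξ, R_pos _ (some_cs.2 hCA), R_pos _ (some_cs.2 hCA), R_pos _ (some_cs.2 hCA),
        Om_some (hA.1 hCA) hC, top_bd hM (acU hy) hC, top_bd hM (acD hζ) hC] at h1
      simpa using h1.symm
    subst hc
    rw [zero_smul, add_zero] at eA eB
    obtain ⟨s, hs, c1, es⟩ := pA (ζ + R (cs A) y)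
      (Submodule.add_mem _ (spt_mono sDA hζ) (R_mem _ _))
      (by rw [map_add, map_add, R_bd hA (acU hy), ← hξ, eA, add2])
    obtain ⟨t, ht, c2, et⟩ := pB (R (cs B) y) (R_mem _ _) (by rw [R_bd hB (acU hy), ← eB])
    apply hζn
    refine ⟨R (cs (A ∩ B)) (s + t), R_mem _ _, c1 + c2, ?_⟩
    have e1 := congrArg (R (cs (A ∩ B))) es
    have e2 := congrArg (R (cs (A ∩ B))) et
    simp only [map_add, map_smul, R_R_sub sDA, R_R_sub sDB, R_eq.2 hζ] at e1 e2
    rw [R_bd hD (Submodule.add_mem _ (acA hs) (spt_mono (cs_ac hB.1) ht)), map_add, map_add,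
      add_smul]
    have h : ζ = (ζ + R (cs (A ∩ B)) y) + R (cs (A ∩ B)) y := by rw [add_assoc, add2, add_zero]
    rw [h, e1]
    nth_rewrite 1 [e2]
    abel

theorem UU_Q {M : Set (CubeFace a)} (hM : CM M d) {F : CubeFace a} (hF : F ∉ M)
    (hFM : ∀ i b, F i = none → upd F i (some b) ∈ M) : ∀ n : ℕ, ∀ J ⊆ fr F,
    (fr F \ J).card = n + 1 → ∀ q, q + n = d + 1 → QQ M d (UU M F J) q := by
  intro n
  induction n with
  | zero =>
    intro J hJ hn q hq
    obtain rfl : q = d + 1 := by omega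
    obtain ⟨i, hi⟩ : (fr F \ J).Nonempty := by rw [← Finset.card_pos]; omega
    have hiF : F i = none := mem_fr.1 (Finset.mem_sdiff.1 hi).1
    obtain ⟨c1, c2⟩ := fr_card_step hi hn
    obtain ⟨s1, s2⟩ := fr_sub_step hi hJ
    have hm : ∀ b, upd F i (some b) ∈ M := fun b => hFM i b hiF
    have hins : insert i J = fr F := by
      apply Finset.Subset.antisymm s2
      rwa [← Finset.sdiff_eq_empty_iff_subset, ← Finset.card_eq_zero]
    have hD : UU M (upd F i (some false)) J ∩ UU M (upd F i (some true)) J = ∅ := by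
      rw [UU_inter hiF, hins, UU_full]
      ext C
      simp only [Set.mem_empty_iff_false, iff_false]
      rintro ⟨hC, hFC⟩
      exact hF (hM.dc C hC F hFC)
    obtain ⟨C, hC, hCd⟩ := UU_top hM (hm false) (s1 false)
    obtain ⟨C', hC', hCd'⟩ := UU_top hM (hm true) (s1 true)
    rw [UU_union hiF]
    generalize hAe : UU M (upd F i (some false)) J = A at *
    generalize hBe : UU M (upd F i (some true)) J = B at *
    have hA : Op M A := hAe ▸ UU_op _ _ _
    have hB : Op M B := hBe ▸ UU_op _ _ _
    have sAU : cs A ⊆ cs (A ∪ B) := cs_mono Set.subset_union_left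
    have sBU : cs B ⊆ cs (A ∪ B) := cs_mono Set.subset_union_right
    have hU := Op_union hA hB
    have hOA : R (cs A) (Om M d) ∈ spt (cs A) := R_mem _ _
    have hOM : R (cs A) (Om M d) ∈ spt (ac M) := spt_mono (cs_ac hA.1) hOA
    have hBA : R (cs B) (R (cs A) (Om M d)) = 0 := by
      rw [R_R, Set.inter_comm, cs_inter, hD]
      ext b
      rw [R_neg]; rfl
      rintro ⟨F, hF, -⟩; exact hF
    have hC'A : C' ∉ A := fun h => by
      have : C' ∈ A ∩ B := ⟨h, hC'⟩
      rw [hD] at this; exact this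
    refine ⟨R (cs A) (Om M d), spt_mono sAU hOA, ?_, ?_, ?_⟩
    · exact spt_mono (fun _ h => h.2.2) (R_spt _ _ (Om_spt M d))
    · refine cover_ext (R_mem _ _) (Submodule.zero_mem _) ?_ ?_
      · rw [R_R_sub sAU, Om_cyc hM hA, map_zero]
      · rw [R_R_sub sBU, ← R_bd hB hOM, hBA]; simp
    · rintro ⟨y, hy, c, e⟩
      have hyM : y ∈ spt (ac M) := spt_mono (cs_ac hU.1) hy
      have h1 := DFunLike.congr_fun e (some C)
      have h2 := DFunLike.congr_fun e (some C')
      simp only [Finsupp.add_apply, Finsupp.smul_apply] at h1 h2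
      rw [R_pos _ (some_cs.2 hC), R_pos _ (sAU (some_cs.2 hC)), R_pos _ (sAU (some_cs.2 hC)),
        Om_some (hA.1 hC) hCd, top_bd hM hyM hCd] at h1
      rw [R_neg _ (fun h => hC'A (some_cs.1 h)), R_pos _ (sBU (some_cs.2 hC')),
        R_pos _ (sBU (some_cs.2 hC')), Om_some (hB.1 hC') hCd', top_bd hM hyM hCd'] at h2
      simp at h1 h2
      rw [← h1] at h2
      exact one_ne_zero h2.symm
  | succ n ih =>
    intro J hJ hn q hq
    obtain ⟨i, hi⟩ : (fr F \ J).Nonempty := by rw [← Finset.card_pos]; omega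
    have hiF : F i = none := mem_fr.1 (Finset.mem_sdiff.1 hi).1
    obtain ⟨c1, c2⟩ := fr_card_step hi hn
    obtain ⟨s1, s2⟩ := fr_sub_step hi hJ
    have hm : ∀ b, upd F i (some b) ∈ M := fun b => hFM i b hiF
    obtain ⟨C, hC, hCd⟩ := UU_top hM (hm false) (s1 false)
    rw [UU_union hiF]
    refine mv_Q hM (UU_op _ _ _) (UU_op _ _ _) (UU_P hM _ _ (hm _) J (s1 _) rfl)
      (UU_P hM _ _ (hm _) J (s1 _) rfl) ?_ hC hCd
    rw [UU_inter hiF]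
    exact ih _ s2 c2 (q+1) (by omega)

end duality
end CubManif

namespace CubManif
open Finsupp hiding some add_apply
open CubeFace

section verts
open scoped Classical
variable {a b d : ℕ}

lemma mem_verts {F : CubeFace a} {v : Fin a → Bool} : v ∈ verts F ↔ ∀ i, F i = none ∨ F i = some (v i) := by
  constructor
  · intro h i
    rcases h i with h | h
    · exact Or.inl h
    · exact Or.inr h.symm
  · intro h i
    rcases h i with h | h
    · exact Or.inl h
    · exact Or.inr h.symm

lemma verts_mono {F G : CubeFace a} (h : F ≤ G) : verts F ⊆ verts G := fun _ hv => le_trans hv h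

lemma verts_sub {F G : CubeFace a} (h : verts F ⊆ verts G) : F ≤ G := by
  intro i
  have h0 : ∀ x : Bool, (∀ y, F i = some y → y = x) →
      (fun j => if j = i then x else (F j).getD false) ∈ verts F := by
    intro x hx
    rw [mem_verts]
    intro j
    by_cases hj : j = i
    · subst hj
      cases hF : F j with
      | none => left; rfl
      | some y => right; simp [hx y hF]
    · cases hF : F j with
      | none => left; rfl
      | some y => right; simp [hj, hF]
  have h1 := fun x hx => mem_verts.1 (h (h0 x hx)) i
  simp only [if_true] at h1
  cases hF : F i with
  | none =>
    have e1 := h1 true (by simp [hF])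
    have e2 := h1 false (by simp [hF])
    rcases e1 with e1 | e1
    · exact Or.inl e1
    · rcases e2 with e2 | e2
      · exact Or.inl e2
      · rw [e1] at e2; simp at e2
  | some y =>
    rcases h1 y (by intro z hz; rw [hF] at hz; simpa using hz.symm) with e | e
    · exact Or.inl e
    · exact Or.inr e.symm

lemma verts_inj {F G : CubeFace a} (h : verts F = verts G) : F = G :=
  le_antisymm (verts_sub h.le) (verts_sub h.ge)

lemma verts_split {F : CubeFace a} {i : Fin a} (h : F i = none) :
    verts F = verts (upd F i (some false)) ∪ verts (upd F i (some true)) := by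
  apply Set.Subset.antisymm
  · intro v hv
    have key : v ∈ verts (upd F i (some (v i))) := by
      rw [mem_verts] at *
      intro j
      by_cases hj : j = i
      · subst hj; simp
      · simpa [hj] using hv j
    cases hvi : v i with
    | false => left; rwa [hvi] at key
    | true => right; rwa [hvi] at key
  · exact Set.union_subset (verts_mono (upd_le h _)) (verts_mono (upd_le h _))

lemma verts_disj (F : CubeFace a) (i : Fin a) :
    Disjoint (verts (upd F i (some false))) (verts (upd F i (some true))) := by
  rw [Set.disjoint_left]
  intro v h1 h2
  have e1 := mem_verts.1 h1 i
  have e2 := mem_verts.1 h2 i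
  simp at e1 e2
  rw [e1] at e2; simp at e2

lemma ncard_verts : ∀ n : ℕ, ∀ F : CubeFace a, dim F = n → (verts F).ncard = 2 ^ n := by
  intro n
  induction n with
  | zero =>
    intro F hF
    have : F = toFace (vx F) := by
      symm
      exact eq_of_le_dim (vx_le F) (by omega)
    have : verts F = {vx F} := by
      ext v
      constructor
      · intro hv
        have hv' : toFace v ≤ F := hv
        have e : toFace v = F := eq_of_le_dim hv' (by omega)
        funext i
        have := congrFun e i
        rw [vx, ← this]; rfl
      · rintro rfl; exact vx_le F
    rw [this]; simp
  | succ n ih =>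
    intro F hF
    obtain ⟨i, hi⟩ : (fr F).Nonempty := by rw [← Finset.card_pos, ← dim_eq]; omega
    have hi' := mem_fr.1 hi
    have e1 := dim_upd_some hi' false
    have e2 := dim_upd_some hi' true
    rw [verts_split hi', Set.ncard_union_eq (verts_disj F i), ih _ (by omega), ih _ (by omega), pow_succ]
    omega

lemma dim_of_ncard {F : CubeFace a} {G : CubeFace b} (h : (verts F).ncard = (verts G).ncard) :
    dim F = dim G := by
  rw [ncard_verts _ F rfl, ncard_verts _ G rfl] at h
  exact Nat.pow_right_injective le_rfl h

lemma dim_toFace (v : Fin a → Bool) : dim (toFace v) = 0 := by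
  rw [dim_eq, Finset.card_eq_zero]
  ext i
  simp [mem_fr, toFace]

lemma verts_meet {F G : CubeFace a} :
    (∀ i, F i = none ∨ G i = none ∨ F i = G i) ↔ (verts F ∩ verts G).Nonempty := by
  constructor
  · intro h
    refine ⟨fun i => (F i).getD ((G i).getD false), ?_, ?_⟩
    · rw [mem_verts]; intro i
      cases hF : F i <;> simp
    · rw [mem_verts]; intro i
      rcases h i with e | e | e
      · cases hG : G i <;> simp [e]
      · exact Or.inl e
      · rw [e]; cases hG : G i <;> simp
  · rintro ⟨v, h1, h2⟩ i
    rcases mem_verts.1 h1 i with e | e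
    · exact Or.inl e
    · rcases mem_verts.1 h2 i with e' | e'
      · exact Or.inr (Or.inl e')
      · exact Or.inr (Or.inr (by rw [e, e']))

lemma verts_nonempty (F : CubeFace a) : (verts F).Nonempty := ⟨vx F, vx_le F⟩

/-- Isomorphism of the `k`-skeleta, with inverse maps. -/
structure SI (M : Set (CubeFace a)) (N : Set (CubeFace b)) (f : (Fin a → Bool) → (Fin b → Bool))
    (g : (Fin b → Bool) → (Fin a → Bool)) (k : ℕ) : Prop where
  fm : ∀ v, toFace v ∈ M → toFace (f v) ∈ N
  gm : ∀ v, toFace v ∈ N → toFace (g v) ∈ M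
  gf : ∀ v, toFace v ∈ M → g (f v) = v
  fg : ∀ v, toFace v ∈ N → f (g v) = v
  ff : ∀ F ∈ M, dim F ≤ k → ∃ G ∈ N, verts G = f '' verts F
  gg : ∀ F ∈ N, dim F ≤ k → ∃ G ∈ M, verts G = g '' verts F

variable {M : Set (CubeFace a)} {N : Set (CubeFace b)} {f : (Fin a → Bool) → (Fin b → Bool)}
    {g : (Fin b → Bool) → (Fin a → Bool)} {k : ℕ}

lemma SI.symm (h : SI M N f g k) : SI N M g f k := ⟨h.gm, h.fm, h.fg, h.gf, h.gg, h.ff⟩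

lemma SI.img_sub (h : SI M N f g k) {W : Set (Fin a → Bool)} (hW : ∀ v ∈ W, toFace v ∈ M) :
    g '' (f '' W) = W := by
  ext v
  constructor
  · rintro ⟨_, ⟨w, hw, rfl⟩, rfl⟩
    rwa [h.gf _ (hW w hw)]
  · intro hv
    exact ⟨f v, ⟨v, hv, rfl⟩, h.gf _ (hW v hv)⟩

lemma verts_mem (hM : DC M) {F : CubeFace a} (hF : F ∈ M) : ∀ v ∈ verts F, toFace v ∈ M :=
  fun _ hv => hM F hF _ hv

lemma SI.injOn (h : SI M N f g k) {W : Set (Fin a → Bool)} (hW : ∀ v ∈ W, toFace v ∈ M) :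
    Set.InjOn f W := by
  intro v hv w hw e
  rw [← h.gf v (hW v hv), e, h.gf w (hW w hw)]

lemma SI.dim_eq (h : SI M N f g k) (hM : DC M) {F : CubeFace a} (hF : F ∈ M) {G : CubeFace b}
    (e : verts G = f '' verts F) : dim G = dim F := by
  apply dim_of_ncard
  rw [e, (h.injOn (verts_mem hM hF)).ncard_image]

lemma SI.image_inter (h : SI M N f g k) (hM : DC M) {F G : CubeFace a} (hF : F ∈ M) (hG : G ∈ M)
    (hd : Disjoint (verts F) (verts G)) : Disjoint (f '' verts F) (f '' verts G) := by
  rw [Set.disjoint_left]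
  rintro _ ⟨v, hv, rfl⟩ ⟨w, hw, e⟩
  have : v = w := by rw [← h.gf v (verts_mem hM hF v hv), ← e, h.gf w (verts_mem hM hG w hw)]
  subst this
  exact Set.disjoint_left.1 hd hv hw

/-- flip of a coordinate -/
def flip (c : Fin a) (v : Fin a → Bool) : Fin a → Bool := fun j => if j = c then !v j else v j

lemma flip_same (c : Fin a) (v : Fin a → Bool) : flip c v c = !v c := by simp [flip]
lemma flip_ne {c j : Fin a} (v : Fin a → Bool) (h : j ≠ c) : flip c v j = v j := by simp [flip, h]

/-- the edge at `v` -/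
lemma edge_le {F : CubeFace a} {v : Fin a → Bool} (hv : v ∈ verts F) {c : Fin a} (hc : F c = none) :
    upd (toFace v) c none ≤ F := by
  intro j
  by_cases hj : j = c
  · subst hj; exact Or.inl hc
  · rw [upd_ne _ _ hj]; exact hv j

lemma edge_dim (v : Fin a → Bool) (c : Fin a) : dim (upd (toFace v) c none) = 1 := by
  rw [dim_upd_none (by simp [toFace]), dim_toFace]

lemma edge_flip {E : CubeFace a} (hE : dim E = 1) {v w : Fin a → Bool} (hv : v ∈ verts E)
    (hw : w ∈ verts E) {c : Fin a} (hc : v c ≠ w c) : w = flip c v := by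
  have hEc : E c = none := by
    rcases mem_verts.1 hv c with e | e
    · exact e
    · rcases mem_verts.1 hw c with e' | e'
      · exact e'
      · rw [e] at e'; exact absurd (by simpa using e') hc
  have hu : ∀ j, j ≠ c → E j ≠ none := by
    intro j hj hn
    have : ({j, c} : Finset (Fin a)) ⊆ fr E := by
      intro x hx
      simp only [Finset.mem_insert, Finset.mem_singleton] at hx
      rcases hx with rfl | rfl
      · exact mem_fr.2 hn
      · exact mem_fr.2 hEc
    have := Finset.card_le_card this
    rw [Finset.card_pair hj, ← CubManif.dim_eq, hE] at this
    omega
  funext j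
  by_cases hj : j = c
  · subst hj
    rw [flip_same]
    cases h1 : v j <;> cases h2 : w j <;> simp_all
  · rw [flip_ne _ hj]
    have e1 := (mem_verts.1 hv j).resolve_left (hu j hj)
    have e2 := (mem_verts.1 hw j).resolve_left (hu j hj)
    rw [e1] at e2
    simpa using e2.symm

theorem SI.pull (h : SI M N f g k) (hM : DC M) (hN : DC N) (hk : 1 ≤ k) {F : CubeFace b} (hF : F ∈ N)
    (hd : dim F = k + 1) {i : Fin b} (hi : F i = none) : ∃ F' : CubeFace a, ∃ c, F' c = none ∧
      verts F' = g '' verts F ∧ dim F' = k + 1 ∧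
      ∀ x, upd F' c (some x) ∈ M ∧ ∃ y, verts (upd F' c (some x)) = g '' verts (upd F i (some y)) := by
  have hF0 : upd F i (some false) ∈ N := hN F hF _ (upd_le hi _)
  have hF1 : upd F i (some true) ∈ N := hN F hF _ (upd_le hi _)
  have d0 := dim_upd_some hi false
  have d1 := dim_upd_some hi true
  obtain ⟨A, hA, eA⟩ := h.gg _ hF0 (by omega)
  obtain ⟨B, hB, eB⟩ := h.gg _ hF1 (by omega)
  have dA := h.symm.dim_eq hN hF0 eA
  have dB := h.symm.dim_eq hN hF1 eB
  have hdis : Disjoint (verts A) (verts B) := by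
    rw [eA, eB]
    exact h.symm.image_inter hN hF0 hF1 (verts_disj F i)
  obtain ⟨c, hc⟩ : ∃ c, A c ≠ none ∧ B c ≠ none ∧ A c ≠ B c := by
    by_contra hn
    push Not at hn
    have : (verts A ∩ verts B).Nonempty := verts_meet.1 (fun i => by
      by_cases h1 : A i = none
      · exact Or.inl h1
      · by_cases h2 : B i = none
        · exact Or.inr (Or.inl h2)
        · exact Or.inr (Or.inr (hn i h1 h2)))
    exact Set.not_disjoint_iff_nonempty_inter.2 this hdis
  obtain ⟨x, hx⟩ := Option.ne_none_iff_exists'.1 hc.1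
  obtain ⟨x', hx'⟩ := Option.ne_none_iff_exists'.1 hc.2.1
  have hxx : x' = !x := by
    have := hc.2.2
    rw [hx, hx'] at this
    cases x <;> cases x' <;> simp_all
  -- flips
  have hfl : ∀ v ∈ verts A, flip c v ∈ verts B := by
    intro v hv
    have hv' := hv
    rw [eA] at hv'
    obtain ⟨w, hw, rfl⟩ := hv'
    have hwF : w ∈ verts F := verts_mono (upd_le hi _) hw
    have hE := hN F hF _ (edge_le hwF hi)
    obtain ⟨E, hEM, eE⟩ := h.gg _ hE (by rw [edge_dim]; exact hk)
    have dE := h.symm.dim_eq hN hE eE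
    rw [edge_dim] at dE
    have hw1 : w ∈ verts (upd (toFace w) i none) := le_upd _ _
    have hw2 : flip i w ∈ verts (upd (toFace w) i none) := by
      rw [mem_verts]; intro j
      by_cases hj : j = i
      · subst hj; left; simp
      · right; rw [upd_ne _ _ hj, flip_ne _ hj]; rfl
    have hw3 : flip i w ∈ verts (upd F i (some true)) := by
      rw [mem_verts]; intro j
      by_cases hj : j = i
      · subst hj
        right
        have := mem_verts.1 hw j
        simp at this
        rw [flip_same, this]; simp
      · rw [upd_ne _ _ hj, flip_ne _ hj]; exact mem_verts.1 hwF j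
    have hB' : g (flip i w) ∈ verts B := by rw [eB]; exact ⟨_, hw3, rfl⟩
    have : g (flip i w) = flip c (g w) := by
      refine edge_flip dE (by rw [eE]; exact ⟨_, hw1, rfl⟩) (by rw [eE]; exact ⟨_, hw2, rfl⟩) ?_
      have e1 := (mem_verts.1 hv c).resolve_left hc.1
      have e2 := (mem_verts.1 hB' c).resolve_left hc.2.1
      intro e
      rw [e] at e1
      exact hc.2.2 (e1.trans e2.symm)
    rwa [← this]
  have hB2 : upd A c (some (!x)) = B := by
    apply eq_of_le_dim
    · apply verts_sub
      intro v hv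
      have : flip c v ∈ verts A := by
        rw [mem_verts] at *
        intro j
        by_cases hj : j = c
        · subst hj
          right
          have := hv j
          simp at this
          rw [flip_same, hx, ← this]
        · have := hv j
          rwa [upd_ne _ _ hj, ← flip_ne v hj] at this
      have := hfl _ this
      have e : flip c (flip c v) = v := by
        funext j
        by_cases hj : j = c
        · subst hj; rw [flip_same, flip_same]; simp
        · rw [flip_ne _ hj, flip_ne _ hj]
      rwa [e] at this
    · have e1 : fr (upd A c (some (!x))) = fr A := by
        rw [fr_upd_some, Finset.erase_eq_of_notMem]
        rw [mem_fr]; exact hc.1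
      rw [CubManif.dim_eq (upd A c _), e1, ← CubManif.dim_eq]
      omega
  have eu : ∀ y, upd (upd A c none) c y = upd A c y := fun y => upd_upd _ _ _ _
  have hAx : upd A c (some x) = A := upd_self hx
  refine ⟨upd A c none, c, upd_same _ _ _, ?_, ?_, ?_⟩
  · rw [verts_split (upd_same A c none), eu, eu, verts_split hi, Set.image_union, ← eA, ← eB]
    cases x with
    | false => rw [hAx]; simp only [Bool.not_false] at hB2; rw [hB2]
    | true => rw [hAx]; simp only [Bool.not_true] at hB2; rw [hB2, Set.union_comm]
  · rw [dim_upd_none hc.1]; omega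
  · intro y
    rw [eu]
    by_cases hy : y = x
    · subst hy
      rw [hAx]
      exact ⟨hA, false, eA⟩
    · have : y = !x := by cases x <;> cases y <;> simp_all
      rw [this, hB2]
      exact ⟨hB, true, eB⟩

theorem SI.pull_all (h : SI M N f g k) (hM : DC M) (hN : DC N) (hk : 1 ≤ k) {F : CubeFace b} (hF : F ∈ N)
    (hd : dim F = k + 1) : ∃ F' : CubeFace a, verts F' = g '' verts F ∧ dim F' = k + 1 ∧
      ∀ j x, F' j = none → upd F' j (some x) ∈ M := by
  obtain ⟨i0, hi0⟩ : (fr F).Nonempty := by rw [← Finset.card_pos, ← CubManif.dim_eq]; omega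
  obtain ⟨F', -, -, eF', dF', -⟩ := h.pull hM hN hk hF hd (mem_fr.1 hi0)
  refine ⟨F', eF', dF', ?_⟩
  have key : ∀ i, ∃ c, i ∈ fr F → F' c = none ∧ ∀ x, upd F' c (some x) ∈ M ∧
      ∃ y, verts (upd F' c (some x)) = g '' verts (upd F i (some y)) := by
    intro i
    by_cases hi : i ∈ fr F
    · obtain ⟨G, c, h1, h2, h3, h4⟩ := h.pull hM hN hk hF hd (mem_fr.1 hi)
      have : G = F' := verts_inj (h2.trans eF'.symm)
      subst this
      exact ⟨c, fun _ => ⟨h1, h4⟩⟩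
    · obtain ⟨c, -⟩ : (fr F').Nonempty := by rw [← Finset.card_pos, ← CubManif.dim_eq]; omega
      exact ⟨c, fun h => absurd h hi⟩
  choose c hc using key
  have hsurj := Finset.surjOn_of_injOn_of_card_le (s := fr F) (t := fr F') c
    (fun i hi => mem_fr.2 (hc i hi).1) (by
      intro i hi j hj e
      by_contra hij
      obtain ⟨-, y, hy⟩ := (hc i hi).2 true
      obtain ⟨-, z, hz⟩ := (hc j hj).2 true
      rw [e, hz] at hy
      have hiN := hN F hF _ (upd_le (mem_fr.1 hi) (some y))
      have hjN := hN F hF _ (upd_le (mem_fr.1 hj) (some z))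
      have e2 := congrArg (fun W => f '' W) hy
      simp only [h.symm.img_sub (verts_mem hN hiN), h.symm.img_sub (verts_mem hN hjN)] at e2
      have e3 := congrFun (verts_inj e2) i
      rw [upd_same, upd_ne _ _ hij, mem_fr.1 hi] at e3
      simp at e3)
    (by rw [← CubManif.dim_eq, ← CubManif.dim_eq, hd, dF'])
  intro j x hj
  obtain ⟨i, hi, rfl⟩ := hsurj (mem_fr.2 hj)
  exact ((hc i hi).2 x).1

end verts
end CubManif

namespace CubManif
open Finsupp hiding some add_apply
open CubeFace

section transfer
open scoped Classical
variable {a b d : ℕ}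

/-- An isomorphism of cell sets. -/
structure CI (S : Set (Cell a)) (T : Set (Cell b)) (U : Set (Cell a)) (V : Set (Cell b))
    (φ : Cell a → Cell b) (ψ : Cell b → Cell a) : Prop where
  fS : ∀ C ∈ S, φ C ∈ T
  gT : ∀ C ∈ T, ψ C ∈ S
  gf : ∀ C ∈ S, ψ (φ C) = C
  fg : ∀ C ∈ T, φ (ψ C) = C
  cS : ∀ C ∈ S, ∀ C', IsFacet C' C → C' ∈ S
  cT : ∀ C ∈ T, ∀ C', IsFacet C' C → C' ∈ T
  ff : ∀ C ∈ S, ∀ C', IsFacet C' C → IsFacet (φ C') (φ C)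
  fg' : ∀ C ∈ T, ∀ C', IsFacet C' C → IsFacet (ψ C') (ψ C)
  fU : ∀ C ∈ S, C ∈ U → φ C ∈ V
  gV : ∀ C ∈ T, C ∈ V → ψ C ∈ U
  df : ∀ C ∈ S, cdeg (φ C) = cdeg C
  dg : ∀ C ∈ T, cdeg (ψ C) = cdeg C

variable {S : Set (Cell a)} {T : Set (Cell b)} {U : Set (Cell a)} {V : Set (Cell b)}
    {φ : Cell a → Cell b} {ψ : Cell b → Cell a}

lemma CI.symm (h : CI S T U V φ ψ) : CI T S V U ψ φ :=
  ⟨h.gT, h.fS, h.fg, h.gf, h.cT, h.cS, h.fg', h.ff, h.gV, h.fU, h.dg, h.df⟩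

/-- pull back of chains along `ψ` on `T` -/
noncomputable def pb (T : Set (Cell b)) (ψ : Cell b → Cell a) : Ch (Cell a) →ₗ[ZMod 2] Ch (Cell b) where
  toFun z := Finsupp.equivFunOnFinite.symm (fun D => if D ∈ T then z (ψ D) else 0)
  map_add' x y := by
    ext D
    by_cases h : D ∈ T <;> simp [h]
  map_smul' c x := by
    ext D
    by_cases h : D ∈ T <;> simp [h]

lemma pb_apply (T : Set (Cell b)) (ψ : Cell b → Cell a) (z : Ch (Cell a)) (D : Cell b) :
    pb T ψ z D = if D ∈ T then z (ψ D) else 0 := by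
  simp [pb]

lemma pb_pos {T : Set (Cell b)} (ψ : Cell b → Cell a) (z : Ch (Cell a)) {D : Cell b} (h : D ∈ T) :
    pb T ψ z D = z (ψ D) := by rw [pb_apply, if_pos h]

lemma pb_neg {T : Set (Cell b)} (ψ : Cell b → Cell a) (z : Ch (Cell a)) {D : Cell b} (h : D ∉ T) :
    pb T ψ z D = 0 := by rw [pb_apply, if_neg h]

lemma pb_mem (z : Ch (Cell a)) : pb T ψ z ∈ spt T := by
  rw [mem_spt]; intro D hD
  by_contra hn
  exact hD (pb_neg _ _ hn)

lemma CI.pb_single (h : CI S T U V φ ψ) {C : Cell a} (hC : C ∈ S) : pb T ψ (single C 1) = single (φ C) 1 := by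
  ext D
  by_cases hD : D ∈ T
  · rw [pb_pos _ _ hD, Finsupp.single_apply, Finsupp.single_apply]
    congr 1
    apply propext
    constructor
    · rintro rfl; exact h.fg D hD
    · rintro rfl; exact (h.gf C hC).symm
  · rw [pb_neg _ _ hD, Finsupp.single_apply, if_neg]
    rintro rfl
    exact hD (h.fS C hC)

lemma zmod2_ext {x y : ZMod 2} (h : x ≠ 0 ↔ y ≠ 0) : x = y := by
  rcases zmod2_cases x with rfl | rfl <;> rcases zmod2_cases y with rfl | rfl <;> simp_all

lemma CI.pb_bd (h : CI S T U V φ ψ) {z : Ch (Cell a)} (hz : z ∈ spt S) :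
    bd (pb T ψ z) = pb T ψ (bd z) := by
  refine map_eq_spt (bd ∘ₗ pb T ψ) (pb T ψ ∘ₗ bd) ?_ hz
  intro C hC
  simp only [LinearMap.comp_apply]
  rw [h.pb_single hC]
  ext D
  by_cases hD : D ∈ T
  · rw [pb_pos _ _ hD]
    apply zmod2_ext
    rw [bd_coeff, bd_coeff]
    constructor
    · intro hf
      have := h.fg' _ (h.fS C hC) _ hf
      rwa [h.gf C hC] at this
    · intro hf
      have := h.ff _ hC _ hf
      rwa [h.fg D hD] at this
  · rw [pb_neg _ _ hD]
    by_contra hn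
    exact hD (h.cT _ (h.fS C hC) _ ((bd_coeff _ _).1 hn))

lemma CI.pb_R (h : CI S T U V φ ψ) (z : Ch (Cell a)) : pb T ψ (R U z) = R V (pb T ψ z) := by
  ext D
  by_cases hD : D ∈ T
  · by_cases hV : D ∈ V
    · rw [pb_pos _ _ hD, R_pos _ hV, R_pos _ (h.gV D hD hV), pb_pos _ _ hD]
    · rw [pb_pos _ _ hD, R_neg _ hV, R_neg]
      intro hU
      apply hV
      have := h.fU _ (h.gT D hD) hU
      rwa [h.fg D hD] at this
  · by_cases hV : D ∈ V
    · rw [pb_neg _ _ hD, R_pos _ hV, pb_neg _ _ hD]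
    · rw [pb_neg _ _ hD, R_neg _ hV]

lemma CI.pb_pb (h : CI S T U V φ ψ) {z : Ch (Cell a)} (hz : z ∈ spt S) : pb S φ (pb T ψ z) = z := by
  ext C
  by_cases hC : C ∈ S
  · rw [pb_pos _ _ hC, pb_pos _ _ (h.fS C hC), h.gf C hC]
  · rw [pb_neg _ _ hC]
    by_contra hn
    exact hC (mem_spt.1 hz C (Ne.symm hn))

lemma CI.pb_spt (h : CI S T U V φ ψ) {z : Ch (Cell a)} (hz : z ∈ spt U) : pb T ψ z ∈ spt V := by
  rw [← R_eq, ← h.pb_R, R_eq.2 hz]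

lemma CI.pb_gr (h : CI S T U V φ ψ) {z : Ch (Cell a)} {q : ℕ} (hz : z ∈ spt ((cellBC a).gr q)) :
    pb T ψ z ∈ spt ((cellBC b).gr q) := by
  rw [mem_spt] at *
  intro D hD
  by_cases hT : D ∈ T
  · rw [pb_pos _ _ hT] at hD
    have : cdeg (ψ D) = q := hz _ hD
    rw [h.dg D hT] at this
    exact this
  · exact absurd (pb_neg _ _ hT) hD

theorem transfer {M : Set (CubeFace a)} {N : Set (CubeFace b)} {U : Set (CubeFace a)}
    {V : Set (CubeFace b)} {q : ℕ} (h : CI S T (cs U) (cs V) φ ψ)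
    (hS : ∀ C, C ∈ cs U → cdeg C ≤ q + 1 → C ∈ S) (hT : ∀ C, C ∈ cs V → cdeg C ≤ q + 1 → C ∈ T)
    (hq : q ≠ d + 1) (hQ : QQ M d U q) (hP : PP N d V) : False := by
  obtain ⟨ζ, hζ, hζq, hζd, hζn⟩ := hQ
  have hζS : ζ ∈ spt S := by
    rw [mem_spt]
    intro C hC
    have h2 : cdeg C = q := mem_spt.1 hζq C hC
    exact hS C (mem_spt.1 hζ C hC) (by omega)
  obtain ⟨u, hu, c, e⟩ := hP (pb T ψ ζ) (h.pb_spt hζ) (by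
    rw [h.pb_bd hζS, ← h.pb_R, hζd, map_zero])
  have e2 := congrArg (R ((cellBC b).gr q)) e
  have hΩ : R ((cellBC b).gr q) (R (cs V) (Om N d)) = 0 := by
    ext C
    by_cases hC : C ∈ (cellBC b).gr q
    · rw [R_pos _ hC]
      have h0 : Om N d C = 0 := by
        by_contra hn
        have h1 : cdeg C = d + 1 := (mem_spt.1 (Om_spt N d) C hn).2
        have h2 : cdeg C = q := hC
        omega
      by_cases hV : C ∈ cs V
      · rw [R_pos _ hV, h0]; rfl
      · rw [R_neg _ hV]; rfl
    · rw [R_neg _ hC]; rfl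
  rw [R_eq.2 (h.pb_gr hζq), map_add, map_smul, hΩ, smul_zero, add_zero, R_R, Set.inter_comm, ← R_R] at e2
  have e3 := (cellBC b).d_gr q u
  change bd _ = R _ (bd u) at e3
  rw [← e3] at e2
  set u' := R ((cellBC b).gr (q+1)) u with hu'
  have m1 : u' ∈ spt ((cellBC b).gr (q+1) ∩ cs V) := R_spt _ _ hu
  have m2 : u' ∈ spt T := by
    rw [mem_spt]
    intro C hC
    have h2 := mem_spt.1 m1 C hC
    have h3 : cdeg C = q + 1 := h2.1
    exact hT C h2.2 (by omega)
  have m3 : u' ∈ spt (cs V) := spt_mono Set.inter_subset_right m1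
  apply hζn
  refine ⟨pb S φ u', h.symm.pb_spt m3, 0, ?_⟩
  rw [zero_smul, add_zero, h.symm.pb_bd m2, ← h.symm.pb_R, ← e2, h.pb_pb hζS]

/-- Translation of cells along a vertex map. -/
noncomputable def tr (N : Set (CubeFace b)) (f : (Fin a → Bool) → (Fin b → Bool)) : Cell a → Cell b
  | none => none
  | some F => if h : ∃ G ∈ N, verts G = f '' verts F then some h.choose else none

variable {M : Set (CubeFace a)} {N : Set (CubeFace b)} {f : (Fin a → Bool) → (Fin b → Bool)}
    {g : (Fin b → Bool) → (Fin a → Bool)} {k : ℕ}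

/-- low dimensional cells -/
def lw (M : Set (CubeFace a)) (k : ℕ) : Set (Cell a) := {C | ∀ F, C = some F → F ∈ M ∧ dim F ≤ k}

lemma none_lw : none ∈ lw M k := by simp [lw]
lemma some_lw {F : CubeFace a} : some F ∈ lw M k ↔ F ∈ M ∧ dim F ≤ k := by simp [lw]

lemma SI.tr_some (h : SI M N f g k) (hM : DC M) {F : CubeFace a} (hF : F ∈ M) (hk : dim F ≤ k) :
    ∃ G ∈ N, tr N f (some F) = some G ∧ verts G = f '' verts F ∧ dim G = dim F := by
  have hx := h.ff F hF hk
  refine ⟨hx.choose, hx.choose_spec.1, ?_, hx.choose_spec.2, h.dim_eq hM hF hx.choose_spec.2⟩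
  simp only [tr]
  rw [dif_pos hx]

lemma SI.tr_lw (h : SI M N f g k) (hM : DC M) : ∀ C ∈ lw M k, tr N f C ∈ lw N k := by
  intro C hC
  cases C with
  | none => exact none_lw
  | some F =>
    obtain ⟨h1, h2⟩ := some_lw.1 hC
    obtain ⟨G, hG, e, -, dG⟩ := h.tr_some hM h1 h2
    rw [e, some_lw]
    exact ⟨hG, by omega⟩

lemma SI.tr_tr (h : SI M N f g k) (hM : DC M) (hN : DC N) : ∀ C ∈ lw M k, tr M g (tr N f C) = C := by
  intro C hC
  cases C with
  | none => rfl
  | some F =>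
    obtain ⟨h1, h2⟩ := some_lw.1 hC
    obtain ⟨G, hG, e, e', dG⟩ := h.tr_some hM h1 h2
    obtain ⟨H, hH, e1, e1', dH⟩ := h.symm.tr_some hN hG (by omega)
    rw [e, e1]
    congr 1
    apply verts_inj
    rw [e1', e', h.img_sub (verts_mem hM h1)]

lemma lw_facet (hM : DC M) : ∀ C ∈ lw M k, ∀ C', IsFacet C' C → C' ∈ lw M k := by
  intro C hC C' hf
  cases C with
  | none => cases C' <;> exact hf.elim
  | some F =>
    obtain ⟨h1, h2⟩ := some_lw.1 hC
    cases C' with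
    | none => exact none_lw
    | some G =>
      rw [some_lw]
      exact ⟨hM F h1 G hf.1, (dim_mono hf.1).trans h2⟩

lemma SI.tr_facet (h : SI M N f g k) (hM : DC M) : ∀ C ∈ lw M k, ∀ C', IsFacet C' C →
    IsFacet (tr N f C') (tr N f C) := by
  intro C hC C' hf
  have hC' := lw_facet hM C hC C' hf
  cases C with
  | none => cases C' <;> exact hf.elim
  | some F =>
    obtain ⟨h1, h2⟩ := some_lw.1 hC
    obtain ⟨G, hG, e, e', dG⟩ := h.tr_some hM h1 h2
    rw [e]
    cases C' with
    | none =>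
      have hf' : dim F = 0 := hf
      show dim G = 0
      omega
    | some F' =>
      obtain ⟨h1', h2'⟩ := some_lw.1 hC'
      obtain ⟨G', hG', e1, e1', dG'⟩ := h.tr_some hM h1' h2'
      rw [e1]
      have hf' : F' ≤ F ∧ dim F' + 1 = dim F := hf
      show G' ≤ G ∧ dim G' + 1 = dim G
      refine ⟨verts_sub ?_, by omega⟩
      rw [e1', e']
      exact Set.image_mono (verts_mono hf'.1)

lemma SI.tr_deg (h : SI M N f g k) (hM : DC M) : ∀ C ∈ lw M k, cdeg (tr N f C) = cdeg C := by
  intro C hC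
  cases C with
  | none => rfl
  | some F =>
    obtain ⟨h1, h2⟩ := some_lw.1 hC
    obtain ⟨G, hG, e, -, dG⟩ := h.tr_some hM h1 h2
    rw [e, cdeg_some, cdeg_some, dG]

lemma SI.tr_U (h : SI M N f g k) (hM : DC M) {F : CubeFace a} {F' : CubeFace b}
    (hF : f '' verts F ⊆ verts F') :
    ∀ C ∈ lw M k, C ∈ cs (UU M F ∅) → tr N f C ∈ cs (UU N F' ∅) := by
  rintro C hC ⟨E, hE, rfl⟩
  obtain ⟨h1, h2⟩ := some_lw.1 hC
  obtain ⟨G, hG, e, e', dG⟩ := h.tr_some hM h1 h2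
  rw [e, some_cs]
  refine ⟨hG, ?_, by simp⟩
  rw [verts_meet]
  obtain ⟨v, hv1, hv2⟩ := verts_meet.1 hE.2.1
  refine ⟨f v, ?_, hF ⟨v, hv2, rfl⟩⟩
  rw [e']
  exact ⟨v, hv1, rfl⟩

lemma SI.ci (h : SI M N f g k) (hM : DC M) (hN : DC N) {F : CubeFace a} {F' : CubeFace b}
    (hF : f '' verts F ⊆ verts F') (hF' : g '' verts F' ⊆ verts F) :
    CI (lw M k) (lw N k) (cs (UU M F ∅)) (cs (UU N F' ∅)) (tr N f) (tr M g) where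
  fS := h.tr_lw hM
  gT := h.symm.tr_lw hN
  gf := h.tr_tr hM hN
  fg := h.symm.tr_tr hN hM
  cS := lw_facet hM
  cT := lw_facet hN
  ff := h.tr_facet hM
  fg' := h.symm.tr_facet hN
  fU := h.tr_U hM hF
  gV := h.symm.tr_U hN hF'
  df := h.tr_deg hM
  dg := h.symm.tr_deg hN

theorem SI.ext (h : SI M N f g k) (hM : CM M d) (hN : CM N d) (hk : d / 2 + 1 ≤ k) (hkd : k + 1 ≤ d)
    {F : CubeFace b} (hF : F ∈ N) (hFd : dim F = k + 1) : ∃ F' ∈ M, verts F' = g '' verts F := by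
  obtain ⟨F', eF', dF', hF'⟩ := h.pull_all hM.dc hN.dc (by omega) hF hFd
  by_contra hn
  have hF'M : F' ∉ M := fun hm => hn ⟨F', hm, eF'⟩
  have hQ := UU_Q hM hF'M (fun i b hi => hF' i b hi) k ∅ (Finset.empty_subset _)
    (by rw [Finset.sdiff_empty, ← CubManif.dim_eq, dF']) (d + 1 - k) (by omega)
  have hP := UU_P hN _ F hF ∅ (Finset.empty_subset _) rfl
  refine transfer (h.ci hM.dc hN.dc (F := F') (F' := F) ?_ eF'.ge) ?_ ?_ ?_ hQ hP
  · rw [eF', h.symm.img_sub (verts_mem hN.dc hF)]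
  · rintro C ⟨E, hE, rfl⟩ hd
    rw [cdeg_some] at hd
    exact some_lw.2 ⟨hE.1, by omega⟩
  · rintro C ⟨E, hE, rfl⟩ hd
    rw [cdeg_some] at hd
    exact some_lw.2 ⟨hE.1, by omega⟩
  · omega

theorem SI.step (h : SI M N f g k) (hM : CM M d) (hN : CM N d) (hk : d / 2 + 1 ≤ k) (hkd : k + 1 ≤ d) :
    SI M N f g (k + 1) := by
  refine ⟨h.fm, h.gm, h.gf, h.fg, ?_, ?_⟩
  · intro F hF hd
    rcases Nat.lt_or_ge (dim F) (k + 1) with hl | hl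
    · exact h.ff F hF (by omega)
    · exact h.symm.ext hN hM hk hkd hF (by omega)
  · intro F hF hd
    rcases Nat.lt_or_ge (dim F) (k + 1) with hl | hl
    · exact h.gg F hF (by omega)
    · exact h.ext hM hN hk hkd hF (by omega)

theorem SI.full (hM : CM M d) (hN : CM N d) (h : SI M N f g (d / 2 + 1)) : ∃ k, d ≤ k ∧ SI M N f g k := by
  have key : ∀ n, d / 2 + 1 + n ≤ d → SI M N f g (d / 2 + 1 + n) := by
    intro n
    induction n with
    | zero => intro _; exact h
    | succ n ih => intro hn; exact (ih (by omega)).step hM hN (by omega) (by omega)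
  rcases Nat.lt_or_ge d (d / 2 + 1) with hl | hl
  · exact ⟨_, hl.le, h⟩
  · refine ⟨_, ?_, key (d - (d / 2 + 1)) (by omega)⟩
    omega

theorem SI.iso (h : SI M N f g k) (hM : DC M) (hN : DC N) (hMd : ∀ F ∈ M, dim F ≤ k)
    (hNd : ∀ F ∈ N, dim F ≤ k) : Iso M N := by
  refine ⟨f, ⟨h.fm, ?_, ?_⟩, ?_⟩
  · intro v hv w hw e
    rw [← h.gf v hv, e, h.gf w hw]
  · intro w hw
    exact ⟨g w, h.gm w hw, h.fg w hw⟩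
  · intro W hW
    constructor
    · rintro ⟨F, hF, rfl⟩
      exact h.ff F hF (hMd F hF)
    · rintro ⟨G, hG, e⟩
      obtain ⟨F, hF, eF⟩ := h.gg G hG (hNd G hG)
      refine ⟨F, hF, ?_⟩
      rw [eF, e, h.img_sub hW]

lemma cvert_skel (k : ℕ) : cvert (skel k M) = cvert M := by
  ext v
  constructor
  · intro h; exact h.1
  · intro h; exact ⟨h, by rw [dim_toFace]; omega⟩

theorem SI_of_iso (hM : DC M) (hN : DC N) (h : Iso (skel k M) (skel k N)) : ∃ f g, SI M N f g k := by
  obtain ⟨f, hf, hW⟩ := h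
  rw [cvert_skel, cvert_skel] at hf
  rw [cvert_skel] at hW
  have hinv := hf.invOn_invFunOn
  have hg : Set.MapsTo (Function.invFunOn f (cvert M)) (cvert N) (cvert M) :=
    hf.surjOn.mapsTo_invFunOn
  refine ⟨f, Function.invFunOn f (cvert M), ?_⟩
  set g := Function.invFunOn f (cvert M)
  refine ⟨fun v hv => hf.mapsTo hv, fun v hv => hg hv, fun v hv => hinv.1 hv, fun v hv => hinv.2 hv, ?_, ?_⟩
  · intro F hF hd
    obtain ⟨G, hG, e⟩ := (hW (verts F) (verts_mem hM hF)).1 ⟨F, ⟨hF, hd⟩, rfl⟩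
    exact ⟨G, hG.1, e⟩
  · intro G hG hd
    have hsub : verts G ⊆ cvert N := verts_mem hN hG
    have e : f '' (g '' verts G) = verts G := by
      ext v
      constructor
      · rintro ⟨_, ⟨w, hw, rfl⟩, rfl⟩
        rwa [hinv.2 (hsub hw)]
      · intro hv
        exact ⟨g v, ⟨v, hv, rfl⟩, hinv.2 (hsub hv)⟩
    obtain ⟨F, hF, e2⟩ := (hW (g '' verts G) (by
      rintro _ ⟨w, hw, rfl⟩
      exact hg (hsub hw))).2 ⟨G, ⟨hG, hd⟩, e.symm⟩
    exact ⟨F, hF.1, e2⟩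

end transfer
end CubManif

open CubeFace in
/-- a `d`-dimensional cubical manifold embedded in a cube is determined by
its `(⌊d/2⌋ + 1)`-skeleton. -/
theorem cubical_manifold_determined_by_skeleton
    {a b d : ℕ} (hd : 1 ≤ d)
    (M : Set (CubeFace a)) (hM : IsSubcomplex M) (hMd : HasDim M d)
    (hmanM : IsCompactManifold (↥(real M)) d)
    (N : Set (CubeFace b)) (hN : IsSubcomplex N) (hNd : HasDim N d)
    (hmanN : IsCompactManifold (↥(real N)) d)
    (hskel : Iso (skel (d / 2 + 1) M) (skel (d / 2 + 1) N)) :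
    Iso M N := by
  have cM := CubManif.combman hM.2 hMd.1 hd hmanM.2
  have cN := CubManif.combman hN.2 hNd.1 hd hmanN.2
  obtain ⟨f, g, h⟩ := CubManif.SI_of_iso hM.2 hN.2 hskel
  obtain ⟨k, hk, h'⟩ := h.full cM cN
  exact h'.iso hM.2 hN.2 (fun F hF => (hMd.1 F hF).trans hk) (fun F hF => (hNd.1 F hF).trans hk)
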